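/- Let c ∈ ℂ. The function 1 − c·b is cyclic for S_b if and only if one of the following three cases holds: (i) |c| < 1; (ii) |c| = 1 and the Aleksandrov–Clark measure μ_{conj(c)} of b is absolutely continuous with respect to m; (iii) |c| > 1 and 1 − c·b is outer. -/

import Mathlib

open MeasureTheory Complex Filter Set Metric
open scoped ComplexConjugate

noncomputable section

/-- The circle group `ℝ / 2πℤ`, parametrizing the unit circle `𝕋`. -/
instance fact_two_pi_pos : Fact (0 < 2 * Real.pi) := ⟨by positivity⟩

abbrev Tc : Type := AddCircle (2 * Real.pi)

/-- Normalized Lebesgue measure on the circle. -/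
def m : Measure Tc := AddCircle.haarAddCircle

instance : IsProbabilityMeasure m := by unfold m; infer_instance

/-- The point `e^{iθ}` of the unit circle corresponding to `θ ∈ ℝ/2πℤ`. -/
def bd (θ : Tc) : ℂ := (AddCircle.toCircle θ : ℂ)

/-- The open unit disc. -/
abbrev uDisc : Set ℂ := Metric.ball (0 : ℂ) 1

/-- A function holomorphic on the open unit disc. -/
def HolDisc (f : ℂ → ℂ) : Prop := DifferentiableOn ℂ f uDisc

/-- `F` is the radial (a.e.) boundary function of `f`. -/
def IsBdry (f : ℂ → ℂ) (F : Tc → ℂ) : Prop :=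
  ∀ᵐ θ ∂m, Tendsto (fun r : ℝ => f ((r : ℂ) * bd θ)) (nhdsWithin 1 (Set.Iio 1)) (nhds (F θ))

/-- Membership in the Hardy space `H^p` of the unit disc, `0 < p < ∞`. -/
def MemHp (p : ℝ) (f : ℂ → ℂ) : Prop :=
  HolDisc f ∧ ∃ C : ℝ, ∀ r : ℝ, 0 ≤ r → r < 1 →
    (∫ θ : Tc, ‖f ((r : ℂ) * bd θ)‖ ^ p ∂m) ≤ C

/-- Membership in `H^∞`: bounded holomorphic functions on the disc. -/
def MemHinf (f : ℂ → ℂ) : Prop := HolDisc f ∧ ∃ C : ℝ, ∀ z ∈ uDisc, ‖f z‖ ≤ C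

/-- Outer functions on the unit disc. -/
def OuterFn (f : ℂ → ℂ) : Prop :=
  HolDisc f ∧ ∃ (α : ℂ) (w : Tc → ℝ), ‖α‖ = 1 ∧ (∀ θ, 0 ≤ w θ) ∧
    Integrable (fun θ => Real.log (w θ)) m ∧
    ∀ z ∈ uDisc,
      f z = α * Complex.exp (∫ θ : Tc, ((bd θ + z) / (bd θ - z)) * (Real.log (w θ) : ℂ) ∂m)

/-- Inner functions: `Θ` holomorphic bounded by one, with unimodular boundary values `Θs`. -/
def InnerFn (Θ : ℂ → ℂ) (Θs : Tc → ℂ) : Prop :=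
  HolDisc Θ ∧ (∀ z ∈ uDisc, ‖Θ z‖ ≤ 1) ∧ IsBdry Θ Θs ∧ (∀ᵐ θ ∂m, ‖Θs θ‖ = 1)

/-- `L²(𝕋, m)`. -/
abbrev L2 : Type := Lp ℂ 2 m

/-- The Hardy space `H²`, viewed inside `L²(𝕋)` as the functions whose negative
Fourier coefficients vanish. -/
def H2 : Set L2 := {F | ∀ n : ℤ, n < 0 → fourierCoeff (F : Tc → ℂ) n = 0}

/-- The Cauchy kernel `k_λ(z) = 1/(1 - conj(λ) z)`. -/
def ker (lam z : ℂ) : ℂ := (1 - conj lam * z)⁻¹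

/-- Divergence of `Σ (1 - |λ_n|)` (for `λ_n` in the unit disc this is the negation of
the Blaschke condition). -/
def NotBlaschke (lam : ℕ → ℂ) : Prop := ¬ Summable (fun n => 1 - ‖lam n‖)

/-- A bundle recording: a non-constant function `b` in the closed unit ball of `H^∞`
with `log(1 - |b|) ∈ L¹(𝕋)`, its Pythagorean mate `a` (outer, `a(0) > 0`,
`|a|² + |b|² = 1` a.e.), together with their boundary functions `bs`, `as'`. -/
structure BPair where
  b : ℂ → ℂ
  a : ℂ → ℂ
  bs : Tc → ℂ
  as' : Tc → ℂ
  b_hol : HolDisc b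
  b_le_one : ∀ z ∈ uDisc, ‖b z‖ ≤ 1
  b_nonconst : ¬ ∃ c : ℂ, ∀ z ∈ uDisc, b z = c
  b_bdry : IsBdry b bs
  log_int : Integrable (fun θ => Real.log (1 - ‖bs θ‖)) m
  a_outer : OuterFn a
  a_bdry : IsBdry a as'
  a0_pos : ∃ r : ℝ, 0 < r ∧ a 0 = (r : ℂ)
  pyth : ∀ᵐ θ ∂m, ‖as' θ‖ ^ 2 + ‖bs θ‖ ^ 2 = 1

/-- The defining relation of `H(b)`: `T_{conj b} F = T_{conj a} F⁺`, i.e. all nonnegative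
Fourier coefficients of `conj(b)·F - conj(a)·F⁺` vanish, with `F, F⁺ ∈ H²`. -/
def HbMem (P : BPair) (F Fp : L2) : Prop :=
  F ∈ H2 ∧ Fp ∈ H2 ∧ ∀ n : ℤ, 0 ≤ n →
    fourierCoeff (fun θ => conj (P.bs θ) * (F : Tc → ℂ) θ - conj (P.as' θ) * (Fp : Tc → ℂ) θ) n = 0

/-- The ambient Hilbert space `L² ×_2 L²` in which `H(b)` embeds isometrically via
`f ↦ (f, f⁺)`; its norm is `‖(F, F⁺)‖² = ‖F‖₂² + ‖F⁺‖₂²`, the `H(b)` norm. -/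
abbrev HbP : Type := WithLp 2 (L2 × L2)

def fst2 (p : HbP) : L2 := ((WithLp.equiv 2 (L2 × L2)) p).1
def snd2 (p : HbP) : L2 := ((WithLp.equiv 2 (L2 × L2)) p).2

/-- The de Branges–Rovnyak space `H(b)`, as the set of pairs `(f, f⁺)`. -/
def HbSet (P : BPair) : Set HbP := {p | HbMem P (fst2 p) (snd2 p)}

/-- `q` represents the element `φ · f` of `H(b)`, where `p` represents `f` and `φs` is a
boundary function: `q ∈ H(b)` and the first component of `q` is `φs` times that of `p`. -/
def MulRep (P : BPair) (φs : Tc → ℂ) (p q : HbP) : Prop :=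
  q ∈ HbSet P ∧ (fst2 q : Tc → ℂ) =ᵐ[m] fun θ => φs θ * (fst2 p : Tc → ℂ) θ

/-- `Zf` is the family of elements `z^n·f`, `n ≥ 0`, of `H(b)`, where `p` represents `f`. -/
def ZFamily (P : BPair) (p : HbP) (Zf : ℕ → HbP) : Prop :=
  ∀ n : ℕ, MulRep P (fun θ => (bd θ) ^ n) p (Zf n)

/-- `f` (represented by the pair `p`) is cyclic for `S_b`: the linear span of
`{z^n f : n ≥ 0}` is dense in `H(b)`. -/
def CyclicSb (P : BPair) (p : HbP) : Prop :=
  p ∈ HbSet P ∧ ∀ Zf : ℕ → HbP, ZFamily P p Zf →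
    closure (↑(Submodule.span ℂ (Set.range Zf)) : Set HbP) = HbSet P

/-- `FK` is the family of elements `f·k_{λ_n}`, `n ≥ 0`, of `H(b)`. -/
def KFamily (P : BPair) (lam : ℕ → ℂ) (p : HbP) (FK : ℕ → HbP) : Prop :=
  ∀ n : ℕ, MulRep P (fun θ => ker (lam n) (bd θ)) p (FK n)

/-- `C` is a bound for the norm of the shift `S_b` on `H(b)`. -/
def ShiftBound (P : BPair) (C : ℝ) : Prop :=
  0 ≤ C ∧ ∀ p q : HbP, p ∈ HbSet P → MulRep P (fun θ => bd θ) p q → ‖q‖ ≤ C * ‖p‖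

/-- `N = ‖S_b‖`, the operator norm of the shift on `H(b)`. -/
def IsShiftNorm (P : BPair) (N : ℝ) : Prop :=
  ShiftBound P N ∧ ∀ C : ℝ, ShiftBound P C → N ≤ C

/-- `μ` is the Aleksandrov–Clark measure `μ_α` of `b`. -/
def IsACMeasure (P : BPair) (α : ℂ) (μ : Measure Tc) : Prop :=
  IsFiniteMeasure μ ∧ ∀ z ∈ uDisc,
    (1 - ‖P.b z‖ ^ 2) / ‖1 - conj α * P.b z‖ ^ 2 = ∫ θ : Tc, (1 - ‖z‖ ^ 2) / ‖z - bd θ‖ ^ 2 ∂μ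


section
open scoped InnerProductSpace ENNReal
open scoped InnerProductSpace ENNReal

/-- Exponential basis vectors of L2. -/
def ee (n : ℤ) : L2 := (fourierLp 2 n : Lp ℂ 2 (AddCircle.haarAddCircle (T := 2 * Real.pi)))

lemma ee_coe (n : ℤ) : (ee n : Tc → ℂ) =ᵐ[m] fun θ => fourier n θ := coeFn_fourierLp 2 n

lemma norm_fourier_pt (n : ℤ) (θ : Tc) : ‖fourier n θ‖ = 1 := by
  rw [fourier_apply]; exact Circle.norm_coe _

lemma bd_pow (n : ℕ) (θ : Tc) : bd θ ^ n = fourier (n : ℤ) θ := by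
  rw [fourier_apply, bd, natCast_zsmul]
  rw [AddCircle.toCircle_nsmul]; simp

lemma norm_bd (θ : Tc) : ‖bd θ‖ = 1 := Circle.norm_coe _

lemma continuous_bd : Continuous bd := by
  have := (fourier (T := 2 * Real.pi) 1).continuous
  have h2 : bd = fun θ => fourier (1 : ℤ) θ := by
    ext θ
    have := bd_pow 1 θ
    simpa using this
  rw [h2]; exact this

lemma inner_ee (n : ℤ) (F : L2) : ⟪ee n, F⟫_ℂ = fourierCoeff (F : Tc → ℂ) n := by
  have h := (HilbertBasis.repr_apply_apply (fourierBasis (T := 2 * Real.pi)) F n).symm.trans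
    (fourierBasis_repr (T := 2 * Real.pi) F n)
  rw [coe_fourierBasis] at h
  exact h

lemma fourierCoeff_eq (f : Tc → ℂ) (n : ℤ) : fourierCoeff f n = ∫ θ, conj (fourier n θ) * f θ ∂m := by
  unfold fourierCoeff
  simp only [smul_eq_mul, fourier_neg]; rfl

lemma inner_ee_ee (i j : ℤ) : ⟪ee i, ee j⟫_ℂ = if i = j then 1 else 0 :=
  (orthonormal_iff_ite.1 (orthonormal_fourier (T := 2 * Real.pi))) i j

lemma L2_inner (F G : L2) : ⟪F, G⟫_ℂ = ∫ θ, conj ((F : Tc → ℂ) θ) * (G : Tc → ℂ) θ ∂m := by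
  rw [MeasureTheory.L2.inner_def]; simp only [RCLike.inner_apply']

/-- Essentially bounded functions. -/
def Bdd (φ : Tc → ℂ) : Prop := AEStronglyMeasurable φ m ∧ ∃ C : ℝ, ∀ᵐ θ ∂m, ‖φ θ‖ ≤ C

lemma Bdd.memLp {φ : Tc → ℂ} (h : Bdd φ) (F : L2) :
    MemLp (fun θ => φ θ * (F : Tc → ℂ) θ) 2 m := by
  obtain ⟨h1, C, hC⟩ := h
  refine MemLp.of_le_mul (c := C) (Lp.memLp F) (h1.mul (Lp.aestronglyMeasurable F)) ?_
  filter_upwards [hC] with θ hθ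
  rw [norm_mul]; gcongr

lemma Bdd.memLp2 {φ : Tc → ℂ} (h : Bdd φ) : MemLp φ 2 m := by
  obtain ⟨h1, C, hC⟩ := h
  exact MemLp.of_bound h1 C hC

lemma Bdd.of_cont {φ : Tc → ℂ} (h : Continuous φ) : Bdd φ := by
  refine ⟨h.aestronglyMeasurable, ?_⟩
  obtain ⟨C, hC⟩ := (isCompact_range h).isBounded.exists_norm_le
  exact ⟨C, ae_of_all _ fun θ => hC _ ⟨θ, rfl⟩⟩

lemma Bdd.fourier (n : ℤ) : Bdd (fun θ => fourier n θ) := Bdd.of_cont (by fun_prop)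

lemma Bdd.mul {φ ψ : Tc → ℂ} (h : Bdd φ) (h' : Bdd ψ) : Bdd (fun θ => φ θ * ψ θ) := by
  obtain ⟨h1, C, hC⟩ := h
  obtain ⟨h2, C', hC'⟩ := h'
  refine ⟨h1.mul h2, C * C', ?_⟩
  filter_upwards [hC, hC'] with θ a b
  rw [norm_mul]
  exact mul_le_mul a b (norm_nonneg _) ((norm_nonneg _).trans a)

lemma Bdd.add {φ ψ : Tc → ℂ} (h : Bdd φ) (h' : Bdd ψ) : Bdd (fun θ => φ θ + ψ θ) := by
  obtain ⟨h1, C, hC⟩ := h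
  obtain ⟨h2, C', hC'⟩ := h'
  refine ⟨h1.add h2, C + C', ?_⟩
  filter_upwards [hC, hC'] with θ a b
  exact (norm_add_le _ _).trans (add_le_add a b)

lemma Bdd.const (c : ℂ) : Bdd (fun _ => c) := Bdd.of_cont continuous_const

lemma Bdd.conj {φ : Tc → ℂ} (h : Bdd φ) : Bdd (fun θ => conj (φ θ)) := by
  obtain ⟨h1, C, hC⟩ := h
  exact ⟨continuous_conj.comp_aestronglyMeasurable h1, C, by simpa using hC⟩

lemma Bdd.congr {φ ψ : Tc → ℂ} (h : Bdd φ) (h' : φ =ᵐ[m] ψ) : Bdd ψ := by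
  obtain ⟨h1, C, hC⟩ := h
  refine ⟨h1.congr h', C, ?_⟩
  filter_upwards [hC, h'] with θ a b
  rwa [← b]

lemma Bdd.const_sub_mul {φ : Tc → ℂ} (h : Bdd φ) (d c : ℂ) : Bdd (fun θ => d - c * φ θ) := by
  have := (Bdd.const d).add ((Bdd.const (-c)).mul h)
  refine this.congr (ae_of_all _ fun θ => by ring)

open Classical in
/-- Multiplication operator on L2 by an essentially bounded function (junk 0 otherwise). -/
def mulOp (φ : Tc → ℂ) : L2 →L[ℂ] L2 :=
  if h : Bdd φ then
    LinearMap.mkContinuousOfExistsBound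
      { toFun := fun F => (h.memLp F).toLp
        map_add' := fun F G => by
          rw [← MemLp.toLp_add, MemLp.toLp_eq_toLp_iff]
          filter_upwards [Lp.coeFn_add F G] with θ hθ
          simp only [hθ, Pi.add_apply]; ring
        map_smul' := fun c F => by
          rw [RingHom.id_apply, ← MemLp.toLp_const_smul, MemLp.toLp_eq_toLp_iff]
          filter_upwards [Lp.coeFn_smul c F] with θ hθ
          simp only [hθ, Pi.smul_apply, smul_eq_mul]; ring }
      (by
        obtain ⟨C, hC⟩ := h.2
        refine ⟨C, fun F => ?_⟩
        apply Lp.norm_le_mul_norm_of_ae_le_mul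
        filter_upwards [hC, (h.memLp F).coeFn_toLp] with θ a b
        simp only [LinearMap.coe_mk, AddHom.coe_mk]
        rw [b, norm_mul]; gcongr)
  else 0

lemma mulOp_coe {φ : Tc → ℂ} (h : Bdd φ) (F : L2) :
    (mulOp φ F : Tc → ℂ) =ᵐ[m] fun θ => φ θ * (F : Tc → ℂ) θ := by
  unfold mulOp
  rw [dif_pos h]
  exact (h.memLp F).coeFn_toLp

lemma mulOp_norm_le {φ : Tc → ℂ} (h : Bdd φ) {C : ℝ} (hC : ∀ᵐ θ ∂m, ‖φ θ‖ ≤ C) (F : L2) :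
    ‖mulOp φ F‖ ≤ C * ‖F‖ := by
  apply Lp.norm_le_mul_norm_of_ae_le_mul
  filter_upwards [hC, mulOp_coe h F] with θ a b
  rw [b, norm_mul]; gcongr

lemma inner_mulOp {φ : Tc → ℂ} (h : Bdd φ) (F G : L2) :
    ⟪mulOp φ F, G⟫_ℂ = ⟪F, mulOp (fun θ => conj (φ θ)) G⟫_ℂ := by
  rw [L2_inner, L2_inner]
  apply integral_congr_ae
  filter_upwards [mulOp_coe h F, mulOp_coe h.conj G] with θ a b
  rw [a, b, map_mul]; ring

lemma mulOp_ext {φ : Tc → ℂ} (h : Bdd φ) {F G : L2}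
    (hh : (G : Tc → ℂ) =ᵐ[m] fun θ => φ θ * (F : Tc → ℂ) θ) : mulOp φ F = G :=
  Lp.ext ((mulOp_coe h F).trans hh.symm)

lemma mulOp_mulOp {φ ψ : Tc → ℂ} (h : Bdd φ) (h' : Bdd ψ) (F : L2) :
    mulOp φ (mulOp ψ F) = mulOp (fun θ => φ θ * ψ θ) F := by
  apply mulOp_ext h
  filter_upwards [mulOp_coe (h.mul h') F, mulOp_coe h' F] with θ a b
  rw [a, b]; ring

lemma mulOp_comm {φ ψ : Tc → ℂ} (h : Bdd φ) (h' : Bdd ψ) (F : L2) :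
    mulOp φ (mulOp ψ F) = mulOp ψ (mulOp φ F) := by
  rw [mulOp_mulOp h h', mulOp_mulOp h' h]
  congr 1; congr 1; ext θ; ring

lemma mulOp_congr {φ ψ : Tc → ℂ} (h : Bdd φ) (hh : φ =ᵐ[m] ψ) (F : L2) :
    mulOp φ F = mulOp ψ F := by
  apply mulOp_ext h
  filter_upwards [mulOp_coe (h.congr hh) F, hh] with θ a b
  rw [a, b]

lemma mulOp_const_sub {φ : Tc → ℂ} (h : Bdd φ) (d c : ℂ) (F : L2) :
    mulOp (fun θ => d - c * φ θ) F = d • F - c • mulOp φ F := by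
  apply mulOp_ext (h.const_sub_mul d c)
  filter_upwards [Lp.coeFn_sub (d • F) (c • mulOp φ F), Lp.coeFn_smul d F,
    Lp.coeFn_smul c (mulOp φ F), mulOp_coe h F] with θ h1 h2 h3 h4
  rw [h1, Pi.sub_apply, h2, h3, Pi.smul_apply, Pi.smul_apply, h4]
  simp only [smul_eq_mul]; ring

lemma mulOp_fourier_ee (k n : ℤ) : mulOp (fun θ => fourier k θ) (ee n) = ee (k + n) := by
  apply mulOp_ext (Bdd.fourier k)
  filter_upwards [ee_coe n, ee_coe (k + n)] with θ a b
  rw [a, b, fourier_add]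

lemma bdd_toLp_coe {φ : Tc → ℂ} (h : Bdd φ) : (mulOp φ (ee 0) : Tc → ℂ) =ᵐ[m] φ := by
  filter_upwards [mulOp_coe h (ee 0), ee_coe 0] with θ a b
  rw [a, b]; simp

/-- H2 as a submodule, in terms of inner products. -/
lemma mem_H2_iff (F : L2) : F ∈ H2 ↔ ∀ n : ℤ, n < 0 → ⟪ee n, F⟫_ℂ = 0 := by
  simp only [inner_ee]; rfl

lemma L2_hasSum (F : L2) : HasSum (fun n : ℤ => ⟪ee n, F⟫_ℂ • ee n) F := by
  simp only [inner_ee]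
  exact hasSum_fourier_series_L2 F

lemma L2_ext {F G : L2} (h : ∀ n, ⟪ee n, F⟫_ℂ = ⟪ee n, G⟫_ℂ) : F = G := by
  have h1 := L2_hasSum F
  simp only [h] at h1
  exact h1.unique (L2_hasSum G)

lemma H2_hasSum {F : L2} (hF : F ∈ H2) : HasSum (fun n : ℕ => ⟪ee n, F⟫_ℂ • ee n) F := by
  have := L2_hasSum F
  refine (Nat.cast_injective (R := ℤ)).hasSum_iff (f := fun n : ℤ => ⟪ee n, F⟫_ℂ • ee n)
    (fun n hn => ?_) |>.2 this
  have : n < 0 := by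
    by_contra h
    push Not at h
    exact hn ⟨n.toNat, by simpa using h⟩
  rw [(mem_H2_iff F).1 hF n this, zero_smul]

/-- Power series of (nonnegative) Fourier coefficients. -/
def psL (F : L2) : PowerSeries ℂ := PowerSeries.mk fun n => ⟪ee n, F⟫_ℂ

lemma coeff_psL (F : L2) (n : ℕ) : PowerSeries.coeff n (psL F) = ⟪ee n, F⟫_ℂ := by
  simp [psL]

lemma psL_add (F G : L2) : psL (F + G) = psL F + psL G := by
  ext n; simp [coeff_psL, inner_add_right]
lemma psL_sub (F G : L2) : psL (F - G) = psL F - psL G := by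
  ext n; simp [coeff_psL, inner_sub_right]
lemma psL_smul (c : ℂ) (F : L2) : psL (c • F) = PowerSeries.C c * psL F := by
  ext n; simp [coeff_psL, inner_smul_right]
lemma psL_zero : psL 0 = 0 := by
  ext n; simp [coeff_psL]
lemma psL_ee (n : ℕ) : psL (ee n) = PowerSeries.X ^ n := by
  ext k; rw [coeff_psL, inner_ee_ee, PowerSeries.coeff_X_pow]; simp

lemma psL_inj {F G : L2} (hF : F ∈ H2) (hG : G ∈ H2) (h : psL F = psL G) : F = G := by
  apply L2_ext
  intro n
  rcases lt_or_ge n 0 with hn | hn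
  · rw [(mem_H2_iff F).1 hF n hn, (mem_H2_iff G).1 hG n hn]
  · obtain ⟨k, rfl⟩ := Int.eq_ofNat_of_zero_le hn
    have := congrArg (PowerSeries.coeff k) h
    rwa [coeff_psL, coeff_psL] at this

lemma H2_add {F G : L2} (hF : F ∈ H2) (hG : G ∈ H2) : F + G ∈ H2 := by
  rw [mem_H2_iff] at *
  intro n hn; rw [inner_add_right, hF n hn, hG n hn, add_zero]
lemma H2_smul (c : ℂ) {F : L2} (hF : F ∈ H2) : c • F ∈ H2 := by
  rw [mem_H2_iff] at *
  intro n hn; rw [inner_smul_right, hF n hn, mul_zero]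
lemma H2_sub {F G : L2} (hF : F ∈ H2) (hG : G ∈ H2) : F - G ∈ H2 := by
  rw [mem_H2_iff] at *
  intro n hn; rw [inner_sub_right, hF n hn, hG n hn, sub_zero]
lemma H2_zero : (0 : L2) ∈ H2 := by
  rw [mem_H2_iff]; simp
lemma H2_ee (n : ℕ) : ee n ∈ H2 := by
  rw [mem_H2_iff]; intro k hk; rw [inner_ee_ee, if_neg (by omega)]
lemma H2_sum {ι : Type*} (s : Finset ι) (f : ι → L2) (h : ∀ i ∈ s, f i ∈ H2) :
    ∑ i ∈ s, f i ∈ H2 := by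
  rw [mem_H2_iff]
  intro n hn
  rw [inner_sum]
  exact Finset.sum_eq_zero fun i hi => (mem_H2_iff _).1 (h i hi) n hn

lemma H2_closed : IsClosed H2 := by
  have : H2 = ⋂ n : ℤ, ⋂ _ : n < 0, {F : L2 | ⟪ee n, F⟫_ℂ = 0} := by
    ext F; simp only [mem_H2_iff, mem_iInter, mem_ofPred_eq]
  rw [this]
  exact isClosed_iInter fun n => isClosed_iInter fun _ =>
    isClosed_eq (by fun_prop) continuous_const

lemma H2_inner_zero {F D : L2} (hF : F ∈ H2) (hD : ∀ n : ℕ, ⟪ee n, D⟫_ℂ = 0) : ⟪F, D⟫_ℂ = 0 := by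
  have h := (H2_hasSum hF).mapL ((innerSL ℂ).flip D)
  simp only [ContinuousLinearMap.flip_apply, innerSL_apply_apply] at h
  refine h.unique ?_
  convert hasSum_zero with n
  simp [inner_smul_left, hD]

/-- `fs` is a bounded analytic boundary function with coefficient series `A`. -/
def HinfB (fs : Tc → ℂ) (A : PowerSeries ℂ) : Prop :=
  Bdd fs ∧ (∀ n : ℤ, n < 0 → fourierCoeff fs n = 0) ∧
    ∀ n : ℕ, fourierCoeff fs n = PowerSeries.coeff n A

lemma inner_ee_mulOp_ee {fs : Tc → ℂ} (h : Bdd fs) (n k : ℤ) :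
    ⟪ee n, mulOp fs (ee k)⟫_ℂ = fourierCoeff fs (n - k) := by
  rw [fourierCoeff_eq, L2_inner]
  apply integral_congr_ae
  filter_upwards [ee_coe n, ee_coe k, mulOp_coe h (ee k)] with θ h1 h2 h3
  rw [h1, h3, h2, ← fourier_neg, ← fourier_neg, show -(n - k) = -n + k by ring, fourier_add]
  ring

lemma HinfB.mul_mem {fs : Tc → ℂ} {A : PowerSeries ℂ} (h : HinfB fs A) {F : L2} (hF : F ∈ H2) :
    mulOp fs F ∈ H2 := by
  rw [mem_H2_iff]
  intro n hn
  have h1 := ((H2_hasSum hF).mapL (mulOp fs)).mapL (innerSL ℂ (ee n))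
  refine h1.unique ?_
  convert hasSum_zero with k
  simp only [map_smul, innerSL_apply_apply, inner_ee_mulOp_ee h.1]
  rw [h.2.1 _ (by omega), smul_zero]

lemma HinfB.psL_mul {fs : Tc → ℂ} {A : PowerSeries ℂ} (h : HinfB fs A) {F : L2} (hF : F ∈ H2) :
    psL (mulOp fs F) = A * psL F := by
  ext n
  rw [coeff_psL]
  have h1 := ((H2_hasSum hF).mapL (mulOp fs)).mapL (innerSL ℂ (ee n))
  refine h1.unique ?_
  rw [mul_comm A, PowerSeries.coeff_mul, Finset.Nat.sum_antidiagonal_eq_sum_range_succ_mk]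
  simp only [map_smul, innerSL_apply_apply, inner_ee_mulOp_ee h.1]
  convert hasSum_sum_of_ne_finset_zero (s := Finset.range n.succ) ?_ using 1
  · apply Finset.sum_congr rfl
    intro k hk
    have hk' : k ≤ n := by simpa [Nat.lt_succ_iff] using hk
    rw [coeff_psL, ← h.2.2, smul_eq_mul]
    congr 2; omega
  · intro k hk
    have hk' : n < k := by simpa [Nat.lt_succ_iff] using hk
    rw [h.2.1 _ (by omega), smul_zero]
  · infer_instance



/-- `fs` is cyclic for the shift (in `H²`), in orthogonality form. -/
def Cyc (fs : Tc → ℂ) : Prop :=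
  ∀ H : L2, (∀ n : ℕ, ⟪mulOp fs (ee n), H⟫_ℂ = 0) → ∀ n : ℕ, ⟪ee n, H⟫_ℂ = 0

/-- Basic analytic facts about a pair. -/
structure Good (P : BPair) (A B : PowerSeries ℂ) : Prop where
  hA : HinfB P.as' A
  hB : HinfB P.bs B
  hA0 : A.constantCoeff ≠ 0
  cyc : Cyc P.as'

/-- Polynomial `T_{conj S} z^n`. -/
def tt (S : PowerSeries ℂ) (n : ℕ) : L2 :=
  ∑ k ∈ Finset.range (n + 1), conj (PowerSeries.coeff (n - k) S) • ee k

lemma tt_mem (S : PowerSeries ℂ) (n : ℕ) : tt S n ∈ H2 :=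
  H2_sum _ _ fun k _ => H2_smul _ (H2_ee k)

lemma inner_tt (S : PowerSeries ℂ) (n : ℕ) (F : L2) :
    ⟪tt S n, F⟫_ℂ = PowerSeries.coeff n (S * psL F) := by
  rw [mul_comm S, PowerSeries.coeff_mul, Finset.Nat.sum_antidiagonal_eq_sum_range_succ_mk, tt,
    sum_inner]
  apply Finset.sum_congr rfl
  intro k _
  rw [inner_smul_left, coeff_psL]; simp [mul_comm]

lemma tt_C (d : ℂ) (n : ℕ) : tt (PowerSeries.C d) n = conj d • ee n := by
  rw [tt, Finset.sum_eq_single n]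
  · simp
  · intro k hk hkn
    have : k < n := by
      have := Finset.mem_range.1 hk
      omega
    rw [PowerSeries.coeff_C, if_neg (by omega)]; simp
  · simp

lemma mem_Hb_iff {P : BPair} {A B : PowerSeries ℂ} (g : Good P A B) (p : HbP) :
    p ∈ HbSet P ↔ fst2 p ∈ H2 ∧ snd2 p ∈ H2 ∧
      ∀ n : ℕ, ⟪mulOp P.bs (ee n), fst2 p⟫_ℂ = ⟪mulOp P.as' (ee n), snd2 p⟫_ℂ := by
  have key : ∀ n : ℤ, fourierCoeff (fun θ => conj (P.bs θ) * (fst2 p : Tc → ℂ) θ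
      - conj (P.as' θ) * (snd2 p : Tc → ℂ) θ) n
      = ⟪mulOp P.bs (ee n), fst2 p⟫_ℂ - ⟪mulOp P.as' (ee n), snd2 p⟫_ℂ := by
    intro n
    rw [inner_mulOp g.hB.1, inner_mulOp g.hA.1, ← inner_sub_right, inner_ee]
    refine congrFun (fourierCoeff_congr_ae ?_) n
    have h1 := Lp.coeFn_sub (mulOp (fun θ => conj (P.bs θ)) (fst2 p))
      (mulOp (fun θ => conj (P.as' θ)) (snd2 p))
    have h2 := mulOp_coe g.hB.1.conj (fst2 p)
    have h3 := mulOp_coe g.hA.1.conj (snd2 p)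
    change _ =ᵐ[m] _
    filter_upwards [h1, h2, h3] with θ a b c
    rw [a, Pi.sub_apply, b, c]
  unfold HbSet
  simp only [mem_ofPred_eq, HbMem, key, sub_eq_zero]
  refine and_congr_right fun _ => and_congr_right fun _ => ⟨fun h n => h n (by omega), ?_⟩
  intro h n hn
  obtain ⟨k, rfl⟩ := Int.eq_ofNat_of_zero_le hn
  exact h k

lemma Hb_orth {P : BPair} {A B : PowerSeries ℂ} (g : Good P A B) {p : HbP} (hp : p ∈ HbSet P)
    {h : L2} (hh : h ∈ H2) :
    ⟪mulOp P.bs h, fst2 p⟫_ℂ = ⟪mulOp P.as' h, snd2 p⟫_ℂ := by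
  rw [mem_Hb_iff g] at hp
  rw [← sub_eq_zero, inner_mulOp g.hB.1, inner_mulOp g.hA.1, ← inner_sub_right]
  apply H2_inner_zero hh
  intro n
  rw [inner_sub_right, ← inner_mulOp g.hB.1, ← inner_mulOp g.hA.1, hp.2.2 n, sub_self]

/-- Pair constructor. -/
def mkP (F G : L2) : HbP := WithLp.toLp 2 (F, G)

lemma fst2_mkP (F G : L2) : fst2 (mkP F G) = F := rfl
lemma snd2_mkP (F G : L2) : snd2 (mkP F G) = G := rfl
lemma fst2_add (p q : HbP) : fst2 (p + q) = fst2 p + fst2 q := rfl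
lemma snd2_add (p q : HbP) : snd2 (p + q) = snd2 p + snd2 q := rfl
lemma fst2_sub (p q : HbP) : fst2 (p - q) = fst2 p - fst2 q := rfl
lemma snd2_sub (p q : HbP) : snd2 (p - q) = snd2 p - snd2 q := rfl
lemma fst2_smul (c : ℂ) (q : HbP) : fst2 (c • q) = c • fst2 q := rfl
lemma snd2_smul (c : ℂ) (q : HbP) : snd2 (c • q) = c • snd2 q := rfl
lemma hbp_ext {p q : HbP} (h1 : fst2 p = fst2 q) (h2 : snd2 p = snd2 q) : p = q := by
  apply (WithLp.equiv 2 (L2 × L2)).injective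
  exact Prod.ext h1 h2
lemma hbp_inner (p q : HbP) : ⟪p, q⟫_ℂ = ⟪fst2 p, fst2 q⟫_ℂ + ⟪snd2 p, snd2 q⟫_ℂ := by
  rw [WithLp.prod_inner_apply]; rfl

/-- continuous coordinate projections -/
def fstL : HbP →L[ℂ] L2 := WithLp.fstL 2 ℂ L2 L2
def sndL : HbP →L[ℂ] L2 := WithLp.sndL 2 ℂ L2 L2
lemma fstL_apply (p : HbP) : fstL p = fst2 p := rfl
lemma sndL_apply (p : HbP) : sndL p = snd2 p := rfl

/-- `H(b)` as a submodule. -/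
def HbSub {P : BPair} {A B : PowerSeries ℂ} (g : Good P A B) : Submodule ℂ HbP where
  carrier := HbSet P
  zero_mem' := by
    rw [mem_Hb_iff g]
    refine ⟨H2_zero, H2_zero, fun n => ?_⟩
    change ⟪_, (0 : L2)⟫_ℂ = ⟪_, (0 : L2)⟫_ℂ
    simp
  add_mem' := by
    intro p q hp hq
    rw [mem_Hb_iff g] at *
    refine ⟨H2_add hp.1 hq.1, H2_add hp.2.1 hq.2.1, fun n => ?_⟩
    rw [fst2_add, snd2_add, inner_add_right, inner_add_right, hp.2.2, hq.2.2]
  smul_mem' := by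
    intro c p hp
    rw [mem_Hb_iff g] at *
    refine ⟨H2_smul c hp.1, H2_smul c hp.2.1, fun n => ?_⟩
    rw [fst2_smul, snd2_smul, inner_smul_right, inner_smul_right, hp.2.2]

lemma mem_HbSub {P : BPair} {A B : PowerSeries ℂ} (g : Good P A B) (p : HbP) :
    p ∈ HbSub g ↔ p ∈ HbSet P := Iff.rfl

lemma HbSet_closed {P : BPair} {A B : PowerSeries ℂ} (g : Good P A B) : IsClosed (HbSet P) := by
  have : HbSet P = fstL ⁻¹' H2 ∩ (sndL ⁻¹' H2 ∩ ⋂ n : ℕ,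
      {p | ⟪mulOp P.bs (ee n), fstL p⟫_ℂ = ⟪mulOp P.as' (ee n), sndL p⟫_ℂ}) := by
    ext p
    rw [mem_Hb_iff g]; simp only [mem_inter_iff, mem_preimage, mem_iInter, mem_ofPred_eq]; rfl
  rw [this]
  refine (H2_closed.preimage fstL.continuous).inter
    ((H2_closed.preimage sndL.continuous).inter (isClosed_iInter fun n => isClosed_eq ?_ ?_))
  · exact continuous_const.inner fstL.continuous
  · exact continuous_const.inner sndL.continuous

lemma cyc_snd_unique {P : BPair} {A B : PowerSeries ℂ} (g : Good P A B) {p q : HbP}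
    (hp : p ∈ HbSet P) (hq : q ∈ HbSet P) (h : fst2 p = fst2 q) : p = q := by
  refine hbp_ext h ?_
  rw [mem_Hb_iff g] at hp hq
  rw [← sub_eq_zero]
  refine psL_inj (H2_sub hp.2.1 hq.2.1) H2_zero ?_
  have : ∀ n : ℕ, ⟪ee n, snd2 p - snd2 q⟫_ℂ = 0 := by
    apply g.cyc
    intro n
    rw [inner_sub_right, ← hp.2.2, ← hq.2.2, h, sub_self]
  ext n
  rw [coeff_psL, this, psL_zero]; simp

lemma pyth_inner {P : BPair} {A B : PowerSeries ℂ} (g : Good P A B) (F G : L2) :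
    ⟪mulOp P.as' F, mulOp P.as' G⟫_ℂ + ⟪mulOp P.bs F, mulOp P.bs G⟫_ℂ = ⟪F, G⟫_ℂ := by
  rw [inner_mulOp g.hA.1, inner_mulOp g.hB.1, ← inner_add_right]
  congr 1
  apply Lp.ext
  filter_upwards [Lp.coeFn_add (mulOp (fun θ => conj (P.as' θ)) (mulOp P.as' G))
    (mulOp (fun θ => conj (P.bs θ)) (mulOp P.bs G)), mulOp_coe g.hA.1.conj (mulOp P.as' G),
    mulOp_coe g.hB.1.conj (mulOp P.bs G), mulOp_coe g.hA.1 G, mulOp_coe g.hB.1 G, P.pyth]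
    with θ h1 h2 h3 h4 h5 h6
  rw [h1, Pi.add_apply, h2, h3, h4, h5]
  have e1 : conj (P.as' θ) * P.as' θ = ((‖P.as' θ‖ ^ 2 : ℝ) : ℂ) := by
    rw [mul_comm, Complex.mul_conj, Complex.normSq_eq_norm_sq]
  have e2 : conj (P.bs θ) * P.bs θ = ((‖P.bs θ‖ ^ 2 : ℝ) : ℂ) := by
    rw [mul_comm, Complex.mul_conj, Complex.normSq_eq_norm_sq]
  rw [← mul_assoc, ← mul_assoc, e1, e2, ← add_mul, ← Complex.ofReal_add, h6]
  simp

/-- boundary function `1 - c b` -/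
def ob (P : BPair) (c : ℂ) : Tc → ℂ := fun θ => 1 - c * P.bs θ

lemma ob_apply {P : BPair} {A B : PowerSeries ℂ} (g : Good P A B) (c : ℂ) (F : L2) :
    mulOp (ob P c) F = F - c • mulOp P.bs F := by
  have := mulOp_const_sub g.hB.1 1 c F
  rw [one_smul] at this
  exact this

/-- The model family in `H(b)`. -/
def YY (P : BPair) (c : ℂ) (T U : PowerSeries ℂ) (n : ℕ) : HbP :=
  mkP (mulOp (ob P c) (tt T n)) (c • mulOp P.as' (tt T n) + tt U n)

open PowerSeries in
lemma YY_mem {P : BPair} {A B : PowerSeries ℂ} (g : Good P A B) (c : ℂ) {T U : PowerSeries ℂ}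
    (h : T * (B - C (conj c)) = U * A) (n : ℕ) : YY P c T U n ∈ HbSet P := by
  rw [mem_Hb_iff g]
  have ht := tt_mem T n
  refine ⟨?_, ?_, fun j => ?_⟩
  · rw [YY, fst2_mkP, ob_apply g]
    exact H2_sub ht (H2_smul _ (g.hB.mul_mem ht))
  · exact H2_add (H2_smul _ (g.hA.mul_mem ht)) (tt_mem U n)
  · rw [YY, fst2_mkP, snd2_mkP, ob_apply g, inner_sub_right, inner_smul_right, inner_add_right,
      inner_smul_right]
    have h1 := pyth_inner g (ee j) (tt T n)
    have h2 : ⟪mulOp P.bs (ee j), tt T n⟫_ℂ - c * ⟪ee j, tt T n⟫_ℂ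
        = ⟪mulOp P.as' (ee j), tt U n⟫_ℂ := by
      rw [← inner_conj_symm _ (tt T n), ← inner_conj_symm (ee j), ← inner_conj_symm _ (tt U n),
        inner_tt, inner_tt, inner_tt, g.hA.psL_mul (H2_ee j), g.hB.psL_mul (H2_ee j)]
      rw [← mul_assoc U, ← h, ← Complex.conj_conj c, ← map_mul, ← map_sub, Complex.conj_conj c]
      congr 1
      rw [mul_sub, sub_mul, map_sub, ← mul_assoc, mul_comm T (C (conj c)), mul_assoc (C (conj c)),
        coeff_C_mul]
    rw [← h2, ← h1]; ring

open PowerSeries in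
lemma inner_YY {P : BPair} {A B : PowerSeries ℂ} (g : Good P A B) (c : ℂ) (T U : PowerSeries ℂ)
    (n : ℕ) {p : HbP} (hp : p ∈ HbSet P) :
    ⟪YY P c T U n, p⟫_ℂ = coeff n (T * psL (fst2 p) + U * psL (snd2 p)) := by
  rw [hbp_inner, YY, fst2_mkP, snd2_mkP, ob_apply g, inner_sub_left, inner_smul_left,
    inner_add_left, inner_smul_left, Hb_orth g hp (tt_mem T n), inner_tt, inner_tt, map_add]
  ring

lemma closure_span_iff {P : BPair} {A B : PowerSeries ℂ} (g : Good P A B) (Z : ℕ → HbP)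
    (hZ : ∀ n, Z n ∈ HbSet P) :
    closure (↑(Submodule.span ℂ (Set.range Z)) : Set HbP) = HbSet P ↔
      ∀ p ∈ HbSet P, (∀ n, ⟪Z n, p⟫_ℂ = 0) → p = 0 := by
  set K := (Submodule.span ℂ (Set.range Z)).topologicalClosure with hK
  have hKc : (K : Set HbP) = closure (↑(Submodule.span ℂ (Set.range Z)) : Set HbP) := rfl
  have hle : K ≤ HbSub g := by
    apply Submodule.topologicalClosure_minimal
    · rw [Submodule.span_le]; rintro _ ⟨n, rfl⟩; exact hZ n
    · exact HbSet_closed g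
  have hcl : IsClosed (K : Set HbP) := Submodule.isClosed_topologicalClosure _
  haveI : CompleteSpace K := hcl.completeSpace_coe
  rw [← hKc]
  have horth : ∀ p, p ∈ Kᗮ ↔ ∀ n, ⟪Z n, p⟫_ℂ = 0 := by
    intro p
    rw [hK, Submodule.orthogonal_closure, Submodule.mem_orthogonal]
    constructor
    · intro h n; exact h _ (Submodule.subset_span ⟨n, rfl⟩)
    · intro h u hu
      induction hu using Submodule.span_induction with
      | mem x hx => obtain ⟨n, rfl⟩ := hx; exact h n
      | zero => simp
      | add x y _ _ hx hy => rw [inner_add_left, hx, hy, add_zero]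
      | smul a x _ hx => rw [inner_smul_left, hx, mul_zero]
  constructor
  · intro h p hp hz
    have h1 : p ∈ K := by rw [← SetLike.mem_coe, h]; exact hp
    have h2 := (horth p).2 hz
    have := Submodule.inner_right_of_mem_orthogonal h1 h2
    exact inner_self_eq_zero.1 this
  · intro h
    apply Set.Subset.antisymm
    · exact hle
    · intro p hp
      have h1 : (p - K.starProjection p) ∈ Kᗮ := by
        exact Submodule.sub_starProjection_mem_orthogonal p
      have h2 : p - K.starProjection p ∈ HbSub g :=
        (HbSub g).sub_mem hp (hle (Submodule.starProjection_apply_mem K p))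
      have h3 := h _ h2 ((horth _).1 h1)
      rw [sub_eq_zero] at h3
      rw [h3]; exact Submodule.starProjection_apply_mem K p

open PowerSeries in
lemma closure_YY_iff {P : BPair} {A B : PowerSeries ℂ} (g : Good P A B) (c : ℂ)
    {T U : PowerSeries ℂ} (h : T * (B - C (conj c)) = U * A) :
    closure (↑(Submodule.span ℂ (Set.range (YY P c T U))) : Set HbP) = HbSet P ↔
      ∀ p ∈ HbSet P, T * psL (fst2 p) + U * psL (snd2 p) = 0 → p = 0 := by
  rw [closure_span_iff g _ (YY_mem g c h)]
  refine forall₂_congr fun p hp => ?_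
  refine imp_congr_left ?_
  simp only [inner_YY g c T U _ hp]
  rw [PowerSeries.ext_iff]
  simp

open PowerSeries in
/-- The criterion. -/
lemma cyclic_iff {P : BPair} {A B : PowerSeries ℂ} (g : Good P A B) (c : ℂ) (q : HbP)
    (hq : q ∈ HbSet P) (hbd : (fst2 q : Tc → ℂ) =ᵐ[m] fun θ => 1 - c * P.bs θ) :
    CyclicSb P q ↔
      ∀ p ∈ HbSet P, A * psL (fst2 p) + (B - C (conj c)) * psL (snd2 p) = 0 → p = 0 := by
  have hu : A * A⁻¹ = 1 := PowerSeries.mul_inv_cancel A g.hA0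
  set U := (B - C (conj c)) * A⁻¹ with hU
  have hrel : (1 : PowerSeries ℂ) * (B - C (conj c)) = U * A := by
    rw [hU, one_mul, mul_assoc, mul_comm A⁻¹, hu, mul_one]
  have hYfst : ∀ n, (fst2 (YY P c 1 U n) : Tc → ℂ) =ᵐ[m]
      fun θ => (bd θ) ^ n * (fst2 q : Tc → ℂ) θ := by
    intro n
    have h1 : tt (1 : PowerSeries ℂ) n = ee n := by
      have := tt_C 1 n
      simpa using this
    rw [YY, fst2_mkP, h1]
    filter_upwards [mulOp_coe (g.hB.1.const_sub_mul 1 c) (ee n), hbd, ee_coe n] with θ h1 h2 h3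
    rw [show ob P c = fun θ => 1 - c * P.bs θ from rfl, h1, h2, h3, bd_pow]; ring
  have hYZ : ZFamily P q (YY P c 1 U) := fun n => ⟨YY_mem g c hrel n, hYfst n⟩
  have huniq : ∀ Zf, ZFamily P q Zf → Zf = YY P c 1 U := by
    intro Zf hZ
    ext1 n
    refine cyc_snd_unique g (hZ n).1 (hYZ n).1 (Lp.ext ((hZ n).2.trans (hYfst n).symm))
  have step : CyclicSb P q ↔
      closure (↑(Submodule.span ℂ (Set.range (YY P c 1 U))) : Set HbP) = HbSet P := by
    constructor
    · intro h; exact h.2 _ hYZ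
    · intro h
      refine ⟨hq, fun Zf hZ => ?_⟩
      rw [huniq Zf hZ]; exact h
  rw [step, closure_YY_iff g c hrel]
  refine forall₂_congr fun p hp => imp_congr_left ?_
  have : A * psL (fst2 p) + (B - C (conj c)) * psL (snd2 p)
      = A * (1 * psL (fst2 p) + U * psL (snd2 p)) := by
    rw [hU]; linear_combination (-(B - C (conj c)) * psL (snd2 p)) * hu
  rw [this]
  have hA : A ≠ 0 := by
    rintro rfl; exact g.hA0 (by simp)
  simp [hA]


lemma hasSum_congr' {f g : ℕ → ℂ} {a : ℂ} (h : ∀ n, f n = g n) : HasSum f a ↔ HasSum g a := by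
  rw [funext h]

/-- `c` is the power series of `f` on the disc. -/
def PS (f : ℂ → ℂ) (c : PowerSeries ℂ) : Prop :=
  ∀ z ∈ uDisc, HasSum (fun n => PowerSeries.coeff n c * z ^ n) (f z)

lemma PS.exists {f : ℂ → ℂ} (hf : HolDisc f) : ∃ c, PS f c := by
  refine ⟨PowerSeries.mk fun n => (n.factorial : ℂ)⁻¹ * iteratedDeriv n f 0, fun z hz => ?_⟩
  have := Complex.hasSum_taylorSeries_on_ball hf hz
  refine (hasSum_congr' fun n => ?_).2 this
  rw [PowerSeries.coeff_mk, sub_zero, smul_eq_mul, smul_eq_mul]; ring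

lemma ofReal_mem_uDisc {r : ℝ} (h0 : 0 ≤ r) (h1 : r < 1) : (r : ℂ) ∈ uDisc := by
  simp [abs_of_nonneg h0, h1]

lemma r_bd_mem {r : ℝ} (h0 : 0 ≤ r) (h1 : r < 1) (θ : Tc) : (r : ℂ) * bd θ ∈ uDisc := by
  simp [norm_bd, abs_of_nonneg h0, h1]

lemma PS.hol {f : ℂ → ℂ} {c : PowerSeries ℂ} (h : PS f c) : HolDisc f := by
  intro z hz
  obtain ⟨r, hr1, hr2⟩ := exists_between (show ‖z‖ < 1 by simpa using hz)
  have hr0 : 0 ≤ r := (norm_nonneg z).trans hr1.le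
  have hs := (h r (ofReal_mem_uDisc hr0 hr2)).summable.norm
  have hd : DifferentiableOn ℂ (fun w => ∑' n, PowerSeries.coeff n c * w ^ n) (ball 0 r) := by
    refine differentiableOn_tsum_of_summable_norm hs (fun n => by fun_prop) isOpen_ball ?_
    intro n w hw
    have hw : ‖w‖ < r := by simpa using hw
    rw [norm_mul, norm_mul, norm_pow, norm_pow]
    gcongr
    rw [norm_real, Real.norm_of_nonneg hr0]; exact hw.le
  have hd2 : DifferentiableOn ℂ f (ball 0 r) := by
    refine hd.congr fun w hw => ((h w ?_).tsum_eq).symm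
    exact ball_subset_ball hr2.le hw
  exact (hd2.differentiableAt (isOpen_ball.mem_nhds (by simpa using hr1))).differentiableWithinAt

lemma PS.mul {f g : ℂ → ℂ} {c d : PowerSeries ℂ} (h : PS f c) (h' : PS g d) :
    PS (fun z => f z * g z) (c * d) := by
  intro z hz
  have h1 := (h z hz)
  have h2 := (h' z hz)
  have := tsum_mul_tsum_eq_tsum_sum_antidiagonal_of_summable_norm h1.summable.norm h2.summable.norm
  have hs := (summable_norm_sum_mul_antidiagonal_of_summable_norm h1.summable.norm
    h2.summable.norm).of_norm
  rw [h1.tsum_eq, h2.tsum_eq] at this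
  have h3 := hs.hasSum
  rw [← this] at h3
  refine (hasSum_congr' fun n => ?_).2 h3
  rw [PowerSeries.coeff_mul, Finset.sum_mul]
  apply Finset.sum_congr rfl
  rintro ⟨i, j⟩ hij
  rw [← Finset.HasAntidiagonal.mem_antidiagonal.1 hij, pow_add]; ring

lemma PS.add {f g : ℂ → ℂ} {c d : PowerSeries ℂ} (h : PS f c) (h' : PS g d) :
    PS (fun z => f z + g z) (c + d) := by
  intro z hz
  convert (h z hz).add (h' z hz) using 2 with n
  rw [map_add]; ring

lemma PS.const (c : ℂ) : PS (fun _ => c) (PowerSeries.C c) := by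
  intro z hz
  convert hasSum_single (f := fun n => PowerSeries.coeff n (PowerSeries.C c) * z ^ n) 0 ?_ using 1
  · simp
  · intro n hn
    simp [PowerSeries.coeff_C, hn]

lemma PS.const_sub_mul {f : ℂ → ℂ} {c : PowerSeries ℂ} (h : PS f c) (d e : ℂ) :
    PS (fun z => d - e * f z) (PowerSeries.C d - PowerSeries.C e * c) := by
  have := (PS.const d).add ((PS.const (-e)).mul h)
  convert this using 1
  · ext z; ring
  · rw [map_neg]; ring

lemma PS.congr {f g : ℂ → ℂ} {c : PowerSeries ℂ} (h : PS f c) (hh : ∀ z ∈ uDisc, f z = g z) :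
    PS g c := fun z hz => hh z hz ▸ h z hz

lemma PS.zero {f : ℂ → ℂ} {c : PowerSeries ℂ} (h : PS f c) : f 0 = PowerSeries.coeff 0 c := by
  refine (h 0 (by simp)).unique ?_
  convert hasSum_single (f := fun n => PowerSeries.coeff n c * (0 : ℂ) ^ n) 0 ?_ using 1
  · simp
  · intro n hn; simp [hn]

lemma integral_fourier (n : ℤ) : ∫ θ, (fourier n θ : ℂ) ∂m = if n = 0 then 1 else 0 := by
  have h := inner_ee_ee 0 n
  rw [inner_ee, fourierCoeff_eq] at h
  rw [show (if n = 0 then (1 : ℂ) else 0) = if 0 = n then 1 else 0 by simp only [eq_comm], ← h]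
  apply integral_congr_ae
  filter_upwards [ee_coe n] with θ hθ
  rw [hθ]; simp

/-- Fourier coefficients of dilates. -/
lemma PS.fourier {f : ℂ → ℂ} {c : PowerSeries ℂ} (h : PS f c) {r : ℝ} (h0 : 0 ≤ r) (h1 : r < 1)
    (n : ℤ) : HasSum (fun k : ℕ => PowerSeries.coeff k c * (r : ℂ) ^ k *
      (if (k : ℤ) = n then 1 else 0)) (fourierCoeff (fun θ => f (r * bd θ)) n) := by
  rw [fourierCoeff_eq]
  have hs := (h r (ofReal_mem_uDisc h0 h1)).summable.norm
  have : HasSum (fun k : ℕ => ∫ θ, conj (_root_.fourier n θ) * (PowerSeries.coeff k c * (r * bd θ) ^ k) ∂m)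
      (∫ θ, conj (_root_.fourier n θ) * f (r * bd θ) ∂m) := by
    refine hasSum_integral_of_dominated_convergence
      (fun k _ => ‖PowerSeries.coeff k c * (r : ℂ) ^ k‖) ?_ ?_ ?_ ?_ ?_
    · intro k
      have := continuous_bd
      exact Continuous.aestronglyMeasurable (by fun_prop)
    · intro k
      refine ae_of_all _ fun θ => ?_
      simp only [norm_mul, norm_pow, norm_bd, mul_one, RCLike.norm_conj, norm_fourier_pt, one_mul,
        le_refl]
    · exact ae_of_all _ fun θ => hs
    · exact integrable_const _
    · refine ae_of_all _ fun θ => ?_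
      exact (h _ (r_bd_mem h0 h1 θ)).mul_left _
  convert this using 2 with k
  rw [show (if (k : ℤ) = n then (1 : ℂ) else 0) = if -n + (k : ℤ) = 0 then 1 else 0 by
    congr 1; rw [eq_iff_iff]; omega, ← integral_fourier, ← integral_const_mul]
  congr 1; ext θ
  rw [fourier_add, ← bd_pow, fourier_neg]; ring

lemma PS.fourier_nat {f : ℂ → ℂ} {c : PowerSeries ℂ} (h : PS f c) {r : ℝ} (h0 : 0 ≤ r) (h1 : r < 1)
    (n : ℕ) : fourierCoeff (fun θ => f (r * bd θ)) n = PowerSeries.coeff n c * (r : ℂ) ^ n := by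
  refine (h.fourier h0 h1 n).unique ?_
  convert hasSum_single (f := fun k : ℕ => PowerSeries.coeff k c * (r : ℂ) ^ k *
      (if (k : ℤ) = n then 1 else 0)) n ?_ using 1
  · simp
  · intro k hk; rw [if_neg (by exact_mod_cast hk), mul_zero]

lemma PS.fourier_neg {f : ℂ → ℂ} {c : PowerSeries ℂ} (h : PS f c) {r : ℝ} (h0 : 0 ≤ r) (h1 : r < 1)
    {n : ℤ} (hn : n < 0) : fourierCoeff (fun θ => f (r * bd θ)) n = 0 := by
  refine (h.fourier h0 h1 n).unique ?_
  convert hasSum_zero with k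
  rw [if_neg (by omega), mul_zero]

lemma PS.unique {f : ℂ → ℂ} {c d : PowerSeries ℂ} (h : PS f c) (h' : PS f d) : c = d := by
  ext n
  have h1 := h.fourier_nat (r := 1/2) (by norm_num) (by norm_num) n
  rw [h'.fourier_nat (r := 1/2) (by norm_num) (by norm_num) n] at h1
  have : (((1/2 : ℝ) : ℂ)) ^ n ≠ 0 := pow_ne_zero _ (by norm_num)
  exact (mul_right_cancel₀ this h1).symm

/-- sequence increasing to 1 -/
def rk (k : ℕ) : ℝ := 1 - 1 / ((k : ℝ) + 2)
lemma rk_nonneg (k : ℕ) : 0 ≤ rk k := by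
  unfold rk
  rw [sub_nonneg, div_le_one (by positivity)]
  linarith [(Nat.cast_nonneg k : (0:ℝ) ≤ k)]
lemma rk_lt (k : ℕ) : rk k < 1 := by
  unfold rk
  have : 0 < 1 / ((k : ℝ) + 2) := by positivity
  linarith
lemma rk_tendsto : Tendsto rk atTop (nhdsWithin 1 (Set.Iio 1)) := by
  refine tendsto_nhdsWithin_iff.2 ⟨?_, Eventually.of_forall rk_lt⟩
  have h := (tendsto_one_div_add_atTop_nhds_zero_nat (𝕜 := ℝ)).comp (tendsto_add_atTop_nat 1)
  have h2 := (tendsto_const_nhds (x := (1:ℝ))).sub h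
  rw [sub_zero] at h2
  refine h2.congr fun k => ?_
  simp only [rk, Function.comp, Nat.cast_add, Nat.cast_one]
  ring

lemma HolDisc.cont_dilate {f : ℂ → ℂ} (hf : HolDisc f) {r : ℝ} (h0 : 0 ≤ r) (h1 : r < 1) :
    Continuous (fun θ : Tc => f (r * bd θ)) :=
  hf.continuousOn.comp_continuous (continuous_const.mul continuous_bd) (r_bd_mem h0 h1)

lemma IsBdry.aesm {f : ℂ → ℂ} {fs : Tc → ℂ} (hf : HolDisc f) (hb : IsBdry f fs) :
    AEStronglyMeasurable fs m := by
  refine aestronglyMeasurable_of_tendsto_ae (u := atTop) (f := fun k θ => f (rk k * bd θ)) ?_ ?_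
  · intro k
    exact (hf.cont_dilate (rk_nonneg k) (rk_lt k)).aestronglyMeasurable
  · filter_upwards [hb] with θ hθ
    exact hθ.comp rk_tendsto

lemma IsBdry.bound {f : ℂ → ℂ} {fs : Tc → ℂ} {M : ℝ} (hM : ∀ z ∈ uDisc, ‖f z‖ ≤ M)
    (hb : IsBdry f fs) : ∀ᵐ θ ∂m, ‖fs θ‖ ≤ M := by
  filter_upwards [hb] with θ hθ
  exact le_of_tendsto (hθ.comp rk_tendsto).norm
    (Eventually.of_forall fun k => hM _ (r_bd_mem (rk_nonneg k) (rk_lt k) θ))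

lemma IsBdry.bdd {f : ℂ → ℂ} {fs : Tc → ℂ} {M : ℝ} (hf : HolDisc f) (hM : ∀ z ∈ uDisc, ‖f z‖ ≤ M)
    (hb : IsBdry f fs) : Bdd fs := ⟨hb.aesm hf, M, hb.bound hM⟩

lemma hinfB_of {f : ℂ → ℂ} {fs : Tc → ℂ} {c : PowerSeries ℂ} {M : ℝ} (hc : PS f c)
    (hM : ∀ z ∈ uDisc, ‖f z‖ ≤ M) (hb : IsBdry f fs) : HinfB fs c := by
  have hf := hc.hol
  have key : ∀ n : ℤ, Tendsto (fun k => fourierCoeff (fun θ => f (rk k * bd θ)) n) atTop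
      (nhds (fourierCoeff fs n)) := by
    intro n
    simp only [fourierCoeff_eq]
    refine tendsto_integral_of_dominated_convergence (fun _ => M) ?_ (integrable_const _) ?_ ?_
    · intro k
      have := hf.cont_dilate (rk_nonneg k) (rk_lt k)
      exact ((continuous_conj.comp (map_continuous (fourier n))).mul this).aestronglyMeasurable
    · intro k
      refine ae_of_all _ fun θ => ?_
      rw [norm_mul, RCLike.norm_conj, norm_fourier_pt, one_mul]
      exact hM _ (r_bd_mem (rk_nonneg k) (rk_lt k) θ)
    · filter_upwards [hb] with θ hθ
      exact (hθ.comp rk_tendsto).const_mul _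
  refine ⟨hb.bdd hf hM, fun n hn => ?_, fun n => ?_⟩
  · refine tendsto_nhds_unique (key n) ?_
    simp only [hc.fourier_neg (rk_nonneg _) (rk_lt _) hn]
    exact tendsto_const_nhds
  · refine tendsto_nhds_unique (key n) ?_
    simp only [hc.fourier_nat (rk_nonneg _) (rk_lt _) n]
    have h1 : Tendsto (fun k => ((rk k : ℝ) : ℂ)) atTop (nhds 1) := by
      have := (tendsto_nhdsWithin_iff.1 rk_tendsto).1
      exact (continuous_ofReal.tendsto 1).comp this
    simpa using (h1.pow n).const_mul (PowerSeries.coeff n c)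


/-- Herglotz kernel -/
def hk (z : ℂ) (θ : Tc) : ℂ := (bd θ + z) / (bd θ - z)
/-- Poisson kernel -/
def pk (z : ℂ) (θ : Tc) : ℝ := (1 - ‖z‖ ^ 2) / ‖z - bd θ‖ ^ 2

lemma bd_sub_ne {z : ℂ} (hz : z ∈ uDisc) (θ : Tc) : bd θ - z ≠ 0 := by
  intro h
  have h1 : bd θ = z := sub_eq_zero.1 h
  have := norm_bd θ
  rw [h1] at this
  have hz : ‖z‖ < 1 := by simpa using hz
  linarith

lemma hk_re (z : ℂ) (θ : Tc) : (hk z θ).re = pk z θ := by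
  have := congrFun (poissonKernel_eq_re_herglotzRieszKernel (c := 0) (w := z)) (bd θ)
  simp only [poissonKernel, herglotzRieszKernel, Function.comp, sub_zero] at this
  rw [hk, pk, ← this, norm_bd, norm_sub_rev, one_pow]

lemma pk_pos {z : ℂ} (hz : z ∈ uDisc) (θ : Tc) : 0 < pk z θ := by
  have hz' : ‖z‖ < 1 := by simpa using hz
  refine div_pos ?_ ?_
  · nlinarith [norm_nonneg z]
  · rw [norm_sub_rev]
    exact pow_pos (norm_pos_iff.2 (bd_sub_ne hz θ)) _

lemma hk_cont {z : ℂ} (hz : z ∈ uDisc) : Continuous (hk z) :=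
  (continuous_bd.add continuous_const).div (continuous_bd.sub continuous_const) (bd_sub_ne hz)

lemma pk_cont {z : ℂ} (hz : z ∈ uDisc) : Continuous (pk z) := by
  have := continuous_re.comp (hk_cont hz)
  convert this using 1
  ext θ; exact (hk_re z θ).symm

lemma hk_hasSum {z : ℂ} (hz : z ∈ uDisc) (θ : Tc) :
    HasSum (fun n : ℕ => (if n = 0 then 1 else 2) * conj (fourier (n : ℤ) θ) * z ^ n) (hk z θ) := by
  have hz' : ‖z‖ < 1 := by simpa using hz
  have hb : bd θ * conj (bd θ) = 1 := by
    rw [mul_conj, normSq_eq_norm_sq, norm_bd]; norm_num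
  have hb0 : bd θ ≠ 0 := by
    intro h; rw [h, zero_mul] at hb; exact zero_ne_one hb
  have hw : ‖conj (bd θ) * z‖ < 1 := by
    rw [norm_mul, RCLike.norm_conj, norm_bd, one_mul]; exact hz'
  have h1 := (hasSum_geometric_of_norm_lt_one hw).mul_left 2
  have h2 : HasSum (fun n : ℕ => if n = 0 then (1 : ℂ) else 0) 1 := hasSum_ite_eq 0 1
  have h3 := h1.sub h2
  have e : 2 * (1 - conj (bd θ) * z)⁻¹ - 1 = hk z θ := by
    have h4 : 1 - conj (bd θ) * z = conj (bd θ) * (bd θ - z) := by rw [mul_sub, mul_comm _ (bd θ), hb]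
    have h5 : conj (bd θ) = (bd θ)⁻¹ := by
      field_simp; rw [mul_comm]; exact hb
    have h6 := bd_sub_ne hz θ
    rw [h4, h5, hk]
    field_simp
    ring
  rw [e] at h3
  refine (hasSum_congr' fun n => ?_).2 h3
  rcases Nat.eq_zero_or_pos n with rfl | hn
  · simp; norm_num
  · rw [if_neg hn.ne', if_neg hn.ne', mul_pow, ← bd_pow, map_pow]; ring

/-- power series of a Herglotz integral -/
def hps (μ : Measure Tc) (φ : Tc → ℂ) : PowerSeries ℂ :=
  PowerSeries.mk fun n => (if n = 0 then 1 else 2) * ∫ θ, conj (fourier (n : ℤ) θ) * φ θ ∂μ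

lemma herg_PS {μ : Measure Tc} {φ : Tc → ℂ} (hφ : Integrable φ μ) :
    PS (fun z => ∫ θ, hk z θ * φ θ ∂μ) (hps μ φ) := by
  intro z hz
  have hz' : ‖z‖ < 1 := by simpa using hz
  have : HasSum (fun n : ℕ => ∫ θ, (if n = 0 then 1 else 2) * conj (fourier (n : ℤ) θ) * z ^ n * φ θ ∂μ)
      (∫ θ, hk z θ * φ θ ∂μ) := by
    refine hasSum_integral_of_dominated_convergence (fun n θ => 2 * ‖z‖ ^ n * ‖φ θ‖) ?_ ?_ ?_ ?_ ?_
    · intro n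
      refine AEStronglyMeasurable.mul ?_ hφ.1
      exact Continuous.aestronglyMeasurable ((continuous_const.mul
        (continuous_conj.comp (map_continuous (fourier (n : ℤ))))).mul continuous_const)
    · intro n
      refine ae_of_all _ fun θ => ?_
      rw [norm_mul, norm_mul, norm_mul, RCLike.norm_conj, norm_fourier_pt, norm_pow, mul_one]
      gcongr
      split_ifs <;> norm_num
    · refine ae_of_all _ fun θ => ?_
      exact ((summable_geometric_of_lt_one (norm_nonneg z) hz').mul_left 2).mul_right _
    · simp only [tsum_mul_right]
      exact hφ.norm.const_mul _
    · exact ae_of_all _ fun θ => (hk_hasSum hz θ).mul_right _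
  refine (hasSum_congr' fun n => ?_).2 this
  rw [hps, PowerSeries.coeff_mk, ← integral_const_mul, ← integral_mul_const]
  congr 1; ext θ; ring

lemma circleAverage_eq (f : ℂ → ℂ) : Real.circleAverage f 0 1 = ∫ θ, f (bd θ) ∂m := by
  rw [m, AddCircle.integral_haarAddCircle, ← AddCircle.intervalIntegral_preimage _ 0,
    Real.circleAverage_def, zero_add]
  congr 2
  ext x
  congr 1
  rw [bd, circleMap, zero_add, ofReal_one, one_mul, AddCircle.toCircle_apply_mk, Circle.coe_exp]
  congr 3
  field_simp

lemma poisson_DC {f : ℂ → ℂ} (hf : DiffContOnCl ℂ f (ball 0 1)) {w : ℂ} (hw : w ∈ uDisc) :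
    ∫ θ, (pk w θ : ℂ) * f (bd θ) ∂m = f w := by
  rw [← hf.circleAverage_re_herglotzRieszKernel_smul hw, circleAverage_eq]
  congr 1; ext θ
  rw [← hk_re]; simp [hk, herglotzRieszKernel]

lemma poisson_hol {f : ℂ → ℂ} (hf : HolDisc f) {r : ℝ} (h0 : 0 ≤ r) (h1 : r < 1) {w : ℂ}
    (hw : w ∈ uDisc) : ∫ θ, (pk w θ : ℂ) * f (r * bd θ) ∂m = f (r * w) := by
  refine poisson_DC (f := fun z => f (r * z)) ?_ hw
  refine DifferentiableOn.diffContOnCl ?_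
  rw [closure_ball _ one_ne_zero]
  refine DifferentiableOn.comp hf (by fun_prop) ?_
  intro z hz
  have hz : ‖z‖ ≤ 1 := by simpa using hz
  simp only [mem_ball_zero_iff, norm_mul, norm_real, Real.norm_of_nonneg h0]
  nlinarith [norm_nonneg z]

lemma integral_pk {w : ℂ} (hw : w ∈ uDisc) : ∫ θ, pk w θ ∂m = 1 := by
  have := poisson_DC (f := fun _ => 1) diffContOnCl_const hw
  simp only [mul_one] at this
  rw [integral_complex_ofReal] at this
  exact_mod_cast this

lemma pk_symm (r : ℝ) (θ t : Tc) : pk (r * bd θ) t = pk (r * bd t) θ := by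
  have key : ‖(r : ℂ) * bd θ - bd t‖ = ‖(r : ℂ) * bd t - bd θ‖ := by
    have e : ∀ z w : ℂ, ‖z‖ = 1 → ‖w‖ = 1 → ‖(r : ℂ) * z - w‖ ^ 2 = r ^ 2 + 1 - 2 * r * (z * conj w).re := by
      intro z w hz hw
      rw [← normSq_eq_norm_sq, normSq_sub, normSq_mul, normSq_eq_norm_sq z, normSq_eq_norm_sq w, hz, hw,
        normSq_ofReal, mul_assoc (r : ℂ) z, re_ofReal_mul]
      ring
    have h1 := e (bd θ) (bd t) (norm_bd _) (norm_bd _)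
    have h2 := e (bd t) (bd θ) (norm_bd _) (norm_bd _)
    have h3 : (bd t * conj (bd θ)).re = (bd θ * conj (bd t)).re := by
      simp only [mul_re, conj_re, conj_im]; ring
    rw [h3, ← h1] at h2
    exact ((sq_eq_sq₀ (norm_nonneg _) (norm_nonneg _)).1 h2).symm
  unfold pk
  rw [key]; simp [norm_bd]

/-- Poisson integral of boundary functions -/
def PI (φ : Tc → ℂ) (z : ℂ) : ℂ := ∫ t, (pk z t : ℂ) * φ t ∂m

lemma pk_int {z : ℂ} (hz : z ∈ uDisc) {μ : Measure Tc} {φ : Tc → ℂ} (hφ : Integrable φ μ) :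
    Integrable (fun t => (pk z t : ℂ) * φ t) μ := by
  obtain ⟨C, hC⟩ := (isCompact_range (pk_cont hz)).isBounded.exists_norm_le
  refine hφ.bdd_mul (c := C) (continuous_ofReal.comp (pk_cont hz)).aestronglyMeasurable ?_
  refine ae_of_all _ fun t => ?_
  simp only [norm_real]; exact hC _ ⟨t, rfl⟩

lemma hk_int {z : ℂ} (hz : z ∈ uDisc) {μ : Measure Tc} {φ : Tc → ℂ} (hφ : Integrable φ μ) :
    Integrable (fun t => hk z t * φ t) μ := by
  obtain ⟨C, hC⟩ := (isCompact_range (hk_cont hz)).isBounded.exists_norm_le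
  refine hφ.bdd_mul (c := C) (hk_cont hz).aestronglyMeasurable ?_
  exact ae_of_all _ fun t => hC _ ⟨t, rfl⟩

lemma PI_fourier {r : ℝ} (h0 : 0 ≤ r) (h1 : r < 1) (n : ℤ) (θ : Tc) :
    PI (fun t => fourier n t) (r * bd θ) = (r : ℂ) ^ n.natAbs * fourier n θ := by
  have key : ∀ k : ℕ, PI (fun t => fourier (k : ℤ) t) (r * bd θ) = (r : ℂ) ^ k * fourier (k : ℤ) θ := by
    intro k
    have := poisson_DC (f := fun z => z ^ k) (by
      exact (Differentiable.diffContOnCl (by fun_prop))) (r_bd_mem h0 h1 θ)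
    simp only [mul_pow, bd_pow] at this
    exact this
  rcases Int.natAbs_eq n with h | h
  · rw [h, Int.natAbs_natCast]; exact key _
  · rw [h, Int.natAbs_neg, Int.natAbs_natCast]
    have := congrArg conj (key n.natAbs)
    rw [PI, ← integral_conj] at this
    simp only [map_mul, map_pow, conj_ofReal, ← fourier_neg] at this
    exact this

lemma pk_prod_cont {r : ℝ} (h0 : 0 ≤ r) (h1 : r < 1) :
    Continuous (fun p : Tc × Tc => pk (r * bd p.1) p.2) := by
  have hb := continuous_bd
  unfold pk
  refine Continuous.div (by fun_prop) (by fun_prop) ?_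
  intro p
  rw [norm_sub_rev]
  exact (pow_pos (norm_pos_iff.2 (bd_sub_ne (r_bd_mem h0 h1 p.1) p.2)) _).ne'

lemma pk_prod_int {r : ℝ} (h0 : 0 ≤ r) (h1 : r < 1) {φ : Tc → ℂ} (hφ : Integrable φ m) :
    Integrable (fun p : Tc × Tc => (pk (r * bd p.1) p.2 : ℂ) * φ p.2) (m.prod m) := by
  obtain ⟨C, hC⟩ := (isCompact_range (pk_prod_cont h0 h1)).isBounded.exists_norm_le
  refine (hφ.comp_snd m).bdd_mul (c := C)
    (continuous_ofReal.comp (pk_prod_cont h0 h1)).aestronglyMeasurable ?_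
  refine ae_of_all _ fun t => ?_
  simp only [norm_real]; exact hC _ ⟨t, rfl⟩

lemma PI_integrable {r : ℝ} (h0 : 0 ≤ r) (h1 : r < 1) {φ : Tc → ℂ} (hφ : Integrable φ m) :
    Integrable (fun θ => PI φ (r * bd θ)) m :=
  (pk_prod_int h0 h1 hφ).integral_prod_left

lemma PI_contract {r : ℝ} (h0 : 0 ≤ r) (h1 : r < 1) {φ : Tc → ℂ} (hφ : Integrable φ m) :
    ∫ θ, ‖PI φ (r * bd θ)‖ ∂m ≤ ∫ θ, ‖φ θ‖ ∂m := by
  have hp := pk_prod_int h0 h1 hφ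
  calc ∫ θ, ‖PI φ (r * bd θ)‖ ∂m ≤ ∫ θ, ∫ t, ‖(pk (r * bd θ) t : ℂ) * φ t‖ ∂m ∂m := by
        refine integral_mono (PI_integrable h0 h1 hφ).norm hp.norm.integral_prod_left ?_
        intro θ
        exact norm_integral_le_integral_norm _
    _ = ∫ t, ∫ θ, ‖(pk (r * bd θ) t : ℂ) * φ t‖ ∂m ∂m := integral_integral_swap hp.norm
    _ = ∫ t, ‖φ t‖ ∂m := by
        congr 1; ext t
        have : ∀ θ, ‖(pk (r * bd θ) t : ℂ) * φ t‖ = pk (r * bd t) θ * ‖φ t‖ := by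
          intro θ
          rw [norm_mul, norm_real, Real.norm_of_nonneg (pk_pos (r_bd_mem h0 h1 θ) t).le, pk_symm]
        simp only [this]
        rw [integral_mul_const, integral_pk (r_bd_mem h0 h1 t), one_mul]

lemma PI_sub {z : ℂ} (hz : z ∈ uDisc) {φ ψ : Tc → ℂ} (hφ : Integrable φ m) (hψ : Integrable ψ m) :
    PI (fun t => φ t - ψ t) z = PI φ z - PI ψ z := by
  unfold PI
  rw [← integral_sub (pk_int hz hφ) (pk_int hz hψ)]
  congr 1; ext t; ring
lemma PI_add {z : ℂ} (hz : z ∈ uDisc) {φ ψ : Tc → ℂ} (hφ : Integrable φ m) (hψ : Integrable ψ m) :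
    PI (fun t => φ t + ψ t) z = PI φ z + PI ψ z := by
  unfold PI
  rw [← integral_add (pk_int hz hφ) (pk_int hz hψ)]
  congr 1; ext t; ring
lemma PI_smul {z : ℂ} {φ : Tc → ℂ} (c : ℂ) :
    PI (fun t => c * φ t) z = c * PI φ z := by
  unfold PI
  rw [← integral_const_mul]
  congr 1; ext t; ring
lemma PI_congr {z : ℂ} {φ ψ : Tc → ℂ} (h : φ =ᵐ[m] ψ) : PI φ z = PI ψ z := by
  apply integral_congr_ae
  filter_upwards [h] with t ht
  rw [ht]

/-- L1 defect -/
def NN (φ : Tc → ℂ) (k : ℕ) : ℝ := ∫ θ, ‖PI φ (rk k * bd θ) - φ θ‖ ∂m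

lemma NN_congr {φ ψ : Tc → ℂ} (h : φ =ᵐ[m] ψ) (k : ℕ) : NN φ k = NN ψ k := by
  apply integral_congr_ae
  filter_upwards [h] with t ht
  rw [ht, PI_congr h]

lemma NN_int {φ : Tc → ℂ} (hφ : Integrable φ m) (k : ℕ) :
    Integrable (fun θ => PI φ (rk k * bd θ) - φ θ) m :=
  (PI_integrable (rk_nonneg k) (rk_lt k) hφ).sub hφ

lemma NN_nonneg (φ : Tc → ℂ) (k : ℕ) : 0 ≤ NN φ k := integral_nonneg fun _ => norm_nonneg _

lemma NN_add {φ ψ : Tc → ℂ} (hφ : Integrable φ m) (hψ : Integrable ψ m) (k : ℕ) :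
    NN (fun t => φ t + ψ t) k ≤ NN φ k + NN ψ k := by
  unfold NN
  rw [← integral_add (NN_int hφ k).norm (NN_int hψ k).norm]
  refine integral_mono (NN_int (hφ.add hψ) k).norm ((NN_int hφ k).norm.add (NN_int hψ k).norm) ?_
  intro θ
  have : PI (fun t => φ t + ψ t) (rk k * bd θ) = _ := PI_add (r_bd_mem (rk_nonneg k) (rk_lt k) θ) hφ hψ
  simp only [this, add_sub_add_comm]
  exact norm_add_le _ _

lemma NN_smul {φ : Tc → ℂ} (c : ℂ) (k : ℕ) : NN (fun t => c * φ t) k = ‖c‖ * NN φ k := by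
  unfold NN
  rw [← integral_const_mul]
  congr 1; ext θ
  rw [PI_smul, ← mul_sub, norm_mul]

lemma NN_le {φ : Tc → ℂ} (hφ : Integrable φ m) (k : ℕ) : NN φ k ≤ 2 * ∫ θ, ‖φ θ‖ ∂m := by
  have h1 := PI_contract (rk_nonneg k) (rk_lt k) hφ
  have h2 : NN φ k ≤ ∫ θ, ‖PI φ (rk k * bd θ)‖ + ‖φ θ‖ ∂m := by
    refine integral_mono (NN_int hφ k).norm
      ((PI_integrable (rk_nonneg k) (rk_lt k) hφ).norm.add hφ.norm) fun θ => ?_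
    exact norm_sub_le _ _
  rw [integral_add (PI_integrable (rk_nonneg k) (rk_lt k) hφ).norm hφ.norm] at h2
  linarith

lemma rk_tendsto_one : Tendsto rk atTop (nhds 1) := (tendsto_nhdsWithin_iff.1 rk_tendsto).1

lemma rkC_tendsto : Tendsto (fun k => ((rk k : ℝ) : ℂ)) atTop (nhds 1) :=
  (continuous_ofReal.tendsto 1).comp rk_tendsto_one

/-- functions whose Poisson integrals converge in L1 -/
def NNsub : Submodule ℂ (Lp ℂ 1 m) where
  carrier := {F | Tendsto (NN (F : Tc → ℂ)) atTop (nhds 0)}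
  zero_mem' := by
    have : ∀ k, NN ((0 : Lp ℂ 1 m) : Tc → ℂ) k = 0 := by
      intro k
      rw [NN_congr (Lp.coeFn_zero ℂ 1 m)]
      simp [NN, PI]
    simp only [mem_ofPred_eq]
    rw [funext this]; exact tendsto_const_nhds
  add_mem' := by
    intro F G hF hG
    simp only [mem_ofPred_eq] at *
    have hF1 := L1.integrable_coeFn F
    have hG1 := L1.integrable_coeFn G
    refine squeeze_zero (fun k => NN_nonneg _ k) (fun k => ?_) (by simpa using hF.add hG)
    rw [NN_congr (Lp.coeFn_add F G)]
    exact NN_add hF1 hG1 k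
  smul_mem' := by
    intro c F hF
    simp only [mem_ofPred_eq] at *
    have : ∀ k, NN ((c • F : Lp ℂ 1 m) : Tc → ℂ) k = ‖c‖ * NN (F : Tc → ℂ) k := by
      intro k
      rw [NN_congr (Lp.coeFn_smul c F)]
      exact NN_smul c k
    rw [funext this]; simpa using hF.const_mul ‖c‖

lemma NN_close (F G : Lp ℂ 1 m) (k : ℕ) :
    NN (F : Tc → ℂ) k ≤ NN (G : Tc → ℂ) k + 2 * ‖F - G‖ := by
  have hG1 := L1.integrable_coeFn G
  have hFG := L1.integrable_coeFn (F - G)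
  have h1 := NN_add hG1 hFG k
  have h2 := NN_le hFG k
  rw [← L1.norm_eq_integral_norm] at h2
  have h3 : (F : Tc → ℂ) =ᵐ[m] fun t => (G : Tc → ℂ) t + (F - G : Lp ℂ 1 m) t := by
    filter_upwards [Lp.coeFn_sub F G] with t ht
    rw [ht]; simp
  rw [NN_congr h3]; linarith

lemma NNsub_closed : IsClosed (NNsub : Set (Lp ℂ 1 m)) := by
  rw [← closure_subset_iff_isClosed]
  intro F hF
  change Tendsto _ _ _
  rw [Metric.tendsto_atTop]
  intro ε hε
  obtain ⟨G, hG, hd⟩ := Metric.mem_closure_iff.1 hF (ε / 4) (by positivity)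
  obtain ⟨N, hN⟩ := Metric.tendsto_atTop.1 (show Tendsto (NN (G : Tc → ℂ)) atTop (nhds 0) from hG)
    (ε / 2) (by positivity)
  refine ⟨N, fun k hk => ?_⟩
  have h1 := hN k hk
  have h2 := NN_close F G k
  rw [dist_eq_norm] at hd
  rw [Real.dist_0_eq_abs, abs_of_nonneg (NN_nonneg _ _)] at *
  linarith

lemma NNsub_top : NNsub = ⊤ := by
  rw [eq_top_iff]
  have := span_fourierLp_closure_eq_top (T := 2 * Real.pi) (p := 1) (by simp)
  rw [show (⊤ : Submodule ℂ (Lp ℂ 1 m)) = _ from this.symm]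
  refine Submodule.topologicalClosure_minimal _ ?_ NNsub_closed
  refine Submodule.span_le.2 ?_
  rintro _ ⟨n, rfl⟩
  change Tendsto _ _ _
  have e : ∀ k, NN ((fourierLp 1 n : Lp ℂ 1 m) : Tc → ℂ) k = ‖(rk k : ℂ) ^ n.natAbs - 1‖ := by
    intro k
    rw [NN_congr (show _ =ᵐ[m] _ from coeFn_fourierLp 1 n)]
    unfold NN
    have : ∀ θ, ‖PI (fun t => fourier n t) (rk k * bd θ) - fourier n θ‖ = ‖(rk k : ℂ) ^ n.natAbs - 1‖ := by
      intro θ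
      rw [PI_fourier (rk_nonneg k) (rk_lt k), ← sub_one_mul, norm_mul, norm_fourier_pt, mul_one]
    have h2 : ∫ θ, ‖PI (fun t => fourier n t) (rk k * bd θ) - fourier n θ‖ ∂m
      = ‖(rk k : ℂ) ^ n.natAbs - 1‖ := by simp only [this]; simp
    exact h2
  have := ((rkC_tendsto.pow n.natAbs).sub_const 1).norm
  rw [one_pow, sub_self, norm_zero] at this
  refine this.congr fun k => ?_
  exact (e k).symm

lemma poisson_L1 {φ : Tc → ℂ} (hφ : Integrable φ m) : Tendsto (NN φ) atTop (nhds 0) := by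
  have h : hφ.toL1 φ ∈ NNsub := by rw [NNsub_top]; trivial
  have h2 : Tendsto (NN (hφ.toL1 φ : Tc → ℂ)) atTop (nhds 0) := h
  rwa [funext (NN_congr hφ.coeFn_toL1)] at h2

lemma poisson_ae {φ : Tc → ℂ} (hφ : Integrable φ m) : ∃ ns : ℕ → ℕ, StrictMono ns ∧
    ∀ᵐ θ ∂m, Tendsto (fun i => PI φ (rk (ns i) * bd θ)) atTop (nhds (φ θ)) := by
  have h := poisson_L1 hφ
  have : TendstoInMeasure m (fun k θ => PI φ (rk k * bd θ)) atTop φ := by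
    refine tendstoInMeasure_of_tendsto_eLpNorm one_ne_zero
      (fun k => (PI_integrable (rk_nonneg k) (rk_lt k) hφ).1) hφ.1 ?_
    have e : ∀ k, eLpNorm ((fun θ => PI φ (rk k * bd θ)) - φ) 1 m = ENNReal.ofReal (NN φ k) := by
      intro k
      rw [eLpNorm_one_eq_lintegral_enorm]
      exact (ofReal_integral_norm_eq_lintegral_enorm (NN_int hφ k)).symm
    rw [funext e]
    simpa using ENNReal.tendsto_ofReal h
  exact this.exists_seq_tendsto_ae

lemma rk_sub {ns : ℕ → ℕ} (h : StrictMono ns) : Tendsto (fun i => rk (ns i)) atTop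
    (nhdsWithin 1 (Set.Iio 1)) := rk_tendsto.comp h.tendsto_atTop

lemma poisson_radial {φ g : Tc → ℂ} (hφ : Integrable φ m)
    (hg : ∀ᵐ θ ∂m, Tendsto (fun r : ℝ => PI φ (r * bd θ)) (nhdsWithin 1 (Set.Iio 1)) (nhds (g θ))) :
    g =ᵐ[m] φ := by
  obtain ⟨ns, h1, h2⟩ := poisson_ae hφ
  filter_upwards [h2, hg] with θ a b
  exact tendsto_nhds_unique (b.comp (rk_sub h1)) a


/-- Herglotz integral of a real function -/
def Hg (φ : Tc → ℝ) (z : ℂ) : ℂ := ∫ θ, hk z θ * (φ θ : ℂ) ∂m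
/-- Real Poisson integral -/
def RP (φ : Tc → ℝ) (z : ℂ) : ℝ := ∫ θ, pk z θ * φ θ ∂m

lemma pk_intR {z : ℂ} (hz : z ∈ uDisc) {μ : Measure Tc} {φ : Tc → ℝ} (hφ : Integrable φ μ) :
    Integrable (fun t => pk z t * φ t) μ := by
  obtain ⟨C, hC⟩ := (isCompact_range (pk_cont hz)).isBounded.exists_norm_le
  refine hφ.bdd_mul (c := C) (pk_cont hz).aestronglyMeasurable ?_
  exact ae_of_all _ fun t => hC _ ⟨t, rfl⟩

lemma PI_ofReal (φ : Tc → ℝ) (z : ℂ) : PI (fun t => (φ t : ℂ)) z = (RP φ z : ℂ) := by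
  unfold PI RP
  rw [← integral_complex_ofReal]
  congr 1; ext t; push_cast; ring

lemma Hg_re {φ : Tc → ℝ} (hφ : Integrable φ m) {z : ℂ} (hz : z ∈ uDisc) :
    (Hg φ z).re = RP φ z := by
  have h1 := integral_re (hk_int hz (μ := m) hφ.ofReal)
  unfold Hg
  refine h1.symm.trans ?_
  unfold RP
  congr 1; ext θ
  rw [← hk_re]; simp

lemma Hg_hol {φ : Tc → ℝ} (hφ : Integrable φ m) : HolDisc (Hg φ) :=
  (herg_PS (μ := m) (φ := fun θ => (φ θ : ℂ)) hφ.ofReal).hol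

lemma intC {φ : Tc → ℝ} {μ : Measure Tc} (hφ : Integrable φ μ) :
    Integrable (fun θ => (φ θ : ℂ)) μ := hφ.ofReal

lemma Hg_add {φ ψ χ : Tc → ℝ} (hφ : Integrable φ m) (hψ : Integrable ψ m)
    (h : ∀ θ, χ θ = φ θ + ψ θ) {z : ℂ} (hz : z ∈ uDisc) : Hg φ z + Hg ψ z = Hg χ z := by
  unfold Hg
  rw [← integral_add (hk_int hz (intC hφ)) (hk_int hz (intC hψ))]
  congr 1; ext θ
  rw [h]; push_cast; ring

lemma norm_ee (n : ℤ) : ‖ee n‖ = 1 :=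
  (orthonormal_fourier (T := 2 * Real.pi)).1 n

lemma Hg_zero (φ : Tc → ℝ) : Hg φ 0 = ((∫ θ, φ θ ∂m : ℝ) : ℂ) := by
  unfold Hg
  rw [← integral_complex_ofReal]
  congr 1; ext θ
  have : bd θ ≠ 0 := by
    have := norm_bd θ
    intro h; rw [h, norm_zero] at this; exact zero_ne_one this
  simp [hk, this]

lemma norm_exp_Hg {φ : Tc → ℝ} (hφ : Integrable φ m) {z : ℂ} (hz : z ∈ uDisc) :
    ‖cexp (Hg φ z)‖ = Real.exp (RP φ z) := by
  rw [Complex.norm_exp, Hg_re hφ hz]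

lemma exp_Hg_hol {φ : Tc → ℝ} (hφ : Integrable φ m) : HolDisc (fun z => cexp (Hg φ z)) :=
  (Hg_hol hφ).cexp

lemma RP_mono {φ ψ : Tc → ℝ} (hφ : Integrable φ m) (hψ : Integrable ψ m) (h : ∀ᵐ θ ∂m, φ θ ≤ ψ θ)
    {z : ℂ} (hz : z ∈ uDisc) : RP φ z ≤ RP ψ z := by
  refine integral_mono_ae (pk_intR hz hφ) (pk_intR hz hψ) ?_
  filter_upwards [h] with θ hθ
  exact mul_le_mul_of_nonneg_left hθ (pk_pos hz θ).le

lemma RP_const (C : ℝ) {z : ℂ} (hz : z ∈ uDisc) : RP (fun _ => C) z = C := by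
  unfold RP
  rw [integral_mul_const, integral_pk hz, one_mul]

lemma RP_le {φ : Tc → ℝ} (hφ : Integrable φ m) {C : ℝ} (h : ∀ᵐ θ ∂m, φ θ ≤ C)
    {z : ℂ} (hz : z ∈ uDisc) : RP φ z ≤ C :=
  (RP_mono hφ (integrable_const C) h hz).trans_eq (RP_const C hz)

lemma RP_ge {φ : Tc → ℝ} (hφ : Integrable φ m) {C : ℝ} (h : ∀ᵐ θ ∂m, C ≤ φ θ)
    {z : ℂ} (hz : z ∈ uDisc) : C ≤ RP φ z :=
  (RP_const C hz).symm.trans_le (RP_mono (integrable_const C) hφ h hz)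

lemma RP_ae {φ : Tc → ℝ} (hφ : Integrable φ m) : ∃ ns : ℕ → ℕ, StrictMono ns ∧
    ∀ᵐ θ ∂m, Tendsto (fun i => RP φ (rk (ns i) * bd θ)) atTop (nhds (φ θ)) := by
  obtain ⟨ns, h1, h2⟩ := poisson_ae (φ := fun θ => (φ θ : ℂ)) hφ.ofReal
  refine ⟨ns, h1, ?_⟩
  filter_upwards [h2] with θ hθ
  simp only [PI_ofReal] at hθ
  have := (continuous_re.tendsto _).comp hθ
  simpa [Function.comp_def] using this

lemma OuterFn.rep {f : ℂ → ℂ} (h : OuterFn f) : ∃ (α : ℂ) (φ : Tc → ℝ), ‖α‖ = 1 ∧ Integrable φ m ∧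
    ∀ z ∈ uDisc, f z = α * cexp (Hg φ z) := by
  obtain ⟨_, α, w, h1, _, h3, h4⟩ := h
  exact ⟨α, _, h1, h3, h4⟩

lemma outer_norm {f : ℂ → ℂ} {α : ℂ} {φ : Tc → ℝ} (hα : ‖α‖ = 1) (hφ : Integrable φ m)
    (hf : ∀ z ∈ uDisc, f z = α * cexp (Hg φ z)) {z : ℂ} (hz : z ∈ uDisc) :
    ‖f z‖ = Real.exp (RP φ z) := by
  rw [hf z hz, norm_mul, hα, one_mul, norm_exp_Hg hφ hz]

lemma outer_bdry {f : ℂ → ℂ} {fs : Tc → ℂ} {α : ℂ} {φ : Tc → ℝ} (hα : ‖α‖ = 1)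
    (hφ : Integrable φ m) (hf : ∀ z ∈ uDisc, f z = α * cexp (Hg φ z)) (hb : IsBdry f fs) :
    ∀ᵐ θ ∂m, ‖fs θ‖ = Real.exp (φ θ) := by
  obtain ⟨ns, h1, h2⟩ := RP_ae hφ
  filter_upwards [h2, hb] with θ a b
  refine tendsto_nhds_unique (b.comp (rk_sub h1)).norm ?_
  refine ((Real.continuous_exp.tendsto _).comp a).congr fun i => ?_
  exact (outer_norm hα hφ hf (r_bd_mem (rk_nonneg _) (rk_lt _) θ)).symm

/-- construct L2 elements from square-summable coefficients -/
lemma L2_of_coeff (a : ℕ → ℂ) (h : Summable fun n => ‖a n‖ ^ 2) :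
    ∃ F ∈ H2, (∀ n : ℕ, ⟪ee n, F⟫_ℂ = a n) ∧ HasSum (fun n => ‖a n‖ ^ 2) (‖F‖ ^ 2) := by
  have hO : Orthonormal ℂ (fun n : ℕ => ee n) := by
    rw [orthonormal_iff_ite]
    intro i j
    rw [inner_ee_ee]; simp
  have hs : Summable fun n : ℕ => a n • ee n := by
    have hf := hO.orthogonalFamily.summable_iff_norm_sq_summable (fun n => a n)
    have := hf.2 h
    simpa [LinearIsometry.toSpanSingleton_apply] using this
  have hS := hs.hasSum
  set F := ∑' n : ℕ, a n • ee n
  have hin : ∀ n : ℤ, HasSum (fun k : ℕ => a k * (if n = (k : ℤ) then 1 else 0)) ⟪ee n, F⟫_ℂ := by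
    intro n
    have := hS.mapL (innerSL ℂ (ee n))
    simp only [innerSL_apply_apply, inner_smul_right, inner_ee_ee] at this
    exact this
  have hc : ∀ n : ℕ, ⟪ee n, F⟫_ℂ = a n := by
    intro n
    refine (hin n).unique ?_
    convert hasSum_single (f := fun k : ℕ => a k * (if (n : ℤ) = (k : ℤ) then 1 else 0)) n ?_ using 1
    · simp
    · intro k hk; rw [if_neg (by exact_mod_cast hk.symm), mul_zero]
  refine ⟨F, ?_, hc, ?_⟩
  · rw [mem_H2_iff]
    intro n hn
    refine (hin n).unique ?_
    convert hasSum_zero with k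
    rw [if_neg (by omega), mul_zero]
  · have := hS.mapL (innerSL ℂ F)
    simp only [innerSL_apply_apply, inner_smul_right] at this
    have h2 := (reCLM.hasSum this)
    rw [reCLM_apply, inner_self_eq_norm_sq_to_K] at h2
    convert h2 using 1
    · ext n
      rw [← inner_conj_symm, hc n, reCLM_apply, mul_conj, ofReal_re, normSq_eq_norm_sq]
    · norm_cast

lemma H2L {f : ℂ → ℂ} {c : PowerSeries ℂ} {M : ℝ} (hc : PS f c) (hM : ∀ z ∈ uDisc, ‖f z‖ ≤ M) :
    ∃ F ∈ H2, psL F = c ∧ ‖F‖ ≤ M := by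
  have hf := hc.hol
  have hM0 : 0 ≤ M := (norm_nonneg _).trans (hM 0 (by simp))
  have hO : Orthonormal ℂ (fun n : ℕ => ee n) := by
    rw [orthonormal_iff_ite]
    intro i j
    rw [inner_ee_ee]; simp
  have hfin : ∀ N : ℕ, ∑ n ∈ Finset.range N, ‖PowerSeries.coeff n c‖ ^ 2 ≤ M ^ 2 := by
    intro N
    have hk : ∀ k, ∑ n ∈ Finset.range N, ‖PowerSeries.coeff n c * (rk k : ℂ) ^ n‖ ^ 2 ≤ M ^ 2 := by
      intro k
      have hb : Bdd (fun θ => f (rk k * bd θ)) := Bdd.of_cont (hf.cont_dilate (rk_nonneg k) (rk_lt k))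
      have h1 := hO.sum_inner_products_le (mulOp (fun θ => f (rk k * bd θ)) (ee 0))
        (s := Finset.range N)
      have h2 : ‖mulOp (fun θ => f (rk k * bd θ)) (ee 0)‖ ≤ M := by
        have := mulOp_norm_le hb (C := M)
          (ae_of_all _ fun θ => hM _ (r_bd_mem (rk_nonneg k) (rk_lt k) θ)) (ee 0)
        have h0 : ‖ee 0‖ = 1 := by simpa using hO.1 0
        rwa [h0, mul_one] at this
      simp only [inner_ee_mulOp_ee hb, sub_zero, hc.fourier_nat (rk_nonneg k) (rk_lt k)] at h1
      exact h1.trans (by gcongr)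
    refine le_of_tendsto' (x := atTop) ?_ hk
    refine tendsto_finsetSum _ fun n _ => ?_
    have := ((rkC_tendsto.pow n).const_mul (PowerSeries.coeff n c)).norm.pow 2
    simpa using this
  have hs : Summable fun n => ‖PowerSeries.coeff n c‖ ^ 2 :=
    summable_of_sum_range_le (fun n => by positivity) hfin
  obtain ⟨F, hF, h1, h2⟩ := L2_of_coeff _ hs
  refine ⟨F, hF, ?_, ?_⟩
  · ext n; rw [coeff_psL, h1]
  · have : ‖F‖ ^ 2 ≤ M ^ 2 := le_of_tendsto' h2.tendsto_sum_nat hfin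
    exact le_of_sq_le_sq this hM0

lemma Cyc_hyp {fs : Tc → ℂ} (hb : Bdd fs) {H : L2} (h : ∀ n : ℕ, ⟪mulOp fs (ee n), H⟫_ℂ = 0)
    {F : L2} (hF : F ∈ H2) : ⟪mulOp fs F, H⟫_ℂ = 0 := by
  rw [inner_mulOp hb]
  refine H2_inner_zero hF fun n => ?_
  rw [← inner_mulOp hb, h n]

lemma hinf_fourier (k : ℕ) : HinfB (fun θ => fourier (k : ℤ) θ) (PowerSeries.X ^ k) := by
  have e : ∀ n : ℤ, fourierCoeff (fun θ : Tc => fourier (k : ℤ) θ) n = if n = k then 1 else 0 := by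
    intro n
    have := inner_ee_mulOp_ee (Bdd.fourier (k : ℤ)) n 0
    rw [sub_zero, mulOp_fourier_ee, add_zero, inner_ee_ee] at this
    exact this.symm
  refine ⟨Bdd.fourier _, fun n hn => ?_, fun n => ?_⟩
  · rw [e, if_neg (by omega)]
  · rw [e, PowerSeries.coeff_X_pow]; simp

/-- Bounded outer functions are cyclic. -/
lemma outer_cyc {f : ℂ → ℂ} {fs : Tc → ℂ} {M : ℝ} (hf : HolDisc f) (hM : ∀ z ∈ uDisc, ‖f z‖ ≤ M)
    (hb : IsBdry f fs) (ho : OuterFn f) : Cyc fs := by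
  intro H hH k
  obtain ⟨α, φ, hα, hφ, hrep⟩ := ho.rep
  obtain ⟨c, hc⟩ := PS.exists hf
  have hB := hinfB_of hc hM hb
  -- truncations
  have hφn : ∀ n : ℕ, Integrable (fun θ => max (φ θ) (-(n : ℝ))) m := fun n =>
    hφ.sup (integrable_const _)
  have hd : ∀ n : ℕ, Integrable (fun θ => φ θ - max (φ θ) (-(n : ℝ))) m := fun n => hφ.sub (hφn n)
  have hU : ∀ n : ℕ, ∃ U : L2, ‖U‖ ≤ 1 ∧
      ⟪ee 0, U⟫_ℂ = α * ((Real.exp (∫ θ, φ θ - max (φ θ) (-(n : ℝ)) ∂m) : ℝ) : ℂ) ∧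
      ⟪mulOp (fun θ => fourier (k : ℤ) θ) U, H⟫_ℂ = 0 := by
    intro n
    have hneg := (hφn n).neg
    obtain ⟨e, he⟩ := PS.exists (exp_Hg_hol hneg)
    have hEb : ∀ z ∈ uDisc, ‖cexp (Hg (-fun θ => max (φ θ) (-(n : ℝ))) z)‖ ≤ Real.exp n := by
      intro z hz
      rw [norm_exp_Hg hneg hz, Real.exp_le_exp]
      refine RP_le hneg (ae_of_all _ fun θ => ?_) hz
      simp only [Pi.neg_apply]
      linarith [le_max_right (φ θ) (-(n : ℝ))]
    obtain ⟨E, hE, hpE, _⟩ := H2L he hEb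
    have hprod := hc.mul he
    have hrep2 : ∀ z ∈ uDisc, f z * cexp (Hg (-fun θ => max (φ θ) (-(n : ℝ))) z)
        = α * cexp (Hg (fun θ => φ θ - max (φ θ) (-(n : ℝ))) z) := by
      intro z hz
      rw [hrep z hz, mul_assoc, ← Complex.exp_add]
      congr 2
      exact Hg_add hφ hneg (fun θ => by simp [sub_eq_add_neg]) hz
    obtain ⟨U, hUm, hpU, hUn⟩ := H2L (M := 1) hprod (by
      intro z hz
      rw [hrep2 z hz, norm_mul, hα, one_mul, norm_exp_Hg (hd n) hz, Real.exp_le_one_iff]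
      refine RP_le (hd n) (ae_of_all _ fun θ => ?_) hz
      linarith [le_max_left (φ θ) (-(n : ℝ))])
    have hUE : U = mulOp fs E := by
      refine psL_inj hUm (hB.mul_mem hE) ?_
      rw [hB.psL_mul hE, hpE, hpU]
    refine ⟨U, hUn, ?_, ?_⟩
    · have h1 := hprod.zero
      rw [← hpU, coeff_psL, hrep2 0 (by simp), Hg_zero] at h1
      rw [ofReal_exp]
      exact h1.symm
    · rw [hUE, mulOp_comm (Bdd.fourier _) hB.1]
      exact Cyc_hyp hB.1 hH ((hinf_fourier k).mul_mem hE)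
  choose U hU1 hU2 hU3 using hU
  have hintg : Tendsto (fun n : ℕ => ∫ θ, φ θ - max (φ θ) (-(n : ℝ)) ∂m) atTop (nhds 0) := by
    have : (0 : ℝ) = ∫ θ : Tc, (0 : ℝ) ∂m := by simp
    rw [this]
    refine tendsto_integral_of_dominated_convergence (fun θ => |φ θ|) (fun n => (hd n).1) hφ.abs ?_ ?_
    · intro n
      refine ae_of_all _ fun θ => ?_
      rw [Real.norm_eq_abs, abs_le]
      have hn : (0 : ℝ) ≤ n := Nat.cast_nonneg n
      rcases max_cases (φ θ) (-(n : ℝ)) with ⟨h, _⟩ | ⟨h, h'⟩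
      · rw [h]; simp
      · rw [h]
        have := abs_nonneg (φ θ)
        have := neg_abs_le (φ θ)
        constructor <;> linarith
    · refine ae_of_all _ fun θ => ?_
      obtain ⟨N, hN⟩ := exists_nat_ge (-(φ θ))
      refine tendsto_const_nhds.congr' ?_
      filter_upwards [eventually_ge_atTop N] with n hn
      have : (N : ℝ) ≤ n := by exact_mod_cast hn
      rw [max_eq_left (by linarith), sub_self]
  have hconv : Tendsto U atTop (nhds (α • ee 0)) := by
    rw [tendsto_iff_norm_sub_tendsto_zero]
    have hsq : Tendsto (fun n => ‖U n - α • ee 0‖ ^ 2) atTop (nhds 0) := by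
      have hlim : Tendsto (fun n : ℕ => 2 - 2 * Real.exp (∫ θ, φ θ - max (φ θ) (-(n : ℝ)) ∂m))
          atTop (nhds 0) := by
        have := (((Real.continuous_exp.tendsto 0).comp hintg).const_mul 2).const_sub 2
        simpa [Function.comp_def] using this
      refine squeeze_zero (fun n => by positivity) (fun n => ?_) hlim
      have h1 := norm_sub_sq (𝕜 := ℂ) (U n) (α • ee 0)
      have h2 : ‖α • ee 0‖ = 1 := by
        rw [norm_smul, hα, one_mul]
        exact norm_ee 0
      have h3 : RCLike.re ⟪U n, α • ee 0⟫_ℂ = Real.exp (∫ θ, φ θ - max (φ θ) (-(n : ℝ)) ∂m) := by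
        rw [inner_smul_right, ← inner_conj_symm, hU2 n, map_mul (starRingEnd ℂ), conj_ofReal, ← mul_assoc, mul_conj,
          normSq_eq_norm_sq, hα, one_pow, ofReal_one, one_mul]
        exact ofReal_re _
      rw [h1, h2, h3]
      nlinarith [hU1 n, norm_nonneg (U n)]
    have := hsq.sqrt
    simpa [Real.sqrt_sq (norm_nonneg _)] using this
  have hfin : ⟪mulOp (fun θ => fourier (k : ℤ) θ) (α • ee 0), H⟫_ℂ = 0 := by
    have h1 := ((mulOp (fun θ => fourier (k : ℤ) θ)).continuous.tendsto _).comp hconv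
    have h2 := h1.inner (tendsto_const_nhds (x := H)) (𝕜 := ℂ)
    simp only [Function.comp, hU3] at h2
    exact tendsto_nhds_unique h2 tendsto_const_nhds
  rw [map_smul, mulOp_fourier_ee, add_zero, inner_smul_left] at hfin
  rcases mul_eq_zero.1 hfin with h | h
  · exfalso
    have : α = 0 := by simpa using h
    rw [this, norm_zero] at hα; exact zero_ne_one hα
  · exact h


lemma const_of_norm_max {I : ℂ → ℂ} (hI : HolDisc I) (h1 : ∀ z ∈ uDisc, ‖I z‖ ≤ 1) {w : ℂ}
    (hw : w ∈ uDisc) (h : 1 ≤ ‖I w‖) : ∀ z ∈ uDisc, I z = I w := by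
  have := Complex.eqOn_of_isPreconnected_of_isMaxOn_norm (f := I) (U := uDisc) (c := w)
    (convex_ball 0 1).isPreconnected isOpen_ball hI hw (fun z hz => (h1 z hz).trans h)
  exact fun z hz => this hz

lemma BPair.b_lt (P : BPair) {z : ℂ} (hz : z ∈ uDisc) : ‖P.b z‖ < 1 := by
  by_contra h
  exact P.b_nonconst ⟨P.b z, const_of_norm_max P.b_hol P.b_le_one hz (not_lt.1 h)⟩

lemma BPair.exists_good (P : BPair) : ∃ A B, Good P A B ∧ PS P.a A ∧ PS P.b B ∧
    (∀ᵐ θ ∂m, P.as' θ ≠ 0) := by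
  obtain ⟨B, hB⟩ := PS.exists P.b_hol
  obtain ⟨A, hA⟩ := PS.exists P.a_outer.1
  obtain ⟨α, φ, hα, hφ, hrep⟩ := P.a_outer.rep
  have hbd := outer_bdry hα hφ hrep P.a_bdry
  have hle : ∀ᵐ θ ∂m, φ θ ≤ 0 := by
    filter_upwards [hbd, P.pyth] with θ h1 h2
    rw [← Real.exp_le_one_iff, ← h1]
    nlinarith [norm_nonneg (P.as' θ), sq_nonneg ‖P.bs θ‖]
  have hM : ∀ z ∈ uDisc, ‖P.a z‖ ≤ 1 := by
    intro z hz
    rw [outer_norm hα hφ hrep hz, Real.exp_le_one_iff]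
    exact RP_le hφ hle hz
  refine ⟨A, B, ⟨hinfB_of hA hM P.a_bdry, hinfB_of hB P.b_le_one P.b_bdry, ?_,
    outer_cyc P.a_outer.1 hM P.a_bdry P.a_outer⟩, hA, hB, ?_⟩
  · obtain ⟨r, hr, h⟩ := P.a0_pos
    rw [← PowerSeries.coeff_zero_eq_constantCoeff_apply, ← hA.zero, h]
    exact_mod_cast hr.ne'
  · filter_upwards [hbd] with θ h
    rw [← norm_ne_zero_iff, h]
    exact (Real.exp_pos _).ne'

lemma le_outer {f : ℂ → ℂ} {fs : Tc → ℂ} {M C : ℝ} {ψ : Tc → ℝ} (hf : HolDisc f)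
    (hM : ∀ z ∈ uDisc, ‖f z‖ ≤ M) (hb : IsBdry f fs) (hψ : Integrable ψ m) (hC : ∀ᵐ θ ∂m, C ≤ ψ θ)
    (hle : ∀ᵐ θ ∂m, ‖fs θ‖ ≤ Real.exp (ψ θ)) {w : ℂ} (hw : w ∈ uDisc) :
    ‖f w‖ ≤ Real.exp (RP ψ w) := by
  obtain ⟨ns, hns, hlim⟩ := RP_ae hψ
  have hM0 : 0 ≤ M := (norm_nonneg _).trans (hM 0 (by simp))
  set g : ℂ → ℂ := fun z => f z * cexp (-Hg ψ z) with hg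
  have hgh : HolDisc g := hf.mul (Hg_hol hψ).neg.cexp
  have hgn : ∀ z ∈ uDisc, ‖g z‖ = ‖f z‖ * Real.exp (-RP ψ z) := by
    intro z hz
    simp only [hg, norm_mul, Complex.norm_exp, neg_re, Hg_re hψ hz]
  have hgM : ∀ z ∈ uDisc, ‖g z‖ ≤ M * Real.exp (-C) := by
    intro z hz
    rw [hgn z hz]
    refine mul_le_mul (hM z hz) (Real.exp_le_exp.2 ?_) (Real.exp_pos _).le hM0
    linarith [RP_ge hψ hC hz]
  have hmem : ∀ i θ, ((rk (ns i) : ℝ) : ℂ) * bd θ ∈ uDisc := fun i θ =>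
    r_bd_mem (rk_nonneg _) (rk_lt _) θ
  -- integral convergence
  have h1 : Tendsto (fun i => ∫ θ, pk w θ * ‖g (rk (ns i) * bd θ)‖ ∂m) atTop
      (nhds (∫ θ, pk w θ * (‖fs θ‖ * Real.exp (-ψ θ)) ∂m)) := by
    refine tendsto_integral_of_dominated_convergence (fun θ => pk w θ * (M * Real.exp (-C))) ?_ ?_ ?_ ?_
    · intro i
      exact ((pk_cont hw).mul (hgh.cont_dilate (rk_nonneg _) (rk_lt _)).norm).aestronglyMeasurable
    · exact pk_intR hw (integrable_const _)
    · intro i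
      refine ae_of_all _ fun θ => ?_
      rw [norm_mul, norm_norm, Real.norm_of_nonneg (pk_pos hw θ).le]
      exact mul_le_mul_of_nonneg_left (hgM _ (hmem i θ)) (pk_pos hw θ).le
    · filter_upwards [hlim, hb] with θ a b
      refine Tendsto.const_mul _ ?_
      have := (b.comp (rk_sub hns)).norm.mul ((Real.continuous_exp.tendsto _).comp a.neg)
      refine this.congr fun i => ?_
      simp only [Function.comp]
      rw [hgn _ (hmem i θ)]
  have h2 : ∫ θ, pk w θ * (‖fs θ‖ * Real.exp (-ψ θ)) ∂m ≤ 1 := by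
    rw [← integral_pk hw]
    refine integral_mono_of_nonneg (ae_of_all _ fun θ => ?_) ((pk_cont hw).integrable_of_hasCompactSupport (HasCompactSupport.of_compactSpace _)) ?_
    · exact mul_nonneg (pk_pos hw θ).le (by positivity)
    · filter_upwards [hle] with θ hθ
      refine mul_le_of_le_one_right (pk_pos hw θ).le ?_
      rw [Real.exp_neg, ← div_eq_mul_inv]
      exact (div_le_one (Real.exp_pos _)).2 hθ
  have h3 : ∀ i, ‖g (rk (ns i) * w)‖ ≤ ∫ θ, pk w θ * ‖g (rk (ns i) * bd θ)‖ ∂m := by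
    intro i
    rw [← poisson_hol hgh (rk_nonneg _) (rk_lt _) hw]
    refine (norm_integral_le_integral_norm _).trans_eq ?_
    congr 1; ext θ
    rw [norm_mul, Complex.norm_real, Real.norm_of_nonneg (pk_pos hw θ).le]
  have h4 : Tendsto (fun i => ‖g (rk (ns i) * w)‖) atTop (nhds ‖g w‖) := by
    have hc : ContinuousAt g w := (hgh.differentiableAt (isOpen_ball.mem_nhds hw)).continuousAt
    have : Tendsto (fun i => ((rk (ns i) : ℝ) : ℂ) * w) atTop (nhds w) := by
      simpa using (rkC_tendsto.comp hns.tendsto_atTop).mul_const w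
    exact (hc.tendsto.comp this).norm
  have h5 : ‖g w‖ ≤ 1 := (le_of_tendsto_of_tendsto' h4 h1 h3).trans h2
  rw [hgn w hw, Real.exp_neg, ← div_eq_mul_inv, div_le_one (Real.exp_pos _)] at h5
  exact h5

lemma log_facts {f : ℂ → ℂ} {fs : Tc → ℂ} {M : ℝ} (hf : HolDisc f)
    (hM : ∀ z ∈ uDisc, ‖f z‖ ≤ M) (hb : IsBdry f fs) (h0 : f 0 ≠ 0) :
    (∀ᵐ θ ∂m, fs θ ≠ 0) ∧ Integrable (fun θ => Real.log ‖fs θ‖) m ∧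
    ∀ w ∈ uDisc, ‖f w‖ ≤ Real.exp (RP (fun θ => Real.log ‖fs θ‖) w) := by
  set L : ℝ := Real.log (max M 1) with hL
  have hL0 : 0 ≤ L := Real.log_nonneg (le_max_right _ _)
  set ψ : ℕ → Tc → ℝ := fun n θ => Real.log (max ‖fs θ‖ (Real.exp (-(n : ℝ)))) with hψ
  have hms : AEStronglyMeasurable fs m := hb.aesm hf
  have hmp : ∀ (n : ℕ) θ, 0 < max ‖fs θ‖ (Real.exp (-(n : ℝ))) := fun n θ =>
    lt_max_of_lt_right (Real.exp_pos _)
  have hlo : ∀ (n : ℕ) θ, -(n : ℝ) ≤ ψ n θ := by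
    intro n θ
    rw [hψ]; simp only
    rw [Real.le_log_iff_exp_le (hmp n θ)]
    exact le_max_right _ _
  have hup : ∀ᵐ θ ∂m, ∀ n, ψ n θ ≤ L := by
    filter_upwards [hb.bound hM] with θ hθ n
    refine Real.log_le_log (hmp n θ) (max_le_max hθ ?_)
    rw [Real.exp_le_one_iff]; simp
  have hanti : ∀ θ, Antitone fun n => ψ n θ := by
    intro θ i j hij
    refine Real.log_le_log (hmp j θ) (max_le_max le_rfl (Real.exp_le_exp.2 ?_))
    have : (i : ℝ) ≤ j := by exact_mod_cast hij
    linarith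
  have hψm : ∀ n, AEMeasurable (ψ n) m := fun n =>
    Real.measurable_log.comp_aemeasurable (hms.norm.aemeasurable.max aemeasurable_const)
  have hψi : ∀ n, Integrable (ψ n) m := by
    intro n
    refine Integrable.of_bound (hψm n).aestronglyMeasurable (max L n) ?_
    filter_upwards [hup] with θ hθ
    rw [Real.norm_eq_abs, abs_le]
    constructor
    · linarith [hlo n θ, le_max_right L (n : ℝ)]
    · exact (hθ n).trans (le_max_left _ _)
  have hfle : ∀ n, ∀ w ∈ uDisc, ‖f w‖ ≤ Real.exp (RP (ψ n) w) := by
    intro n w hw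
    refine le_outer hf hM hb (hψi n) (ae_of_all _ (hlo n)) (ae_of_all _ fun θ => ?_) hw
    rw [hψ]; simp only
    rw [Real.exp_log (hmp n θ)]
    exact le_max_left _ _
  have hRP0 : ∀ φ : Tc → ℝ, RP φ 0 = ∫ θ, φ θ ∂m := by
    intro φ
    unfold RP
    congr 1; ext θ
    simp [pk, norm_bd]
  set K : ℝ := L - Real.log ‖f 0‖ with hK
  have hintg : ∀ n, ∫ θ, (L - ψ n θ) ∂m ≤ K := by
    intro n
    rw [integral_sub (integrable_const _) (hψi n)]
    have := hfle n 0 (by simp)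
    rw [hRP0] at this
    have := (Real.log_le_iff_le_exp (norm_pos_iff.2 h0)).2 this
    simp only [integral_const, probReal_univ, one_smul]
    linarith
  have hsup : ∫⁻ θ, ⨆ n, ENNReal.ofReal (L - ψ n θ) ∂m ≤ ENNReal.ofReal K := by
    rw [lintegral_iSup' (fun n => ((hψm n).const_sub L).ennreal_ofReal)
      (ae_of_all _ fun θ i j hij => ENNReal.ofReal_le_ofReal (by linarith [hanti θ hij]))]
    refine iSup_le fun n => ?_
    rw [← ofReal_integral_eq_lintegral_ofReal (f := fun θ => L - ψ n θ) ((integrable_const _).sub (hψi n))]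
    · exact ENNReal.ofReal_le_ofReal (hintg n)
    · filter_upwards [hup] with θ hθ
      simpa using hθ n
  have hne : ∀ᵐ θ ∂m, fs θ ≠ 0 := by
    have := ae_lt_top' (AEMeasurable.iSup fun n => ((hψm n).const_sub L).ennreal_ofReal)
      (hsup.trans_lt ENNReal.ofReal_lt_top).ne
    filter_upwards [this] with θ hθ h
    refine hθ.ne (ENNReal.eq_top_of_forall_nnreal_le fun r => ?_)
    obtain ⟨n, hn⟩ := exists_nat_ge (r : ℝ)
    refine le_trans ?_ (le_iSup _ n)
    have e : ψ n θ = -(n : ℝ) := by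
      rw [hψ]; simp only
      rw [h, norm_zero, max_eq_right (Real.exp_pos _).le, Real.log_exp]
    rw [e]
    rw [← ENNReal.ofReal_coe_nnreal]
    exact ENNReal.ofReal_le_ofReal (by linarith)
  have hev : ∀ θ, fs θ ≠ 0 → ∃ N, ∀ n ≥ N, ψ n θ = Real.log ‖fs θ‖ := by
    intro θ hθ
    obtain ⟨N, hN⟩ := exists_nat_ge (-Real.log ‖fs θ‖)
    refine ⟨N, fun n hn => ?_⟩
    rw [hψ]; simp only
    rw [max_eq_left]
    rw [← Real.le_log_iff_exp_le (norm_pos_iff.2 hθ)]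
    have : (N : ℝ) ≤ n := by exact_mod_cast hn
    linarith
  have hlogm : AEStronglyMeasurable (fun θ => Real.log ‖fs θ‖) m :=
    (Real.measurable_log.comp_aemeasurable hms.norm.aemeasurable).aestronglyMeasurable
  have hI1 : Integrable (fun θ => L - Real.log ‖fs θ‖) m := by
    refine ⟨aestronglyMeasurable_const.sub hlogm, ?_⟩
    rw [hasFiniteIntegral_iff_ofReal]
    · refine lt_of_le_of_lt (lintegral_mono_ae ?_) (hsup.trans_lt ENNReal.ofReal_lt_top)
      filter_upwards [hne] with θ hθ
      obtain ⟨N, hN⟩ := hev θ hθ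
      rw [← hN N le_rfl]
      exact le_iSup (fun n => ENNReal.ofReal (L - ψ n θ)) N
    · filter_upwards [hne, hup] with θ hθ h2
      obtain ⟨N, hN⟩ := hev θ hθ
      rw [← hN N le_rfl]
      simpa using h2 N
  have hI : Integrable (fun θ => Real.log ‖fs θ‖) m := by
    have := (integrable_const L).sub hI1
    refine this.congr (ae_of_all _ fun θ => ?_)
    simp
  refine ⟨hne, hI, fun w hw => ?_⟩
  have hl : Tendsto (fun n => RP (ψ n) w) atTop (nhds (RP (fun θ => Real.log ‖fs θ‖) w)) := by
    refine tendsto_integral_of_dominated_convergence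
      (fun θ => pk w θ * (L + |Real.log ‖fs θ‖|)) (fun n => (pk_intR hw (hψi n)).1)
      (pk_intR hw ((integrable_const L).add hI.abs)) ?_ ?_
    · intro n
      filter_upwards [hne, hup] with θ hθ h2
      rw [norm_mul, Real.norm_of_nonneg (pk_pos hw θ).le]
      refine mul_le_mul_of_nonneg_left ?_ (pk_pos hw θ).le
      have h3 : Real.log ‖fs θ‖ ≤ ψ n θ := Real.log_le_log (norm_pos_iff.2 hθ) (le_max_left _ _)
      rw [Real.norm_eq_abs, abs_le]
      have := neg_abs_le (Real.log ‖fs θ‖)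
      have := abs_nonneg (Real.log ‖fs θ‖)
      constructor
      · linarith
      · linarith [h2 n]
    · filter_upwards [hne] with θ hθ
      obtain ⟨N, hN⟩ := hev θ hθ
      refine tendsto_const_nhds.congr' ?_
      filter_upwards [eventually_ge_atTop N] with n hn
      rw [hN n hn]
  exact ge_of_tendsto' ((Real.continuous_exp.tendsto _).comp hl) fun n => hfle n w hw

lemma e0_mem_of_cyc {fs : Tc → ℂ} (hC : Cyc fs) :
    ee 0 ∈ (Submodule.span ℂ (Set.range fun n : ℕ => mulOp fs (ee n))).topologicalClosure := by
  rw [← Submodule.orthogonal_orthogonal_eq_closure, Submodule.mem_orthogonal]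
  intro H hH
  rw [Submodule.mem_orthogonal] at hH
  rw [← inner_conj_symm]
  have := hC H (fun n => hH _ (Submodule.subset_span ⟨n, rfl⟩)) 0
  rw [Nat.cast_zero] at this
  rw [this, map_zero]

lemma L2_norm_sq (F : L2) : ‖F‖ ^ 2 = ∫ θ, ‖(F : Tc → ℂ) θ‖ ^ 2 ∂m := by
  have h := inner_self_eq_norm_sq_to_K (𝕜 := ℂ) F
  rw [L2_inner] at h
  have e : ∀ θ, conj ((F : Tc → ℂ) θ) * (F : Tc → ℂ) θ = ((‖(F : Tc → ℂ) θ‖ ^ 2 : ℝ) : ℂ) := by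
    intro θ; rw [conj_mul']; push_cast; rfl
  simp only [e] at h
  rw [integral_complex_ofReal] at h
  have h2 : ((∫ θ, ‖(F : Tc → ℂ) θ‖ ^ 2 ∂m : ℝ) : ℂ) = ((‖F‖ ^ 2 : ℝ) : ℂ) := by
    rw [h]; push_cast; rfl
  exact (ofReal_injective h2).symm

lemma span_poly {fs : Tc → ℂ} (hb : Bdd fs) {G : L2}
    (hG : G ∈ Submodule.span ℂ (Set.range fun n : ℕ => mulOp fs (ee n))) :
    ∃ p : Polynomial ℂ, (G : Tc → ℂ) =ᵐ[m] fun θ => fs θ * p.eval (bd θ) := by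
  induction hG using Submodule.span_induction with
  | mem x h =>
    obtain ⟨n, rfl⟩ := h
    refine ⟨Polynomial.X ^ n, ?_⟩
    filter_upwards [mulOp_coe hb (ee n), ee_coe n] with θ a b
    rw [a, b]; simp [bd_pow]
  | zero => exact ⟨0, by filter_upwards [Lp.coeFn_zero ℂ 2 m] with θ a; rw [a]; simp⟩
  | add x y _ _ hx hy =>
    obtain ⟨p, hp⟩ := hx
    obtain ⟨q, hq⟩ := hy
    refine ⟨p + q, ?_⟩
    filter_upwards [hp, hq, Lp.coeFn_add x y] with θ a b c
    rw [c, Pi.add_apply, a, b, Polynomial.eval_add]; ring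
  | smul r x _ hx =>
    obtain ⟨p, hp⟩ := hx
    refine ⟨Polynomial.C r * p, ?_⟩
    filter_upwards [hp, Lp.coeFn_smul r x] with θ a c
    rw [c, Pi.smul_apply, a, smul_eq_mul, Polynomial.eval_mul, Polynomial.eval_C]; ring

lemma hol_poly (p : Polynomial ℂ) : HolDisc fun z => p.eval z := p.differentiable.differentiableOn

lemma poly_bound (p : Polynomial ℂ) : ∃ C, ∀ z ∈ uDisc, ‖p.eval z‖ ≤ C := by
  obtain ⟨C, hC⟩ := (isCompact_closedBall (0 : ℂ) 1).bddAbove_image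
    (f := fun z => ‖p.eval z‖) (p.continuous.norm.continuousOn)
  exact ⟨C, fun z hz => hC ⟨z, ball_subset_closedBall hz, rfl⟩⟩

lemma inner_e0_bdry {f : ℂ → ℂ} {fs : Tc → ℂ} {M : ℝ} (hf : HolDisc f)
    (hM : ∀ z ∈ uDisc, ‖f z‖ ≤ M) (hb : IsBdry f fs) {G : L2} (hG : (G : Tc → ℂ) =ᵐ[m] fs) :
    ⟪ee 0, G⟫_ℂ = f 0 := by
  obtain ⟨c, hc⟩ := PS.exists hf
  have h := (hinfB_of hc hM hb).2.2 0
  rw [inner_ee, hc.zero, ← h, fourierCoeff_eq, fourierCoeff_eq]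
  apply integral_congr_ae
  filter_upwards [hG] with θ hθ
  rw [hθ]; rfl

/-- an analytic function whose modulus has boundary values dominated by an L2 function -/
lemma mean_le {g : ℂ → ℂ} {M : ℝ} (hg : HolDisc g) (hM : ∀ z ∈ uDisc, ‖g z‖ ≤ M)
    {ns : ℕ → ℕ} {G : L2} (hl : ∀ᵐ θ ∂m, Tendsto (fun i => ‖g (rk (ns i) * bd θ)‖) atTop
      (nhds ‖(G : Tc → ℂ) θ‖)) : ‖g 0‖ ≤ ‖G‖ := by
  have hB : ∀ i, Bdd (fun θ => g (rk (ns i) * bd θ)) := fun i =>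
    Bdd.of_cont (hg.cont_dilate (rk_nonneg _) (rk_lt _))
  set X : ℕ → L2 := fun i => mulOp (fun θ => g (rk (ns i) * bd θ)) (ee 0) with hX
  have hXc : ∀ i, (X i : Tc → ℂ) =ᵐ[m] fun θ => g (rk (ns i) * bd θ) := fun i => bdd_toLp_coe (hB i)
  have h1 : ∀ i, ‖g 0‖ ^ 2 ≤ ∫ θ, ‖g (rk (ns i) * bd θ)‖ ^ 2 ∂m := by
    intro i
    obtain ⟨c, hc⟩ := PS.exists hg
    have e1 : ⟪ee 0, X i⟫_ℂ = g 0 := by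
      rw [inner_ee, hc.zero]
      have := hc.fourier_nat (rk_nonneg (ns i)) (rk_lt _) 0
      rw [pow_zero, mul_one] at this
      rw [← this, fourierCoeff_eq, fourierCoeff_eq]
      apply integral_congr_ae
      filter_upwards [hXc i] with θ hθ
      rw [hθ]; rfl
    have e2 : ‖X i‖ ^ 2 = ∫ θ, ‖g (rk (ns i) * bd θ)‖ ^ 2 ∂m := by
      rw [L2_norm_sq]
      apply integral_congr_ae
      filter_upwards [hXc i] with θ hθ
      rw [hθ]
    rw [← e2, ← e1]
    have := norm_inner_le_norm (𝕜 := ℂ) (ee 0) (X i)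
    rw [norm_ee, one_mul] at this
    exact pow_le_pow_left₀ (norm_nonneg _) this 2
  have h2 : Tendsto (fun i => ∫ θ, ‖g (rk (ns i) * bd θ)‖ ^ 2 ∂m) atTop (nhds (‖G‖ ^ 2)) := by
    rw [L2_norm_sq]
    refine tendsto_integral_of_dominated_convergence (fun _ => M ^ 2) ?_ (integrable_const _) ?_ ?_
    · intro i
      exact ((hg.cont_dilate (rk_nonneg _) (rk_lt _)).norm.pow 2).aestronglyMeasurable
    · intro i
      refine ae_of_all _ fun θ => ?_
      rw [norm_pow, norm_norm]
      exact pow_le_pow_left₀ (norm_nonneg _) (hM _ (r_bd_mem (rk_nonneg _) (rk_lt _) θ)) 2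
    · filter_upwards [hl] with θ hθ
      exact hθ.pow 2
  exact (sq_le_sq₀ (norm_nonneg _) (norm_nonneg _)).1 (ge_of_tendsto' h2 h1)

lemma cyc_outer {f : ℂ → ℂ} {fs : Tc → ℂ} {M : ℝ} (hf : HolDisc f) (hM : ∀ z ∈ uDisc, ‖f z‖ ≤ M)
    (hb : IsBdry f fs) (hC : Cyc fs) : OuterFn f := by
  obtain ⟨c, hc⟩ := PS.exists hf
  have hB := hinfB_of hc hM hb
  have h0 : f 0 ≠ 0 := by
    intro h
    rw [hc.zero] at h
    have := hC (ee 0) (fun n => by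
      rw [← inner_conj_symm, inner_ee_mulOp_ee hB.1]
      rcases Nat.eq_zero_or_pos n with rfl | hn
      · rw [Nat.cast_zero, sub_zero]
        have := hB.2.2 0
        rw [Nat.cast_zero] at this
        rw [this, h, map_zero]
      · rw [hB.2.1 _ (by omega), map_zero]) 0
    rw [Nat.cast_zero, inner_ee_ee, if_pos rfl] at this
    exact one_ne_zero this
  obtain ⟨hne, hI, hle⟩ := log_facts hf hM hb h0
  set φ : Tc → ℝ := fun θ => Real.log ‖fs θ‖ with hφ
  have hM0 : 0 < M := (norm_pos_iff.2 h0).trans_le (hM 0 (by simp))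
  have hOM : ∀ z ∈ uDisc, ‖cexp (Hg φ z)‖ ≤ M := by
    intro z hz
    rw [norm_exp_Hg hI hz, ← Real.exp_log hM0]
    refine Real.exp_le_exp.2 (RP_le hI ?_ hz)
    filter_upwards [hne, hb.bound hM] with θ a b
    exact Real.log_le_log (norm_pos_iff.2 a) b
  obtain ⟨ns, hns, hlim⟩ := RP_ae hI
  have hspan : ∀ G ∈ Submodule.span ℂ (Set.range fun n : ℕ => mulOp fs (ee n)),
      ‖⟪ee 0, G⟫_ℂ‖ * ‖cexp (Hg φ 0)‖ ≤ ‖f 0‖ * ‖G‖ := by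
    intro G hG
    obtain ⟨p, hp⟩ := span_poly hB.1 hG
    obtain ⟨Cp, hCp⟩ := poly_bound p
    have hpb : ∀ θ, Tendsto (fun r : ℝ => p.eval ((r : ℂ) * bd θ)) (nhdsWithin 1 (Set.Iio 1))
        (nhds (p.eval (bd θ))) := by
      intro θ
      have : Continuous fun r : ℝ => p.eval ((r : ℂ) * bd θ) := by fun_prop
      have := this.tendsto 1
      rw [ofReal_one, one_mul] at this
      exact this.mono_left nhdsWithin_le_nhds
    have e1 : ⟪ee 0, G⟫_ℂ = f 0 * p.eval 0 := by
      refine inner_e0_bdry (M := M * Cp) (hf.mul (hol_poly p)) ?_ ?_ hp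
      · intro z hz
        rw [Pi.mul_apply, norm_mul]
        exact mul_le_mul (hM z hz) (hCp z hz) (norm_nonneg _) hM0.le
      · filter_upwards [hb] with θ hθ
        exact hθ.mul (hpb θ)
    have e2 : ‖cexp (Hg φ 0) * p.eval 0‖ ≤ ‖G‖ := by
      refine mean_le (g := fun z => cexp (Hg φ z) * p.eval z) (M := M * Cp) (ns := ns)
        ((exp_Hg_hol hI).mul (hol_poly p)) ?_ ?_
      · intro z hz
        rw [norm_mul]
        exact mul_le_mul (hOM z hz) (hCp z hz) (norm_nonneg _) hM0.le
      · filter_upwards [hlim, hp, hne] with θ a b d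
        rw [b, norm_mul]
        have h3 := ((Real.continuous_exp.tendsto _).comp a).mul (((hpb θ).comp (rk_sub hns)).norm)
        rw [hφ] at h3
        simp only at h3
        rw [Real.exp_log (norm_pos_iff.2 d)] at h3
        refine h3.congr fun i => ?_
        simp only [Function.comp]
        rw [norm_mul, norm_exp_Hg hI (r_bd_mem (rk_nonneg _) (rk_lt _) θ)]
    rw [e1, norm_mul, mul_assoc, mul_comm ‖p.eval 0‖, ← norm_mul (cexp _)]
    exact mul_le_mul_of_nonneg_left e2 (norm_nonneg _)
  have h1 : ‖cexp (Hg φ 0)‖ ≤ ‖f 0‖ := by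
    have hcl : IsClosed {G : L2 | ‖⟪ee 0, G⟫_ℂ‖ * ‖cexp (Hg φ 0)‖ ≤ ‖f 0‖ * ‖G‖} :=
      isClosed_le (by fun_prop) (by fun_prop)
    have : ‖⟪ee 0, ee 0⟫_ℂ‖ * ‖cexp (Hg φ 0)‖ ≤ ‖f 0‖ * ‖ee 0‖ :=
      closure_minimal (fun G hG => hspan G hG) hcl (e0_mem_of_cyc hC)
    rw [inner_ee_ee, if_pos rfl, norm_ee] at this
    simpa using this
  refine ⟨hf, f 0 / cexp (Hg φ 0), fun θ => ‖fs θ‖, ?_, fun θ => norm_nonneg _, hI, fun z hz => ?_⟩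
  · rw [norm_div]
    have h2 := hle 0 (by simp)
    rw [← norm_exp_Hg hI (by simp)] at h2
    rw [le_antisymm h1 h2, div_self (norm_ne_zero_iff.2 h0)]
  · have := const_of_norm_max (I := fun z => f z / cexp (Hg φ z))
      (hf.div (exp_Hg_hol hI) fun z _ => Complex.exp_ne_zero _) (fun z hz => by
        rw [norm_div, div_le_one (norm_pos_iff.2 (Complex.exp_ne_zero _)), norm_exp_Hg hI hz]
        exact hle z hz) (w := 0) (by simp) (by
        rw [norm_div, one_le_div (norm_pos_iff.2 (Complex.exp_ne_zero _))]
        exact h1) z hz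
    rw [← this]
    exact (div_mul_cancel₀ _ (Complex.exp_ne_zero _)).symm

lemma ob_bdry (P : BPair) (c : ℂ) : IsBdry (fun z => 1 - c * P.b z) (ob P c) := by
  filter_upwards [P.b_bdry] with θ hθ
  exact (hθ.const_mul c).const_sub 1

lemma BPair.bs_le (P : BPair) : ∀ᵐ θ ∂m, ‖P.bs θ‖ ≤ 1 := P.b_bdry.bound P.b_le_one

lemma eq_zero_of_mul {φ : Tc → ℂ} (h : Bdd φ) (h0 : ∀ᵐ θ ∂m, φ θ ≠ 0) {F : L2}
    (hF : mulOp φ F = 0) : F = 0 := by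
  apply Lp.ext
  have h1 := mulOp_coe h F
  rw [hF] at h1
  filter_upwards [h0, h1, Lp.coeFn_zero ℂ 2 m] with θ a b d
  rw [d] at b ⊢
  simpa [a] using b.symm

/-- the pointwise kernel relation -/
lemma ker_rel {P : BPair} {A B : PowerSeries ℂ} (g : Good P A B) (c : ℂ) {p : HbP}
    (hp : p ∈ HbSet P)
    (hk : A * psL (fst2 p) + (B - PowerSeries.C (conj c)) * psL (snd2 p) = 0) :
    mulOp P.as' (fst2 p) = conj c • snd2 p - mulOp P.bs (snd2 p) := by
  obtain ⟨h1, h2, _⟩ := (mem_Hb_iff g p).1 hp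
  refine psL_inj (g.hA.mul_mem h1) (H2_sub (H2_smul _ h2) (g.hB.mul_mem h2)) ?_
  rw [psL_sub, psL_smul, g.hA.psL_mul h1, g.hB.psL_mul h2]
  linear_combination hk

/-- If `H` has no nonnegative coefficients and `a H ∈ H²` then `H = 0`. -/
lemma conj_cyc {fs : Tc → ℂ} (hb : Bdd fs) (hC : Cyc fs) {H : L2} (h1 : ∀ n : ℕ, ⟪ee n, H⟫_ℂ = 0)
    (h2 : mulOp fs H ∈ H2) : H = 0 := by
  have key : ∀ (φ : Tc → ℂ), Bdd φ → ∀ n : ℕ, ⟪mulOp φ (ee n), mulOp (fun θ => fourier (-1) θ) (star H)⟫_ℂ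
      = conj ⟪ee (-n - 1), mulOp φ H⟫_ℂ := by
    intro φ hφ n
    rw [L2_inner, L2_inner, ← integral_conj]
    apply integral_congr_ae
    filter_upwards [mulOp_coe hφ (ee n), mulOp_coe hφ H, ee_coe n, ee_coe (-n - 1),
      mulOp_coe (Bdd.fourier (-1)) (star H), Lp.coeFn_star H] with θ a b d e f k
    rw [a, b, d, e, f, k, Pi.star_apply, RCLike.star_def]
    have : fourier (-(n : ℤ) - 1) θ = conj (fourier (n : ℤ) θ) * fourier (-1) θ := by
      rw [sub_eq_add_neg, fourier_add, fourier_neg]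
    rw [this]
    simp only [map_mul, conj_conj]
    ring
  apply L2_ext
  intro n
  rw [inner_zero_right]
  rcases le_or_gt 0 n with hn | hn
  · lift n to ℕ using hn
    exact h1 n
  · have := hC _ (fun k => by
      rw [key fs hb k, (mem_H2_iff _).1 h2 _ (by omega), map_zero]) (-n - 1).toNat
    have h3 := key (fun _ => 1) (Bdd.const 1) (-n - 1).toNat
    have h4 : ∀ F, mulOp (fun _ => 1) F = F := fun F => mulOp_ext (Bdd.const 1) (by simp)
    rw [h4, h4, this] at h3
    have e : -(((-n - 1).toNat : ℕ) : ℤ) - 1 = n := by omega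
    rw [e] at h3
    have := congrArg conj h3.symm
    simpa using this

lemma case_lt {P : BPair} {A B : PowerSeries ℂ} (g : Good P A B) (ha : ∀ᵐ θ ∂m, P.as' θ ≠ 0)
    {c : ℂ} (hc : ‖c‖ < 1) {p : HbP} (hp : p ∈ HbSet P)
    (hk : A * psL (fst2 p) + (B - PowerSeries.C (conj c)) * psL (snd2 p) = 0) : p = 0 := by
  have hrel := ker_rel g c hp hk
  obtain ⟨hF, hG, hD⟩ := (mem_Hb_iff g p).1 hp
  set F := fst2 p
  set G := snd2 p
  have hlow : ∀ b : ℂ, ‖b‖ ≤ 1 → 1 - ‖c‖ ≤ ‖1 - c * b‖ := by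
    intro b hb
    have h1 := norm_sub_norm_le (1 : ℂ) (c * b)
    rw [norm_one, norm_mul] at h1
    nlinarith [norm_nonneg c]
  have hone : ∀ b : ℂ, ‖b‖ ≤ 1 → 1 - c * b ≠ 0 := by
    intro b hb h
    have := hlow b hb
    rw [h, norm_zero] at this; linarith
  have hhol : HolDisc (fun z => (1 - c * P.b z)⁻¹) :=
    ((differentiableOn_const 1).sub ((differentiableOn_const c).mul P.b_hol)).inv
      fun z hz => hone _ (P.b_le_one z hz)
  obtain ⟨U, hU⟩ := PS.exists hhol
  have hI : HinfB (fun θ => (1 - c * P.bs θ)⁻¹) U := by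
    refine hinfB_of hU (M := (1 - ‖c‖)⁻¹) ?_ ?_
    · intro z hz
      rw [norm_inv]
      exact inv_anti₀ (by linarith) (hlow _ (P.b_le_one z hz))
    · filter_upwards [P.b_bdry, P.bs_le] with θ hθ h1
      exact ((hθ.const_mul c).const_sub 1).inv₀ (hone _ h1)
  set D := mulOp (fun θ => conj (P.as' θ)) G - mulOp (fun θ => conj (P.bs θ)) F with hDd
  set H := mulOp (fun θ => conj ((1 - c * P.bs θ)⁻¹)) D with hH
  have hH0 : ∀ n : ℕ, ⟪ee n, H⟫_ℂ = 0 := by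
    intro n
    rw [hH, ← inner_mulOp hI.1, hDd, inner_sub_right, ← inner_mulOp g.hA.1, ← inner_mulOp g.hB.1,
      Hb_orth g hp (hI.mul_mem (H2_ee n)), sub_self]
  have haH : mulOp P.as' H = G := by
    apply mulOp_ext g.hA.1
    have e := mulOp_coe g.hA.1 F
    rw [hrel] at e
    filter_upwards [P.pyth, P.bs_le, e, Lp.coeFn_sub (conj c • G) (mulOp P.bs G),
      Lp.coeFn_smul (conj c) G, mulOp_coe g.hB.1 G, mulOp_coe hI.1.conj D,
      Lp.coeFn_sub (mulOp (fun θ => conj (P.as' θ)) G) (mulOp (fun θ => conj (P.bs θ)) F),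
      mulOp_coe g.hA.1.conj G, mulOp_coe g.hB.1.conj F] with θ py h1 r1 r2 r3 r4 r5 r6 r7 r8
    rw [r5, r6, Pi.sub_apply, r7, r8]
    rw [r2, Pi.sub_apply, r3, r4, Pi.smul_apply, smul_eq_mul] at r1
    have hne : conj (1 - c * P.bs θ) ≠ 0 := (map_ne_zero _).2 (hone _ h1)
    have py2 : P.as' θ * conj (P.as' θ) + P.bs θ * conj (P.bs θ) = 1 := by
      rw [mul_conj', mul_conj']; exact_mod_cast py
    rw [map_inv₀]
    field_simp
    rw [map_sub, map_mul, map_one]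
    linear_combination (-(G : Tc → ℂ) θ) * py2 - conj (P.bs θ) * r1
  have hH00 : H = 0 := conj_cyc g.hA.1 g.cyc hH0 (by rw [haH]; exact hG)
  have hG0 : G = 0 := by rw [← haH, hH00, map_zero]
  rw [hG0, map_zero, smul_zero, sub_zero] at hrel
  exact hbp_ext (eq_zero_of_mul g.hA.1 ha hrel) hG0

lemma case_gt {P : BPair} {A B : PowerSeries ℂ} (g : Good P A B)
    {c : ℂ} (hc : 1 < ‖c‖) :
    (∀ p ∈ HbSet P, A * psL (fst2 p) + (B - PowerSeries.C (conj c)) * psL (snd2 p) = 0 → p = 0) ↔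
      Cyc (ob P c) := by
  have hob : ∀ (n : ℕ) (H : L2), ⟪mulOp (ob P c) (ee n), H⟫_ℂ
      = ⟪ee n, H⟫_ℂ - conj c * ⟪mulOp P.bs (ee n), H⟫_ℂ := by
    intro n H
    rw [ob_apply g, inner_sub_left, inner_smul_left]
  constructor
  · intro h H hH n
    have hs : Summable fun n : ℕ => ‖⟪ee n, H⟫_ℂ‖ ^ 2 := by
      have hO : Orthonormal ℂ (fun n : ℕ => ee n) := by
        rw [orthonormal_iff_ite]
        intro i j
        rw [inner_ee_ee]; simp
      exact hO.inner_products_summable H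
    obtain ⟨K, hK, hKc, _⟩ := L2_of_coeff _ hs
    have hKH : ∀ F ∈ H2, ⟪F, K⟫_ℂ = ⟪F, H⟫_ℂ := by
      intro F hF
      rw [← sub_eq_zero, ← inner_sub_right]
      exact H2_inner_zero hF fun n => by rw [inner_sub_right, hKc, sub_self]
    have hp : mkP (conj c • K - mulOp P.bs K) (mulOp P.as' K) ∈ HbSet P := by
      rw [mem_Hb_iff g]
      refine ⟨H2_sub (H2_smul _ hK) (g.hB.mul_mem hK), g.hA.mul_mem hK, fun n => ?_⟩
      rw [fst2_mkP, snd2_mkP]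
      have h1 := pyth_inner g (ee n) K
      have h2 := hH n
      rw [hob, ← hKH _ (H2_ee n), ← hKH _ (g.hB.mul_mem (H2_ee n))] at h2
      rw [inner_sub_right, inner_smul_right]
      linear_combination -h1 - h2
    have := h _ hp (by
      rw [fst2_mkP, snd2_mkP, psL_sub, psL_smul, g.hA.psL_mul hK, g.hB.psL_mul hK]; ring)
    have h3 : mulOp P.as' K = 0 := congrArg snd2 this
    have h4 := congrArg psL h3
    rw [g.hA.psL_mul hK, psL_zero] at h4
    have hA0 : A ≠ 0 := by
      intro h; exact g.hA0 (by rw [h, map_zero])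
    have h5 := (mul_eq_zero.1 h4).resolve_left hA0
    rw [← hKc, ← coeff_psL, h5, map_zero]
  · intro hC p hp hk
    have hrel := ker_rel g c hp hk
    obtain ⟨hF, hG, hD⟩ := (mem_Hb_iff g p).1 hp
    set F := fst2 p
    set G := snd2 p
    have hlow : ∀ b : ℂ, ‖b‖ ≤ 1 → ‖c‖ - 1 ≤ ‖conj c - b‖ := by
      intro b hb
      have h1 := norm_sub_norm_le (conj c) b
      rw [RCLike.norm_conj] at h1
      linarith
    have hone : ∀ b : ℂ, ‖b‖ ≤ 1 → conj c - b ≠ 0 := by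
      intro b hb h
      have := hlow b hb
      rw [h, norm_zero] at this; linarith
    have hhol : HolDisc (fun z => (conj c - P.b z)⁻¹) :=
      ((differentiableOn_const _).sub P.b_hol).inv fun z hz => hone _ (P.b_le_one z hz)
    obtain ⟨U, hU⟩ := PS.exists hhol
    have hI : HinfB (fun θ => (conj c - P.bs θ)⁻¹) U := by
      refine hinfB_of hU (M := (‖c‖ - 1)⁻¹) ?_ ?_
      · intro z hz
        rw [norm_inv]
        exact inv_anti₀ (by linarith) (hlow _ (P.b_le_one z hz))
      · filter_upwards [P.b_bdry, P.bs_le] with θ hθ h1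
        exact (hθ.const_sub _).inv₀ (hone _ h1)
    set H := mulOp (fun θ => (conj c - P.bs θ)⁻¹) F with hH
    have hHm : H ∈ H2 := hI.mul_mem hF
    have e1 : F = conj c • H - mulOp P.bs H := by
      apply Lp.ext
      filter_upwards [P.bs_le, mulOp_coe hI.1 F, Lp.coeFn_sub (conj c • H) (mulOp P.bs H),
        Lp.coeFn_smul (conj c) H, mulOp_coe g.hB.1 H] with θ h1 r1 r2 r3 r4
      rw [r2, Pi.sub_apply, r3, r4, Pi.smul_apply, smul_eq_mul, r1]
      have := hone _ h1
      field_simp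
    have e2 : G = mulOp P.as' H := by
      symm
      apply mulOp_ext g.hA.1
      have e := mulOp_coe g.hA.1 F
      rw [hrel] at e
      filter_upwards [P.bs_le, mulOp_coe hI.1 F, e, Lp.coeFn_sub (conj c • G) (mulOp P.bs G),
        Lp.coeFn_smul (conj c) G, mulOp_coe g.hB.1 G] with θ h1 r1 r5 r2 r3 r4
      rw [r2, Pi.sub_apply, r3, r4, Pi.smul_apply, smul_eq_mul] at r5
      rw [r1]
      have := hone _ h1
      field_simp
      linear_combination r5
    have hH0 : H = 0 := by
      have := hC H fun n => by
        have h1 := pyth_inner g (ee n) H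
        have h2 := hD n
        rw [e2] at h2
        nth_rw 1 [e1] at h2
        rw [inner_sub_right, inner_smul_right] at h2
        rw [hob]
        linear_combination -h1 - h2
      exact psL_inj hHm H2_zero (by ext n; rw [coeff_psL, this, psL_zero, map_zero])
    refine hbp_ext ?_ ?_
    · exact e1.trans (by rw [hH0, map_zero, smul_zero, sub_zero]; rfl)
    · exact e2.trans (by rw [hH0, map_zero]; rfl)

/-! ### Aleksandrov–Clark measures -/

lemma ps_re_zero {f : ℂ → ℂ} {s : PowerSeries ℂ} (h : PS f s) (hre : ∀ z ∈ uDisc, (f z).re = 0)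
    {n : ℕ} (hn : 1 ≤ n) : PowerSeries.coeff n s = 0 := by
  have h0 : (0 : ℝ) ≤ 1 / 2 := by norm_num
  have h1 : (1 / 2 : ℝ) < 1 := by norm_num
  have e1 := h.fourier_nat h0 h1 n
  have e2 := h.fourier_neg h0 h1 (n := -(n : ℤ)) (by omega)
  rw [fourierCoeff_eq] at e1 e2
  have e3 : ∫ θ, conj (fourier (n : ℤ) θ : ℂ) * f (((1 / 2 : ℝ) : ℂ) * bd θ) ∂m
      = - conj (∫ θ, conj (fourier (-(n : ℤ)) θ : ℂ) * f (((1 / 2 : ℝ) : ℂ) * bd θ) ∂m) := by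
    rw [← integral_conj, ← integral_neg]
    congr 1
    ext θ
    have hc : conj (f (((1 / 2 : ℝ) : ℂ) * bd θ)) = - f (((1 / 2 : ℝ) : ℂ) * bd θ) := by
      apply Complex.ext
      · have := hre _ (r_bd_mem h0 h1 θ)
        rw [Complex.conj_re, Complex.neg_re, this, neg_zero]
      · simp
    rw [map_mul, hc, fourier_neg]
    simp
  rw [e3, e2, map_zero, neg_zero] at e1
  have : ((1 / 2 : ℝ) : ℂ) ^ n ≠ 0 := pow_ne_zero _ (by norm_num)
  rcases mul_eq_zero.mp e1.symm with h | h
  · exact h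
  · exact absurd h this

lemma re_cayley {w : ℂ} (hw : w ≠ 1) :
    (1 - ‖w‖ ^ 2) / ‖1 - w‖ ^ 2 = (2 * (1 - w)⁻¹ - 1).re := by
  have h : ‖1 - w‖ ^ 2 ≠ 0 := by
    have : (1 - w) ≠ 0 := sub_ne_zero.mpr hw.symm
    positivity
  rw [Complex.sub_re, Complex.mul_re, Complex.inv_re, Complex.inv_im]
  rw [← Complex.normSq_eq_norm_sq] at h ⊢
  rw [← Complex.normSq_eq_norm_sq]
  simp only [Complex.re_ofNat, Complex.im_ofNat, Complex.one_re, zero_mul, sub_zero,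
    Complex.sub_re]
  field_simp
  simp only [Complex.normSq_apply, Complex.sub_re, Complex.sub_im, Complex.one_re, Complex.one_im]
  ring

section
variable {P : BPair} {c : ℂ}

lemma ob_ne (hc : ‖c‖ = 1) {z : ℂ} (hz : z ∈ uDisc) : 1 - c * P.b z ≠ 0 := by
  intro h
  have h1 := P.b_lt hz
  have h2 : ‖c * P.b z‖ = 1 := by rw [← sub_eq_zero.mp h]; simp
  rw [norm_mul, hc, one_mul] at h2
  linarith

/-- the Herglotz function -/
def uf (P : BPair) (c : ℂ) (z : ℂ) : ℂ := 2 * (1 - c * P.b z)⁻¹ - 1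

lemma uf_re (hc : ‖c‖ = 1) {z : ℂ} (hz : z ∈ uDisc) :
    (1 - ‖P.b z‖ ^ 2) / ‖1 - c * P.b z‖ ^ 2 = (uf P c z).re := by
  have := re_cayley (w := c * P.b z) (sub_ne_zero.mp (ob_ne hc hz)).symm
  rw [norm_mul, hc, one_mul] at this
  exact this

lemma uf_pos (hc : ‖c‖ = 1) {z : ℂ} (hz : z ∈ uDisc) : 0 < (uf P c z).re := by
  rw [← uf_re hc hz]
  have h1 := P.b_lt hz
  have h2 := norm_nonneg (P.b z)
  have h3 : 0 < ‖1 - c * P.b z‖ := norm_pos_iff.mpr (ob_ne hc hz)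
  apply div_pos _ (by positivity)
  nlinarith

lemma inv_hol (hc : ‖c‖ = 1) : HolDisc (fun z => (1 - c * P.b z)⁻¹) :=
  DifferentiableOn.inv ((differentiableOn_const 1).sub (P.b_hol.const_mul c))
    (fun _ hz => ob_ne hc hz)

lemma uf_hol (hc : ‖c‖ = 1) : HolDisc (uf P c) :=
  (DifferentiableOn.const_mul (inv_hol hc) 2).sub (differentiableOn_const 1)

lemma inv_PS (hc : ‖c‖ = 1) {B : PowerSeries ℂ} (hB : PS P.b B) :
    PS (fun z => (1 - c * P.b z)⁻¹) (1 - PowerSeries.C c * B)⁻¹ := by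
  obtain ⟨U, hU⟩ := PS.exists (inv_hol (P := P) hc)
  have h1 := hU.mul (hB.const_sub_mul 1 c)
  have h2 : PS (fun z => (1 - c * P.b z)⁻¹ * (1 - c * P.b z)) (PowerSeries.C 1) :=
    (PS.const 1).congr fun z hz => (inv_mul_cancel₀ (ob_ne hc hz)).symm
  have h3 := h1.unique h2
  simp only [map_one] at h3
  have h4 : PowerSeries.constantCoeff (1 - PowerSeries.C c * B) ≠ 0 := by
    intro h
    have := congrArg PowerSeries.constantCoeff h3
    rw [map_mul, h] at this
    simp at this
  have : U = (1 - PowerSeries.C c * B)⁻¹ := by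
    rw [PowerSeries.eq_inv_iff_mul_eq_one h4]; exact h3
  rw [← this]; exact hU

lemma uf_PS (hc : ‖c‖ = 1) {B : PowerSeries ℂ} (hB : PS P.b B) :
    PS (uf P c) (PowerSeries.C (-1) - PowerSeries.C (-2) * (1 - PowerSeries.C c * B)⁻¹) := by
  refine ((inv_PS hc hB).const_sub_mul (-1) (-2)).congr fun z hz => ?_
  unfold uf; ring

/-- Fourier coefficients from a Poisson representation. -/
lemma ac_coeff (hc : ‖c‖ = 1) {B : PowerSeries ℂ} (hB : PS P.b B) {μ : Measure Tc}
    [IsFiniteMeasure μ] (hμ : ∀ z ∈ uDisc, (uf P c z).re = ∫ θ, pk z θ ∂μ) {n : ℕ} (hn : 1 ≤ n) :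
    ∫ θ, conj (fourier (n : ℤ) θ : ℂ) ∂μ
      = PowerSeries.coeff n (1 - PowerSeries.C c * B)⁻¹ := by
  have h1 := herg_PS (μ := μ) (φ := fun _ => 1) (integrable_const 1)
  have h2 := h1.add ((uf_PS hc hB).const_sub_mul 0 1)
  have h3 := ps_re_zero h2 (fun z hz => ?_) hn
  · simp only [map_add, map_sub, hps, PowerSeries.coeff_mk, PowerSeries.coeff_C_mul,
      PowerSeries.coeff_C] at h3
    have hn0 : n ≠ 0 := by omega
    simp only [hn0, if_false, mul_one] at h3
    linear_combination h3 / 2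
  · have e := hμ z hz
    have hi := hk_int hz (μ := μ) (φ := fun _ => 1) (integrable_const 1)
    have : (∫ θ, hk z θ * 1 ∂μ).re = ∫ θ, pk z θ ∂μ := by
      rw [← RCLike.re_eq_complex_re, ← integral_re hi]
      congr 1
      ext θ
      simp [hk_re]
    rw [Complex.add_re, this, ← e]
    simp

lemma ac_zero {P : BPair} {c : ℂ} {μ : Measure Tc}
    (hμ : ∀ z ∈ uDisc, (uf P c z).re = ∫ θ, pk z θ ∂μ) : μ.real univ = (uf P c 0).re := by
  rw [hμ 0 (by simp)]
  simp [pk, norm_bd]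

lemma isAC_iff (hc : ‖c‖ = 1) (μ : Measure Tc) : IsACMeasure P (conj c) μ ↔
    IsFiniteMeasure μ ∧ ∀ z ∈ uDisc, (uf P c z).re = ∫ θ, pk z θ ∂μ := by
  unfold IsACMeasure
  refine and_congr_right fun _ => forall_congr' fun z => forall_congr' fun hz => ?_
  rw [← uf_re hc hz, Complex.conj_conj]
  rfl

lemma ac_density (hc : ‖c‖ = 1) {μ : Measure Tc} [IsFiniteMeasure μ]
    (hμ : ∀ z ∈ uDisc, (uf P c z).re = ∫ θ, pk z θ ∂μ) (hac : μ ≪ m) :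
    ∀ᵐ θ ∂m, (μ.rnDeriv m θ).toReal = ‖P.as' θ‖ ^ 2 / ‖ob P c θ‖ ^ 2 := by
  have hi : Integrable (fun θ => (μ.rnDeriv m θ).toReal) m := Measure.integrable_toReal_rnDeriv
  have h0 := (log_facts (f := fun z => 1 - c * P.b z) (M := 2)
    ((differentiableOn_const 1).sub (P.b_hol.const_mul c)) (fun z hz => by
      refine (norm_sub_le _ _).trans ?_
      rw [norm_mul, hc, norm_one]
      linarith [P.b_le_one z hz]) (ob_bdry P c) (ob_ne hc (by simp))).1
  have hh := poisson_radial (φ := fun θ => (((μ.rnDeriv m θ).toReal : ℝ) : ℂ))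
    (g := fun θ => ((‖P.as' θ‖ ^ 2 / ‖ob P c θ‖ ^ 2 : ℝ) : ℂ)) hi.ofReal ?_
  · filter_upwards [hh] with θ h
    exact_mod_cast h.symm
  · filter_upwards [h0, ob_bdry P c, P.b_bdry, P.pyth] with θ h1 h2 h3 h4
    have h5 : Tendsto (fun r : ℝ => (((1 - ‖P.b (r * bd θ)‖ ^ 2) / ‖1 - c * P.b (r * bd θ)‖ ^ 2 : ℝ) : ℂ))
        (nhdsWithin 1 (Iio 1)) (nhds ((‖P.as' θ‖ ^ 2 / ‖ob P c θ‖ ^ 2 : ℝ) : ℂ)) := by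
      refine (Complex.continuous_ofReal.tendsto _).comp ?_
      have : ‖P.as' θ‖ ^ 2 = 1 - ‖P.bs θ‖ ^ 2 := by linarith
      rw [this]
      exact (tendsto_const_nhds.sub (h3.norm.pow 2)).div (h2.norm.pow 2) (by positivity)
    refine h5.congr' ?_
    have h6 : ∀ᶠ r : ℝ in nhdsWithin 1 (Iio 1), 0 ≤ r :=
      nhdsWithin_le_nhds (eventually_ge_nhds (by norm_num))
    filter_upwards [h6, self_mem_nhdsWithin] with r hr0 hr1
    have hz := r_bd_mem hr0 hr1 θ
    rw [PI_ofReal, uf_re hc hz, hμ _ hz]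
    congr 1
    have : μ.HaveLebesgueDecomposition m := Measure.haveLebesgueDecomposition_of_sigmaFinite μ m
    rw [← integral_rnDeriv_smul hac]
    unfold RP
    congr 1
    ext t
    simp [mul_comm]
end

lemma cont_integral (μ : Measure Tc) [IsFiniteMeasure μ] :
    Continuous (fun f : C(Tc, ℂ) => ∫ θ, f θ ∂μ) := by
  have h : (fun f : C(Tc, ℂ) => ∫ θ, f θ ∂μ)
      = fun f => ∫ θ, (ContinuousMap.toLp 1 μ ℂ f : Tc → ℂ) θ ∂μ := by
    ext f
    exact (integral_congr_ae (ContinuousMap.coeFn_toLp μ f)).symm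
  rw [h]
  exact continuous_integral.comp (ContinuousMap.toLp 1 μ ℂ).continuous

lemma measure_ext_fourier {μ ν : Measure Tc} [IsFiniteMeasure μ] [IsFiniteMeasure ν]
    (h : ∀ n : ℕ, ∫ θ, conj (fourier (n : ℤ) θ : ℂ) ∂μ = ∫ θ, conj (fourier (n : ℤ) θ : ℂ) ∂ν) :
    μ = ν := by
  have hZ : ∀ n : ℤ, ∫ θ, (fourier n θ : ℂ) ∂μ = ∫ θ, (fourier n θ : ℂ) ∂ν := by
    intro n
    rcases Int.eq_nat_or_neg n with ⟨k, rfl | rfl⟩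
    · have := congrArg conj (h k)
      rw [← integral_conj, ← integral_conj] at this
      simpa using this
    · simp_rw [fourier_neg]
      exact h k
  have hall : ∀ f : C(Tc, ℂ), ∫ θ, f θ ∂μ = ∫ θ, f θ ∂ν := by
    have hcl : IsClosed {f : C(Tc, ℂ) | ∫ θ, f θ ∂μ = ∫ θ, f θ ∂ν} :=
      isClosed_eq (cont_integral μ) (cont_integral ν)
    have hintg : ∀ (f : C(Tc, ℂ)) (ρ : Measure Tc) [IsFiniteMeasure ρ], Integrable f ρ :=
      fun f ρ _ => f.continuous.integrable_of_hasCompactSupport (HasCompactSupport.of_compactSpace _)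
    have hsub : (Submodule.span ℂ (range (fourier (T := 2 * Real.pi))) : Set C(Tc, ℂ)) ⊆
        {f : C(Tc, ℂ) | ∫ θ, f θ ∂μ = ∫ θ, f θ ∂ν} := by
      intro f hf
      refine Submodule.span_induction ?_ ?_ ?_ ?_ hf
      · rintro _ ⟨n, rfl⟩; exact hZ n
      · simp
      · intro x y _ _ hx hy
        simp only [mem_ofPred_eq, ContinuousMap.add_apply] at hx hy ⊢
        rw [integral_add (hintg x μ) (hintg y μ), integral_add (hintg x ν) (hintg y ν), hx, hy]
      · intro a x _ hx
        simp only [mem_ofPred_eq, ContinuousMap.smul_apply] at hx ⊢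
        rw [integral_smul, integral_smul, hx]
    intro f
    have hf : f ∈ (Submodule.span ℂ (range (fourier (T := 2 * Real.pi)))).topologicalClosure := by
      rw [span_fourier_closure_eq_top]; trivial
    exact closure_minimal hsub hcl hf
  refine ext_of_forall_integral_eq_of_IsFiniteMeasure fun f => ?_
  have := hall ⟨fun θ => (f θ : ℂ), Complex.continuous_ofReal.comp f.continuous⟩
  simp only [ContinuousMap.coe_mk] at this
  rw [integral_complex_ofReal, integral_complex_ofReal] at this
  exact_mod_cast this

section
variable {P : BPair} {c : ℂ}

lemma uf_dilate (hc : ‖c‖ = 1) {r : ℝ} (h0 : 0 ≤ r) (h1 : r < 1) {w : ℂ} (hw : w ∈ uDisc) :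
    ∫ θ, pk w θ * (uf P c (r * bd θ)).re ∂m = (uf P c (r * w)).re := by
  have hcont := (uf_hol (P := P) hc).cont_dilate h0 h1
  have h := poisson_hol (uf_hol (P := P) hc) h0 h1 hw
  rw [← h, ← RCLike.re_eq_complex_re, ← integral_re]
  · congr 1; ext θ; simp
  · exact pk_int hw (hcont.integrable_of_hasCompactSupport (HasCompactSupport.of_compactSpace _))

lemma ac_exists (P : BPair) (hc : ‖c‖ = 1) : ∃ μ : Measure Tc, IsFiniteMeasure μ ∧
    ∀ z ∈ uDisc, (uf P c z).re = ∫ θ, pk z θ ∂μ := by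
  set u0 := (uf P c 0).re with hu0
  have hu0p : 0 < u0 := uf_pos hc (by simp)
  let d : ℕ → Tc → ℝ := fun k θ => (uf P c (rk k * bd θ)).re / u0
  have dpos : ∀ k θ, 0 ≤ d k θ := fun k θ =>
    (div_pos (uf_pos hc (r_bd_mem (rk_nonneg k) (rk_lt k) θ)) hu0p).le
  have dcont : ∀ k, Continuous (d k) := fun k =>
    (Complex.continuous_re.comp ((uf_hol (P := P) hc).cont_dilate (rk_nonneg k) (rk_lt k))).div_const _
  have dint : ∀ k, Integrable (d k) m := fun k =>
    (dcont k).integrable_of_hasCompactSupport (HasCompactSupport.of_compactSpace _)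
  have hd : ∀ k, ∀ w ∈ uDisc, ∫ θ, pk w θ * d k θ ∂m = (uf P c (rk k * w)).re / u0 := by
    intro k w hw
    rw [← uf_dilate hc (rk_nonneg k) (rk_lt k) hw, ← integral_div]
    congr 1; ext θ; simp only [d]; ring
  have hone : ∀ k, ∫ θ, d k θ ∂m = 1 := by
    intro k
    have := hd k 0 (by simp)
    simp only [mul_zero, ← hu0, div_self hu0p.ne'] at this
    rw [← this]
    congr 1; ext θ; simp [pk, norm_bd]
  let ν : ℕ → Measure Tc := fun k => m.withDensity (fun θ => ENNReal.ofReal (d k θ))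
  have hν : ∀ k, IsProbabilityMeasure (ν k) := fun k => ⟨by
    simp only [ν]
    rw [withDensity_apply _ MeasurableSet.univ, Measure.restrict_univ,
      ← ofReal_integral_eq_lintegral_ofReal (dint k) (Eventually.of_forall (dpos k)), hone]
    simp⟩
  let N : ℕ → ProbabilityMeasure Tc := fun k => ⟨ν k, hν k⟩
  let F : Ultrafilter (ProbabilityMeasure Tc) := (hyperfilter ℕ).map N
  have hF : Tendsto N (hyperfilter ℕ : Filter ℕ) (nhds F.lim) := F.le_nhds_lim
  rw [ProbabilityMeasure.tendsto_iff_forall_integral_tendsto] at hF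
  refine ⟨ENNReal.ofReal u0 • (F.lim : Measure Tc), ⟨?_⟩, fun z hz => ?_⟩
  · simp
  · have h1 := hF (BoundedContinuousFunction.mkOfCompact ⟨pk z, pk_cont hz⟩)
    have h2 : ∀ k, ∫ θ, pk z θ ∂(ν k) = (uf P c (rk k * z)).re / u0 := by
      intro k
      rw [← hd k z hz]
      simp only [ν]
      rw [integral_withDensity_eq_integral_toReal_smul₀
        ((dcont k).measurable.ennreal_ofReal.aemeasurable) (by simp)]
      congr 1; ext θ
      rw [ENNReal.toReal_ofReal (dpos k θ), smul_eq_mul, mul_comm]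
    have h3 : Tendsto (fun k => (uf P c (rk k * z)).re / u0) atTop (nhds ((uf P c z).re / u0)) := by
      refine Tendsto.div_const ?_ _
      refine (Complex.continuous_re.tendsto _).comp ?_
      have hca : ContinuousAt (uf P c) z :=
        (uf_hol (P := P) hc).continuousOn.continuousAt (isOpen_ball.mem_nhds hz)
      refine hca.tendsto.comp ?_
      simpa using rkC_tendsto.mul_const z
    have h4 := h3.mono_left (Nat.hyperfilter_le_atTop)
    have h5 := tendsto_nhds_unique h4 (h1.congr fun k => h2 k)
    simp only [BoundedContinuousFunction.mkOfCompact_apply, ContinuousMap.coe_mk] at h5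
    rw [integral_smul_measure, ENNReal.toReal_ofReal hu0p.le, ← h5, smul_eq_mul]
    field_simp
end

/-! ### The case `|c| = 1` -/

lemma coeff_mul_hasSum (O : PowerSeries ℂ) {κ : ℕ → ℂ} {S : ℕ → PowerSeries ℂ} {τ : PowerSeries ℂ}
    (h : ∀ l, HasSum (fun n => κ n * PowerSeries.coeff l (S n)) (PowerSeries.coeff l τ)) (j : ℕ) :
    HasSum (fun n => κ n * PowerSeries.coeff j (O * S n)) (PowerSeries.coeff j (O * τ)) := by
  simp only [PowerSeries.coeff_mul, Finset.mul_sum]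
  refine hasSum_sum fun x _ => ?_
  refine ((h x.2).mul_left (PowerSeries.coeff x.1 O)).congr_fun ?_
  intro n; ring

section
variable {P : BPair} {A B : PowerSeries ℂ} {c : ℂ}

/-- Power series of `1 - c b`. -/
abbrev Os (B : PowerSeries ℂ) (c : ℂ) : PowerSeries ℂ := 1 - PowerSeries.C c * B

lemma Os_ne (hc : ‖c‖ = 1) (hB : PS P.b B) : PowerSeries.constantCoeff (Os B c) ≠ 0 := by
  have h := (hB.const_sub_mul 1 c).zero
  have h2 := ob_ne (P := P) hc (z := 0) (by simp)
  rw [h] at h2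
  simpa using h2

lemma ob_hinf (hB : PS P.b B) (c : ℂ) : HinfB (ob P c) (Os B c) := by
  have := hinfB_of (M := 1 + ‖c‖) (hB.const_sub_mul 1 c) (fun z hz => by
      refine (norm_sub_le _ _).trans ?_
      rw [norm_mul, norm_one]
      nlinarith [P.b_le_one z hz, norm_nonneg c]) (ob_bdry P c)
  simpa using this

/-- The orthonormal family. -/
abbrev Gs (A B : PowerSeries ℂ) (c : ℂ) : PowerSeries ℂ := A * (Os B c)⁻¹
def VV (P : BPair) (A B : PowerSeries ℂ) (c : ℂ) (n : ℕ) : HbP :=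
  YY P c (Gs A B c) (-PowerSeries.C (conj c)) n

lemma C_cc (hc : ‖c‖ = 1) : (PowerSeries.C (conj c) : PowerSeries ℂ) * PowerSeries.C c = 1 := by
  rw [← map_mul, Complex.conj_mul', hc]; simp

lemma Gs_mul (hc : ‖c‖ = 1) (hB : PS P.b B) : Gs A B c * Os B c = A := by
  rw [mul_assoc, PowerSeries.inv_mul_cancel _ (Os_ne hc hB), mul_one]

lemma B_sub (hc : ‖c‖ = 1) : B - PowerSeries.C (conj c) = -PowerSeries.C (conj c) * Os B c := by
  have := C_cc hc
  linear_combination (-B) * this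

lemma VV_mem (g : Good P A B) (hc : ‖c‖ = 1) (hB : PS P.b B) (n : ℕ) : VV P A B c n ∈ HbSet P := by
  refine YY_mem g c ?_ n
  rw [B_sub hc]
  linear_combination (-PowerSeries.C (conj c)) * Gs_mul (A := A) hc hB

lemma inner_VV (g : Good P A B) (n : ℕ) {p : HbP} (hp : p ∈ HbSet P) :
    ⟪VV P A B c n, p⟫_ℂ = PowerSeries.coeff n
      (Gs A B c * psL (fst2 p) - PowerSeries.C (conj c) * psL (snd2 p)) := by
  rw [VV, inner_YY g c _ _ n hp]
  congr 1; ring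

lemma ker_VV (g : Good P A B) (hc : ‖c‖ = 1) (hB : PS P.b B) {p : HbP} (hp : p ∈ HbSet P) :
    A * psL (fst2 p) + (B - PowerSeries.C (conj c)) * psL (snd2 p) = 0 ↔
      ∀ n, ⟪VV P A B c n, p⟫_ℂ = 0 := by
  have h : A * psL (fst2 p) + (B - PowerSeries.C (conj c)) * psL (snd2 p)
      = Os B c * (Gs A B c * psL (fst2 p) - PowerSeries.C (conj c) * psL (snd2 p)) := by
    rw [B_sub hc]
    linear_combination (-psL (fst2 p)) * Gs_mul (A := A) hc hB
  have hO : Os B c ≠ 0 := by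
    intro h; have := Os_ne hc hB; rw [h] at this; simp at this
  rw [h, mul_eq_zero, or_iff_right hO, PowerSeries.ext_iff]
  simp only [inner_VV g _ hp, map_zero]

lemma psL_fst_VV (hB : PS P.b B) (n : ℕ) :
    psL (fst2 (VV P A B c n)) = Os B c * psL (tt (Gs A B c) n) := by
  rw [VV, YY, fst2_mkP, (ob_hinf hB c).psL_mul (tt_mem _ _)]

lemma psL_snd_VV (g : Good P A B) (n : ℕ) :
    psL (snd2 (VV P A B c n))
      = PowerSeries.C c * (A * psL (tt (Gs A B c) n) - PowerSeries.X ^ n) := by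
  rw [VV, YY, snd2_mkP, psL_add, psL_smul, g.hA.psL_mul (tt_mem _ _), ← map_neg, tt_C, psL_smul,
    psL_ee]
  simp only [map_neg, Complex.conj_conj]
  ring

lemma VV_orth (g : Good P A B) (hc : ‖c‖ = 1) (hB : PS P.b B) : Orthonormal ℂ (VV P A B c) := by
  rw [orthonormal_iff_ite]
  intro i j
  rw [inner_VV g i (VV_mem g hc hB j), psL_fst_VV hB, psL_snd_VV g]
  have : Gs A B c * (Os B c * psL (tt (Gs A B c) j)) - PowerSeries.C (conj c) *
      (PowerSeries.C c * (A * psL (tt (Gs A B c) j) - PowerSeries.X ^ j)) = PowerSeries.X ^ j := by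
    linear_combination psL (tt (Gs A B c) j) * Gs_mul (A := A) hc hB
      - (A * psL (tt (Gs A B c) j) - PowerSeries.X ^ j) * C_cc hc
  rw [this, PowerSeries.coeff_X_pow]

/-- The constant function one. -/
lemma one_mem (g : Good P A B) : ∃ k0 : ℂ, mkP (ee 0) (k0 • ee 0) ∈ HbSet P := by
  refine ⟨conj (PowerSeries.coeff 0 B / PowerSeries.coeff 0 A), ?_⟩
  have h0 : PowerSeries.coeff 0 A ≠ 0 := by simpa using g.hA0
  have e0 : ee 0 ∈ H2 := H2_ee 0
  rw [mem_Hb_iff g, fst2_mkP, snd2_mkP]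
  refine ⟨e0, H2_smul _ e0, fun n => ?_⟩
  rw [inner_smul_right, ← inner_conj_symm, ← inner_conj_symm (_ : L2) (ee 0),
    inner_ee_mulOp_ee g.hB.1, inner_ee_mulOp_ee g.hA.1]
  rcases Nat.eq_zero_or_pos n with rfl | hn
  · have h1 := g.hA.2.2 0
    have h2 := g.hB.2.2 0
    simp only [Nat.cast_zero, sub_zero] at h1 h2 ⊢
    rw [h1, h2, ← map_mul, div_mul_cancel₀ _ h0]
  · rw [g.hA.2.1 _ (by omega), g.hB.2.1 _ (by omega)]; simp

lemma exists_gL (g : Good P A B) (hc : ‖c‖ = 1) (hB : PS P.b B) :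
    ∃ G ∈ H2, psL G = Gs A B c := by
  obtain ⟨k0, h1⟩ := one_mem g
  have hs := (VV_orth (c := c) g hc hB).inner_products_summable (mkP (ee 0) (k0 • ee 0))
  obtain ⟨F, hF, hc1, -⟩ := L2_of_coeff _ hs
  have e0 : psL (ee 0) = 1 := by simpa using psL_ee 0
  have e0' : ee 0 ∈ H2 := H2_ee 0
  refine ⟨F + (conj c * k0) • ee 0, H2_add hF (H2_smul _ e0'), ?_⟩
  rw [psL_add, psL_smul, e0]
  ext n
  rw [map_add, coeff_psL, hc1, inner_VV g n h1, fst2_mkP, snd2_mkP, psL_smul, e0,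
    map_mul (PowerSeries.C : ℂ →+* PowerSeries ℂ)]
  rw [← map_add]
  congr 1; ring

lemma Vsum (g : Good P A B) (hc : ‖c‖ = 1) (hB : PS P.b B) {G : L2} (hG : G ∈ H2)
    (hGs : psL G = Gs A B c) {k : L2} (hk : k ∈ H2) :
    ∃ W ∈ HbSet P, (∀ p : HbP, (∀ n, ⟪VV P A B c n, p⟫_ℂ = 0) → ⟪W, p⟫_ℂ = 0) ∧
      psL (fst2 W) = Os B c * PowerSeries.mk (fun j : ℕ => ⟪mulOp (fun θ => fourier (j : ℤ) θ) G, k⟫_ℂ) ∧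
      psL (snd2 W) = PowerSeries.C c * (A * PowerSeries.mk
        (fun j : ℕ => ⟪mulOp (fun θ => fourier (j : ℤ) θ) G, k⟫_ℂ) - psL k) := by
  set τ : PowerSeries ℂ := PowerSeries.mk
    (fun j : ℕ => ⟪mulOp (fun θ => fourier (j : ℤ) θ) G, k⟫_ℂ) with hτ
  let κ : ℕ → ℂ := fun n => ⟪ee n, k⟫_ℂ
  have hO := VV_orth (A := A) (c := c) g hc hB
  have hee : Orthonormal ℂ (fun n : ℕ => ee n) := by
    rw [orthonormal_iff_ite]; intro i j; rw [inner_ee_ee]; norm_cast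
  have hκ : Summable (fun n => ‖κ n‖ ^ 2) := hee.inner_products_summable k
  have hsum : Summable (fun n => κ n • VV P A B c n) := by
    have := (hO.orthogonalFamily.summable_iff_norm_sq_summable κ).mpr hκ
    simpa using this
  obtain ⟨W, hW⟩ := hsum
  have hτs : ∀ l, HasSum (fun n => κ n * PowerSeries.coeff l (psL (tt (Gs A B c) n)))
      (PowerSeries.coeff l τ) := by
    intro l
    have h1 := (H2_hasSum hk).mapL (innerSL ℂ (mulOp (fun θ => fourier (l : ℤ) θ) G))
    simp only [innerSL_apply_apply, inner_smul_right] at h1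
    rw [hτ, PowerSeries.coeff_mk]
    refine h1.congr_fun fun n => ?_
    congr 1
    rw [coeff_psL, ← inner_conj_symm, inner_tt, psL_ee, ← inner_conj_symm, ← coeff_psL,
      (hinf_fourier l).psL_mul hG, hGs, mul_comm]
  refine ⟨W, ?_, ?_, ?_, ?_⟩
  · refine (HbSet_closed g).mem_of_tendsto hW (Eventually.of_forall fun s => ?_)
    rw [← mem_HbSub g]
    exact Submodule.sum_mem _ fun n _ => Submodule.smul_mem _ _ ((mem_HbSub g _).mpr (VV_mem g hc hB n))
  · intro p hp
    rw [← inner_conj_symm]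
    have h1 := hW.mapL (innerSL ℂ p)
    simp only [innerSL_apply_apply, inner_smul_right] at h1
    have h2 : ∀ n, κ n * ⟪p, VV P A B c n⟫_ℂ = 0 := fun n => by
      rw [← inner_conj_symm, hp n]; simp
    simp only [h2] at h1
    rw [h1.unique hasSum_zero, map_zero]
  · ext j
    have h1 := (hW.mapL fstL).mapL (innerSL ℂ (ee j))
    simp only [map_smul, innerSL_apply_apply, smul_eq_mul] at h1
    have h2 := coeff_mul_hasSum (Os B c) hτs j
    rw [coeff_psL]
    refine h1.unique (h2.congr_fun fun n => ?_)
    rw [← psL_fst_VV hB, coeff_psL]; rfl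
  · ext j
    have h1 := (hW.mapL sndL).mapL (innerSL ℂ (ee j))
    simp only [map_smul, innerSL_apply_apply, smul_eq_mul] at h1
    have h2 := coeff_mul_hasSum A hτs j
    have h3 : HasSum (fun n => κ n * PowerSeries.coeff j ((PowerSeries.X : PowerSeries ℂ) ^ n))
        (PowerSeries.coeff j (psL k)) := by
      rw [coeff_psL]
      convert hasSum_single (f := fun n => κ n * PowerSeries.coeff j ((PowerSeries.X : PowerSeries ℂ) ^ n)) j ?_ using 1
      · simp [κ, PowerSeries.coeff_X_pow]
      · intro n hn; simp [PowerSeries.coeff_X_pow, hn.symm]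
    have h4 := (h2.sub h3).mul_left c
    rw [coeff_psL, PowerSeries.coeff_C_mul, map_sub]
    refine h1.unique (h4.congr_fun fun n => ?_)
    have : ⟪ee j, sndL (VV P A B c n)⟫_ℂ = PowerSeries.coeff j (psL (snd2 (VV P A B c n))) := by
      rw [coeff_psL]; rfl
    rw [this, psL_snd_VV g, PowerSeries.coeff_C_mul, map_sub]
    ring
end

/-- Fourier coefficients of `|G|²`. -/
def wG (G : L2) (n : ℤ) : ℂ := ∫ θ, conj (fourier n θ : ℂ) * ((‖(G : Tc → ℂ) θ‖ ^ 2 : ℝ) : ℂ) ∂m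

lemma inner_four (G : L2) (i j : ℤ) :
    ⟪mulOp (fun θ => fourier i θ) G, mulOp (fun θ => fourier j θ) G⟫_ℂ = wG G (i - j) := by
  rw [L2_inner, wG]
  refine integral_congr_ae ?_
  filter_upwards [mulOp_coe (Bdd.fourier i) G, mulOp_coe (Bdd.fourier j) G] with θ h1 h2
  rw [h1, h2, sub_eq_add_neg, fourier_add, fourier_neg]
  simp only [map_mul, Complex.conj_conj]
  rw [Complex.ofReal_pow, ← Complex.conj_mul']
  ring

section
variable {P : BPair} {A B : PowerSeries ℂ} {c : ℂ}

lemma ob_ae (hc : ‖c‖ = 1) : ∀ᵐ θ ∂m, ob P c θ ≠ 0 :=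
  (log_facts (f := fun z => 1 - c * P.b z) (M := 2)
    ((differentiableOn_const 1).sub (P.b_hol.const_mul c)) (fun z hz => by
      refine (norm_sub_le _ _).trans ?_
      rw [norm_mul, hc, norm_one]
      linarith [P.b_le_one z hz]) (ob_bdry P c) (ob_ne hc (by simp))).1

lemma G_ae (g : Good P A B) (hc : ‖c‖ = 1) (hB : PS P.b B) {G : L2} (hG : G ∈ H2)
    (hGs : psL G = Gs A B c) :
    ∀ᵐ θ ∂m, ‖P.as' θ‖ ^ 2 / ‖ob P c θ‖ ^ 2 = ‖(G : Tc → ℂ) θ‖ ^ 2 := by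
  have e0' : ee 0 ∈ H2 := H2_ee 0
  have e0 : psL (ee 0) = 1 := by simpa using psL_ee 0
  have h : mulOp (ob P c) G = mulOp P.as' (ee 0) := by
    refine psL_inj ((ob_hinf hB c).mul_mem hG) (g.hA.mul_mem e0') ?_
    rw [(ob_hinf hB c).psL_mul hG, g.hA.psL_mul e0', hGs, e0, mul_one, mul_comm, Gs_mul hc hB]
  have h1 := mulOp_coe (ob_hinf hB c).1 G
  rw [h] at h1
  filter_upwards [h1, bdd_toLp_coe g.hA.1, ob_ae (P := P) hc] with θ h2 h3 h4
  rw [← h3, h2, norm_mul, mul_pow]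
  have : ‖ob P c θ‖ ≠ 0 := norm_ne_zero_iff.mpr h4
  field_simp

lemma ac_wG (g : Good P A B) (hc : ‖c‖ = 1) (hB : PS P.b B) {G : L2} (hG : G ∈ H2)
    (hGs : psL G = Gs A B c) {μ : Measure Tc} [IsFiniteMeasure μ]
    (hμ : ∀ z ∈ uDisc, (uf P c z).re = ∫ θ, pk z θ ∂μ) (hac : μ ≪ m) (n : ℤ) :
    ∫ θ, conj (fourier n θ : ℂ) ∂μ = wG G n := by
  have : μ.HaveLebesgueDecomposition m := Measure.haveLebesgueDecomposition_of_sigmaFinite μ m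
  rw [← integral_rnDeriv_smul hac, wG]
  refine integral_congr_ae ?_
  filter_upwards [G_ae g hc hB hG hGs, ac_density hc hμ hac] with θ h1 h2
  rw [h2, h1, Complex.real_smul, mul_comm]

lemma ker_zero_of_w (g : Good P A B) (hc : ‖c‖ = 1) (hB : PS P.b B) {G : L2} (hG : G ∈ H2)
    (hGs : psL G = Gs A B c)
    (hw : ∀ n : ℕ, 1 ≤ n → wG G n = PowerSeries.coeff n (Os B c)⁻¹)
    (hw0 : wG G 0 = (uf P c 0).re) {p : HbP} (hp : p ∈ HbSet P)
    (hV : ∀ n, ⟪VV P A B c n, p⟫_ℂ = 0) : p = 0 := by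
  obtain ⟨hF, -, -⟩ := (mem_Hb_iff g p).mp hp
  set κ : ℂ := wG G 0 - PowerSeries.coeff 0 (Os B c)⁻¹ with hκ
  have hκ1 : 1 + κ ≠ 0 := by
    have h1 := (inv_PS hc hB).zero
    have h2 : (1 - c * P.b 0)⁻¹ ≠ 0 := inv_ne_zero (ob_ne hc (by simp))
    have h3 : 1 + κ = conj ((1 - c * P.b 0)⁻¹) := by
      rw [hκ, hw0, ← h1, uf]
      generalize (1 - c * P.b 0)⁻¹ = t
      apply Complex.ext
      · simp; ring
      · simp
    rw [h3]
    exact (map_ne_zero _).mpr h2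
  have hOi : Os B c * (Os B c)⁻¹ = 1 := PowerSeries.mul_inv_cancel _ (Os_ne hc hB)
  have key : ∀ M : ℕ, ⟪ee M, fst2 p⟫_ℂ = 0 := by
    intro M
    induction M using Nat.strong_induction_on with
    | _ M ih =>
    let q : L2 := ∑ j ∈ Finset.range M, wG G ((j : ℤ) - M) • ee j
    let h : L2 := κ • ee M + q
    have hq : q ∈ H2 := H2_sum _ _ fun j _ => H2_smul _ (H2_ee j)
    have hh : h ∈ H2 := H2_add (H2_smul _ (H2_ee M)) hq
    have hqc : ∀ j : ℕ, ⟪ee j, q⟫_ℂ = if j < M then wG G ((j : ℤ) - M) else 0 := by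
      intro j
      simp only [q, inner_sum, inner_smul_right, inner_ee_ee, Nat.cast_inj, mul_ite, mul_one,
        mul_zero, Finset.sum_ite_eq, Finset.mem_range]
    obtain ⟨W, hWm, hWp, hW1, hW2⟩ := Vsum g hc hB hG hGs ((hinf_fourier M).mul_mem hG)
    simp only [inner_four] at hW1 hW2
    have hτ : PowerSeries.mk (fun j : ℕ => wG G ((j : ℤ) - M))
        = PowerSeries.X ^ M * (Os B c)⁻¹ + psL h := by
      ext j
      rw [PowerSeries.coeff_mk, map_add, PowerSeries.coeff_X_pow_mul', coeff_psL]
      simp only [h, inner_add_right, inner_smul_right, hqc, inner_ee_ee, Nat.cast_inj]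
      rcases lt_trichotomy j M with hj | rfl | hj
      · rw [if_neg (by omega), if_neg (by omega), if_pos hj]; simp
      · simp [hκ]
      · rw [if_pos hj.le, if_neg (by omega), if_neg (by omega), ← hw (j - M) (by omega)]
        rw [Nat.cast_sub hj.le]; simp
    rw [hτ] at hW1 hW2
    obtain ⟨hWf, hWs, -⟩ := (mem_Hb_iff g W).mp hWm
    have e1 : fst2 W = ee M + mulOp (ob P c) h := by
      refine psL_inj hWf (H2_add (H2_ee M) ((ob_hinf hB c).mul_mem hh)) ?_
      rw [hW1, psL_add (ee M), psL_ee, (ob_hinf hB c).psL_mul hh]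
      linear_combination PowerSeries.X ^ M * hOi
    have e2 : snd2 W = c • mulOp P.as' h := by
      refine psL_inj hWs (H2_smul _ (g.hA.mul_mem hh)) ?_
      rw [hW2, psL_smul, g.hA.psL_mul hh, (hinf_fourier M).psL_mul hG, hGs]
      ring
    have e3 := hWp p hV
    rw [hbp_inner, e1, e2, ob_apply g, inner_add_left, inner_sub_left, inner_smul_left,
      inner_smul_left, Hb_orth g hp hh] at e3
    have e4 : ⟪ee M, fst2 p⟫_ℂ + ⟪h, fst2 p⟫_ℂ = 0 := by linear_combination e3
    have e5 : ⟪q, fst2 p⟫_ℂ = 0 := by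
      simp only [q, sum_inner, inner_smul_left]
      refine Finset.sum_eq_zero fun j hj => ?_
      rw [ih j (Finset.mem_range.mp hj), mul_zero]
    simp only [h, inner_add_left, inner_smul_left, e5] at e4
    have e6 : conj (1 + κ) * ⟪ee M, fst2 p⟫_ℂ = 0 := by
      rw [map_add, map_one]; linear_combination e4
    rcases mul_eq_zero.mp e6 with h' | h'
    · exact absurd h' ((map_ne_zero _).mpr hκ1)
    · exact h'
  have hz : (0 : HbP) ∈ HbSet P := (mem_HbSub g 0).mp (Submodule.zero_mem _)
  refine cyc_snd_unique g hp hz ?_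
  have : fst2 (0 : HbP) = 0 := rfl
  rw [this]
  refine psL_inj hF H2_zero ?_
  ext n
  rw [coeff_psL, coeff_psL, key, inner_zero_right]

lemma w_of_cyc (g : Good P A B) (hc : ‖c‖ = 1) (hB : PS P.b B) {G : L2} (hG : G ∈ H2)
    (hGs : psL G = Gs A B c)
    (hcyc : ∀ p ∈ HbSet P, (∀ n, ⟪VV P A B c n, p⟫_ℂ = 0) → p = 0) {n : ℕ} (hn : 1 ≤ n) :
    wG G n = PowerSeries.coeff n (Os B c)⁻¹ := by
  obtain ⟨k0, h1⟩ := one_mem g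
  have e0 : psL (ee 0) = 1 := by simpa using psL_ee 0
  have e0' : ee 0 ∈ H2 := H2_ee 0
  let k : L2 := G - (conj c * k0) • ee 0
  have hk : k ∈ H2 := H2_sub hG (H2_smul _ e0')
  have hpk : psL k = Gs A B c - PowerSeries.C (conj c) * PowerSeries.C k0 := by
    simp only [k]
    rw [psL_sub, psL_smul, e0, hGs, map_mul (PowerSeries.C : ℂ →+* PowerSeries ℂ), mul_one]
  obtain ⟨W, hWm, -, hW1, hW2⟩ := Vsum g hc hB hG hGs hk
  set τ := PowerSeries.mk (fun j : ℕ => ⟪mulOp (fun θ => fourier (j : ℤ) θ) G, k⟫_ℂ) with hτ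
  have hm : mkP (ee 0) (k0 • ee 0) - W ∈ HbSet P :=
    (mem_HbSub g _).mp (Submodule.sub_mem _ ((mem_HbSub g _).mpr h1) ((mem_HbSub g _).mpr hWm))
  have hz := hcyc _ hm (fun n => by
    rw [inner_sub_right, inner_VV g n h1, inner_VV g n hWm, hW1, hW2, fst2_mkP, snd2_mkP, psL_smul,
      e0, hpk, ← map_sub]
    have : Gs A B c * 1 - PowerSeries.C (conj c) * (PowerSeries.C k0 * 1) -
        (Gs A B c * (Os B c * τ) - PowerSeries.C (conj c) * (PowerSeries.C c * (A * τ -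
          (Gs A B c - PowerSeries.C (conj c) * PowerSeries.C k0)))) = 0 := by
      linear_combination (-τ) * Gs_mul (A := A) hc hB + (A * τ -
          (Gs A B c - PowerSeries.C (conj c) * PowerSeries.C k0)) * C_cc hc
    rw [this, map_zero])
  have h2 : fst2 W = ee 0 := by
    rw [← sub_eq_zero.mp hz, fst2_mkP]
  rw [h2, e0] at hW1
  have h3 : τ = (Os B c)⁻¹ := by
    rw [PowerSeries.eq_inv_iff_mul_eq_one (Os_ne hc hB), mul_comm]; exact hW1.symm
  rw [← h3, hτ, PowerSeries.coeff_mk]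
  simp only [k]
  rw [inner_sub_right, inner_smul_right, ← inner_conj_symm _ (ee 0)]
  have h4 : ⟪ee 0, mulOp (fun θ => fourier (n : ℤ) θ) G⟫_ℂ = 0 := by
    have := coeff_psL (mulOp (fun θ => fourier (n : ℤ) θ) G) 0
    rw [(hinf_fourier n).psL_mul hG, PowerSeries.coeff_X_pow_mul', if_neg (by omega)] at this
    simpa using this.symm
  rw [h4, map_zero, mul_zero, sub_zero]
  have h5 := inner_four G n 0
  rw [sub_zero] at h5
  rw [← h5]
  congr 1
  refine mulOp_ext (Bdd.fourier 0) ?_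
  exact Eventually.of_forall fun θ => by simp

lemma ac_of_w {G : L2} (hc : ‖c‖ = 1) (hB : PS P.b B)
    (hw : ∀ n : ℕ, 1 ≤ n → wG G n = PowerSeries.coeff n (Os B c)⁻¹)
    {μ : Measure Tc} [IsFiniteMeasure μ]
    (hμ : ∀ z ∈ uDisc, (uf P c z).re = ∫ θ, pk z θ ∂μ) : μ ≪ m := by
  have hintg : Integrable (fun θ => ‖(G : Tc → ℂ) θ‖ ^ 2) m := by
    have := (Lp.memLp G).integrable_norm_pow (by norm_num)
    simpa using this
  have hmeas : AEMeasurable (fun θ => ENNReal.ofReal (‖(G : Tc → ℂ) θ‖ ^ 2)) m :=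
    hintg.aestronglyMeasurable.aemeasurable.ennreal_ofReal
  let ρ : Measure Tc := m.withDensity (fun θ => ENNReal.ofReal (‖(G : Tc → ℂ) θ‖ ^ 2))
  have hρfin : IsFiniteMeasure ρ := isFiniteMeasure_withDensity_ofReal hintg.2
  have hρ : ∀ n : ℤ, ∫ θ, conj (fourier n θ : ℂ) ∂ρ = wG G n := by
    intro n
    simp only [ρ]
    rw [integral_withDensity_eq_integral_toReal_smul₀ hmeas (by simp), wG]
    congr 1; ext θ
    rw [ENNReal.toReal_ofReal (by positivity), Complex.real_smul, mul_comm]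
  have hfi : ∀ (n : ℤ) (σ : Measure Tc) [IsFiniteMeasure σ],
      Integrable (fun θ => conj (fourier n θ : ℂ)) σ := fun n σ _ =>
    (Complex.continuous_conj.comp (fourier n).continuous).integrable_of_hasCompactSupport
      (HasCompactSupport.of_compactSpace _)
  have hm1 : ∀ n : ℕ, 1 ≤ n → ∫ θ, conj (fourier (n : ℤ) θ : ℂ) ∂m = 0 := by
    intro n hn
    have := integral_fourier (-(n : ℤ))
    rw [if_neg (by omega)] at this
    rw [← this]
    congr 1; ext θ; rw [fourier_neg]
  have heq : μ + ρ univ • m = ρ + μ univ • m := by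
    have i1 : IsFiniteMeasure (ρ univ • m) := Measure.smul_finite m (measure_ne_top ρ univ)
    have i2 : IsFiniteMeasure (μ univ • m) := Measure.smul_finite m (measure_ne_top μ univ)
    refine measure_ext_fourier fun n => ?_
    rw [integral_add_measure (hfi _ _) (hfi _ _), integral_add_measure (hfi _ _) (hfi _ _),
      integral_smul_measure, integral_smul_measure]
    rcases Nat.eq_zero_or_pos n with rfl | hn
    · simp [Measure.real, add_comm]
    · rw [hm1 n hn, hρ, hw n hn, ac_coeff hc hB hμ hn, smul_zero, smul_zero]
  have hac : ρ + μ univ • m ≪ m :=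
    Measure.AbsolutelyContinuous.add_left (withDensity_absolutelyContinuous _ _)
      (Measure.smul_absolutelyContinuous)
  rw [← heq] at hac
  exact (Measure.absolutelyContinuous_of_le (Measure.le_add_right le_rfl)).trans hac

lemma case_eq (g : Good P A B) (hc : ‖c‖ = 1) (hB : PS P.b B) :
    (∀ p ∈ HbSet P, A * psL (fst2 p) + (B - PowerSeries.C (conj c)) * psL (snd2 p) = 0 → p = 0) ↔
      ∀ μ, IsACMeasure P (conj c) μ → μ ≪ m := by
  obtain ⟨G, hG, hGs⟩ := exists_gL (c := c) g hc hB
  have h0 : (∀ p ∈ HbSet P, A * psL (fst2 p) + (B - PowerSeries.C (conj c)) * psL (snd2 p) = 0 → p = 0)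
      ↔ ∀ p ∈ HbSet P, (∀ n, ⟪VV P A B c n, p⟫_ℂ = 0) → p = 0 :=
    forall_congr' fun p => forall_congr' fun hp => by rw [ker_VV g hc hB hp]
  rw [h0]
  constructor
  · intro h μ hμ
    rw [isAC_iff hc] at hμ
    obtain ⟨_, hμ⟩ := hμ
    exact ac_of_w hc hB (fun n hn => w_of_cyc g hc hB hG hGs h hn) hμ
  · intro h p hp hV
    obtain ⟨μ, hfin, hμ⟩ := ac_exists P hc
    have hac := h μ ((isAC_iff hc μ).mpr ⟨hfin, hμ⟩)
    refine ker_zero_of_w g hc hB hG hGs (fun n hn => ?_) ?_ hp hV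
    · rw [← ac_wG g hc hB hG hGs hμ hac, ac_coeff hc hB hμ hn]
    · rw [← ac_wG g hc hB hG hGs hμ hac, ← ac_zero hμ]
      simp
end

end

/-- Let `c ∈ ℂ`. The function `1 - c·b` is cyclic for `S_b` iff:
(i) `|c| < 1`; or (ii) `|c| = 1` and the Aleksandrov–Clark measure `μ_{conj c}` is absolutely
continuous w.r.t. `m`; or (iii) `|c| > 1` and `1 - c·b` is outer. -/
theorem stmt_14 (P : BPair) (c : ℂ) (q : HbP) (hq : q ∈ HbSet P)
    (hbd : (fst2 q : Tc → ℂ) =ᵐ[m] fun θ => 1 - c * P.bs θ) :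
    CyclicSb P q ↔
      (‖c‖ < 1 ∨
        (‖c‖ = 1 ∧ ∀ μ : Measure Tc, IsACMeasure P (conj c) μ → μ ≪ m) ∨
        (1 < ‖c‖ ∧ OuterFn (fun z => 1 - c * P.b z))) := by
  obtain ⟨A, B, g, -, hB, ha⟩ := P.exists_good
  rw [cyclic_iff g c q hq hbd]
  have hhol : HolDisc (fun z => 1 - c * P.b z) :=
    (differentiableOn_const 1).sub (P.b_hol.const_mul c)
  have hM : ∀ z ∈ uDisc, ‖1 - c * P.b z‖ ≤ 1 + ‖c‖ := fun z hz => by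
    refine (norm_sub_le _ _).trans ?_
    rw [norm_mul, norm_one]
    nlinarith [P.b_le_one z hz, norm_nonneg c]
  rcases lt_trichotomy ‖c‖ 1 with h | h | h
  · exact ⟨fun _ => Or.inl h, fun _ p hp hk => case_lt g ha h hp hk⟩
  · rw [case_eq g h hB]
    constructor
    · intro h1
      exact Or.inr (Or.inl ⟨h, h1⟩)
    · rintro (h1 | ⟨-, h1⟩ | ⟨h1, -⟩)
      · exact absurd h h1.ne
      · exact h1
      · exact absurd h h1.ne'
  · rw [case_gt g h]
    constructor
    · intro h1
      exact Or.inr (Or.inr ⟨h, cyc_outer hhol hM (ob_bdry P c) h1⟩)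
    · rintro (h1 | ⟨h1, -⟩ | ⟨-, h1⟩)
      · exact absurd h1 (not_lt.mpr h.le)
      · exact absurd h1 h.ne'
      · exact outer_cyc hhol hM (ob_bdry P c) h1


end
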